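/- arXiv:2303.09504 — 2 statements merged into one kernel-verified Lean document; each statement's English description precedes it below -/
import Mathlib

section
/- Let $A_\Gamma$ be an Artin group with standard generating set $X$ and Artin monoid $M$. If there exist pairwise distinct $a, b, c \in X$ such that $m(a,b)$, $m(b,c)$, and $m(a,c)$ are all finite, none of them equals $3$, and at most one of them equals $2$ (i.e., $\Gamma$ contains a triangle with no label equal to $3$ and at most one label equal to $2$), then the monoid Cayley graph $\mathrm{Cay}(A_\Gamma, M)$ has infinite diameter; that is, for every $n$ there is $g \in A_\Gamma$ with $d_M(e,g) > n$. -/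
/-- The alternating product `x y x y ⋯` of length `n` in the free group, starting with `x`. -/
def altProd {X : Type*} : ℕ → X → X → FreeGroup X
  | 0, _, _ => 1
  | n + 1, x, y => FreeGroup.of x * altProd n y x

/-- The Artin relations associated to a labelling `m : X → X → ℕ∞` (label `⊤` = no relation):
for each pair `x ≠ y` with finite label `k`, the relator `(xyx⋯)(yxy⋯)⁻¹` (both of length `k`). -/
def artinRels {X : Type*} (m : X → X → ℕ∞) : Set (FreeGroup X) :=
  { r | ∃ (x y : X) (k : ℕ), x ≠ y ∧ m x y = (k : ℕ∞) ∧
      r = altProd k x y * (altProd k y x)⁻¹ }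

/-- The Artin group of the labelled graph encoded by `m`. -/
abbrev ArtinGroup {X : Type*} (m : X → X → ℕ∞) : Type _ := PresentedGroup (artinRels m)

/-- The standard generators of the Artin group. -/
def artinGen {X : Type*} (m : X → X → ℕ∞) (x : X) : ArtinGroup m := PresentedGroup.of x

/-- The Artin monoid: the submonoid of the Artin group generated by the standard generators. -/
def artinMonoid {X : Type*} (m : X → X → ℕ∞) : Submonoid (ArtinGroup m) :=
  Submonoid.closure (Set.range (artinGen m))

/-- The monoid word metric on a group `G` relative to a submonoid `M`: `monoidDist M g h` is the
least `n` such that `g⁻¹ * h` is a product of `n` elements each lying in `M` or `M⁻¹`. -/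
noncomputable def monoidDist {G : Type*} [Group G] (M : Submonoid G) (g h : G) : ℕ :=
  sInf { n : ℕ | ∃ l : List G, l.length = n ∧ (∀ a ∈ l, a ∈ M ∨ a⁻¹ ∈ M) ∧ g⁻¹ * h = l.prod }

/-- A word over `X`: a list of letters `x^ε`, where `ε = true` denotes the positive letter `x`
and `ε = false` the negative letter `x⁻¹`. -/
abbrev Word (X : Type*) := List (X × Bool)

/-- The element of `G` represented by a word over `X`, given `f : X → G`. -/
def evalWord {X G : Type*} [Group G] (f : X → G) (w : Word X) : G :=
  (w.map (fun p => if p.2 then f p.1 else (f p.1)⁻¹)).prod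

/-- A word is positive if all its letters are positive. -/
def IsPosWord {X : Type*} (w : Word X) : Prop := ∀ p ∈ w, p.2 = true

/-- A word is negative if all its letters are negative. -/
def IsNegWord {X : Type*} (w : Word X) : Prop := ∀ p ∈ w, p.2 = false

/-- A word is geodesic if no strictly shorter word represents the same element of `G`. -/
def IsGeodesic {X G : Type*} [Group G] (f : X → G) (w : Word X) : Prop :=
  ∀ v : Word X, evalWord f v = evalWord f w → w.length ≤ v.length

/-- `(u, x)` is a blocking pair if for every word `w` such that `w ++ u` is geodesic,
the word `w ++ u ++ [x]` is also geodesic. -/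
def BlockingPair {X G : Type*} [Group G] (f : X → G) (u : Word X) (x : X × Bool) : Prop :=
  ∀ w : Word X, IsGeodesic f (w ++ u) → IsGeodesic f (w ++ u ++ [x])

/-- An alternating blocking sequence `(α n)` (indexed from `n = 1`; the value `α 0` is ignored):
each `α n` is nonempty, positive for odd `n` and negative for even `n`, and every letter `x`
of `α n` is immediately preceded, within `α (n-1) ++ α n` (with `α 0` read as the empty word),
by a subword `u` such that `(u, x)` is a blocking pair. -/
def IsAltBlockingSeq {X G : Type*} [Group G] (f : X → G) (α : ℕ → Word X) : Prop :=
  (∀ n, 1 ≤ n → α n ≠ []) ∧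
  (∀ n, 1 ≤ n → Odd n → IsPosWord (α n)) ∧
  (∀ n, 1 ≤ n → Even n → IsNegWord (α n)) ∧
  (∀ n, 1 ≤ n → ∀ p x s, α n = p ++ x :: s →
    ∃ u : Word X, u <:+ ((if n = 1 then ([] : Word X) else α (n - 1)) ++ p) ∧
      BlockingPair f u x)

/-- `u` is the longest positive (`ε = true`) resp. negative (`ε = false`) proper suffix of `w`. -/
def IsLongestSignedProperSuffix {X : Type*} (ε : Bool) (w u : Word X) : Prop :=
  u <:+ w ∧ u ≠ w ∧ (∀ p ∈ u, p.2 = ε) ∧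
    ∀ v : Word X, v <:+ w → v ≠ w → (∀ p ∈ v, p.2 = ε) → v.length ≤ u.length

/-- Preserved positive (`ε = true`) resp. negative (`ε = false`) suffixes: whenever `w` is a
geodesic word ending in a letter of sign `ε`, `u` is the longest proper suffix of `w` of sign `ε`,
and `a` is a generator, the element represented by `a^ε · w` admits a geodesic representative
having `u` as a suffix. -/
def PreservedSignSuffixes {X G : Type*} [Group G] (ε : Bool) (f : X → G) : Prop :=
  ∀ (w : Word X) (y : X), IsGeodesic f w → w.getLast? = some (y, ε) →
    ∀ u : Word X, IsLongestSignedProperSuffix ε w u →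
    ∀ a : X, ∃ w' : Word X, IsGeodesic f w' ∧
      evalWord f w' = evalWord f ((a, ε) :: w) ∧ u <:+ w'

/-- Preserved signed suffixes: both preserved positive and preserved negative suffixes. -/
def PreservedSignedSuffixes {X G : Type*} [Group G] (f : X → G) : Prop :=
  PreservedSignSuffixes true f ∧ PreservedSignSuffixes false f

/-! ### Sign changes in free groups -/

/-- The number of sign changes in the sequence `σ, ε₁, ε₂, …`, where the `εᵢ` are the signs of
the letters of the given word. -/
def signChanges {X : Type*} : Bool → Word X → ℕ
  | _, [] => 0
  | σ, p :: w => (if p.2 = σ then 0 else 1) + signChanges p.2 w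

lemma signChanges_le_add_one {X : Type*} (σ τ : Bool) (w : Word X) :
    signChanges σ w ≤ signChanges τ w + 1 := by
  cases w with
  | nil => simp [signChanges]
  | cons p w => simp only [signChanges]; split_ifs <;> omega

lemma signChanges_toWord_mk_mul_le {X : Type*} [DecidableEq X] (σ : Bool) (x : X)
    (f : FreeGroup X) :
    signChanges σ (FreeGroup.mk [(x, σ)] * f).toWord ≤ signChanges σ f.toWord := by
  have h : (FreeGroup.mk [(x, σ)] * f).toWord = FreeGroup.reduce ((x, σ) :: f.toWord) := by
    conv_lhs => rw [← FreeGroup.mk_toWord (x := f), FreeGroup.mul_mk, FreeGroup.toWord_mk]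
    simp
  rw [h, FreeGroup.reduce.cons, FreeGroup.reduce_toWord]
  rcases f.toWord with _ | ⟨p, w⟩
  · simp [signChanges]
  · dsimp only
    split_ifs with hp
    · have := signChanges_le_add_one σ p.2 w
      have hne : p.2 ≠ σ := by rw [hp.2]; cases p.2 <;> simp
      simp only [signChanges, hne, if_false]
      omega
    · simp [signChanges]

/-- The word `(y⁻¹ y⁻¹ x x)ⁿ`, with `x = true` and `y = false`. -/
def alternatingWord : ℕ → Word Bool
  | 0 => []
  | n + 1 => (false, false) :: (false, false) :: (true, true) :: (true, true) :: alternatingWord n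

lemma signChanges_alternatingWord (n : ℕ) : signChanges true (alternatingWord n) = 2 * n := by
  induction n with
  | zero => rfl
  | succ n ih => simp [alternatingWord, signChanges, ih]; omega

/-- The element `y⁻² x²` of the free group on `x = true` and `y = false`. -/
def alternatingElt : FreeGroup Bool :=
  (FreeGroup.of false)⁻¹ * (FreeGroup.of false)⁻¹ * (FreeGroup.of true * FreeGroup.of true)

lemma toWord_alternatingElt_pow (n : ℕ) : (alternatingElt ^ n).toWord = alternatingWord n := by
  induction n with
  | zero => simp [alternatingWord]
  | succ n ih =>
    have h : alternatingElt =
        FreeGroup.mk [(false, false), (false, false), (true, true), (true, true)] := rfl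
    have hred : FreeGroup.reduce (alternatingWord n) = alternatingWord n := by
      rw [← ih, FreeGroup.reduce_toWord]
    rw [pow_succ', ← FreeGroup.mk_toWord (x := alternatingElt ^ n), ih, h, FreeGroup.mul_mk,
      FreeGroup.toWord_mk]
    simp only [List.cons_append, List.nil_append, FreeGroup.reduce.cons, hred]
    cases n <;> simp [alternatingWord]

/-! ### Wall crossings

A reflection group `W` with generating involutions `ρ x` and two reflections `r₁`, `r₂` which lie
in no common finite dihedral residue give an action of the Artin group on `FreeGroup Bool × W`,
recording the crossings of the two corresponding walls. -/

section WallCrossing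

open Classical in
/-- The free generator recording the crossing of the wall of `t`, if it is that of `r₁` or `r₂`. -/
noncomputable def wallLabel {W : Type*} (r₁ r₂ t : W) : FreeGroup Bool :=
  if t = r₁ then FreeGroup.of true else if t = r₂ then FreeGroup.of false else 1

lemma wallLabel_eq {W : Type*} (r₁ r₂ t : W) :
    wallLabel r₁ r₂ t = 1 ∨ ∃ i, wallLabel r₁ r₂ t = FreeGroup.of i := by
  unfold wallLabel; split_ifs <;> simp

variable {X W : Type*} [Group W]

/-- Applying the generator `x` in the state `w`, recording the wall crossed. -/
noncomputable def crossPerm (ρ : X → W) (hρ : ∀ x, ρ x * ρ x = 1) (r₁ r₂ : W) (x : X) :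
    Equiv.Perm (FreeGroup Bool × W) where
  toFun z := (wallLabel r₁ r₂ (z.2⁻¹ * ρ x * z.2) * z.1, ρ x * z.2)
  invFun z := ((wallLabel r₁ r₂ (z.2⁻¹ * ρ x * z.2))⁻¹ * z.1, ρ x * z.2)
  left_inv z := by
    have h := inv_eq_of_mul_eq_one_left (hρ x)
    ext1 <;> simp [mul_assoc, h, ← mul_assoc (ρ x) (ρ x), hρ]
  right_inv z := by
    have h := inv_eq_of_mul_eq_one_left (hρ x)
    ext1 <;> simp [mul_assoc, h, ← mul_assoc (ρ x) (ρ x), hρ]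

lemma lift_altProd_mul_inv (ρ : X → W) (hρ : ∀ x, ρ x * ρ x = 1) (n : ℕ) (x y : X) :
    FreeGroup.lift ρ (altProd n x y) * (FreeGroup.lift ρ (altProd n y x))⁻¹ =
      (ρ x * ρ y) ^ n := by
  induction n generalizing x y with
  | zero => simp [altProd]
  | succ n ih =>
    have hy := inv_eq_of_mul_eq_one_left (hρ y)
    simp only [altProd, map_mul, FreeGroup.lift_apply_of, mul_inv_rev, hy]
    calc _ = ρ x * (FreeGroup.lift ρ (altProd n y x) *
          (FreeGroup.lift ρ (altProd n x y))⁻¹) * ρ y := by group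
      _ = _ := by rw [ih, ← mul_pow_mul, pow_succ, mul_assoc]

lemma lift_crossPerm_altProd (ρ : X → W) (hρ : ∀ x, ρ x * ρ x = 1) (r₁ r₂ : W) (n : ℕ) (x y : X)
    (f : FreeGroup Bool) (w u : W) (hu : u = FreeGroup.lift ρ (altProd n x y) * w) :
    FreeGroup.lift (crossPerm ρ hρ r₁ r₂) (altProd n x y) (f, w) =
      (((List.range n).map
        fun j => wallLabel r₁ r₂ (u⁻¹ * ((ρ x * ρ y) ^ j * ρ x) * u)).prod * f, u) := by
  induction n generalizing x y u with
  | zero => simp [altProd, hu]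
  | succ n ih =>
    have hx := inv_eq_of_mul_eq_one_left (hρ x)
    have hu' : ρ x * u = FreeGroup.lift ρ (altProd n y x) * w := by
      rw [hu]; simp [altProd, ← mul_assoc, hρ]
    have hconj (j : ℕ) : (ρ x * u)⁻¹ * ((ρ y * ρ x) ^ j * ρ y) * (ρ x * u) =
        u⁻¹ * ((ρ x * ρ y) ^ (j + 1) * ρ x) * u := by
      rw [mul_pow_mul (ρ x) (ρ y), pow_succ]
      simp only [mul_inv_rev, hx, mul_assoc]
    rw [altProd, map_mul, FreeGroup.lift_apply_of, Equiv.Perm.mul_apply, ih y x _ hu',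
      List.prod_range_succ']
    simp only [hconj]
    ext1
    · simp [crossPerm, mul_assoc, hx, ← mul_assoc (ρ x) (ρ x), hρ]
    · simp [crossPerm, ← mul_assoc, hρ]

/-- If `r₁ r₂` has infinite order, then a finite dihedral residue meets at most one of the two
walls. -/
lemma exists_wallLabel_eq_pow {s t : W} (hs : s * s = 1) (ht : t * t = 1) {k : ℕ} (hk : 0 < k)
    (hst : (s * t) ^ k = 1) {r₁ r₂ : W} (hr : ∀ n : ℕ, 0 < n → (r₁ * r₂) ^ n ≠ 1) (u : W) :
    ∃ (q : FreeGroup Bool) (e : ℕ → ℕ), ∀ j,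
      wallLabel r₁ r₂ (u⁻¹ * ((s * t) ^ j * s) * u) = q ^ e j := by
  classical
  have hs' := inv_eq_of_mul_eq_one_left hs
  have ht' := inv_eq_of_mul_eq_one_left ht
  set R : ℕ → W := fun j => u⁻¹ * ((s * t) ^ j * s) * u with hR
  have hsemi (j : ℕ) : s * (s * t) ^ j * s = ((s * t) ^ j)⁻¹ := by
    have := conj_pow (a := s) (b := s * t) (i := j)
    rw [hs'] at this
    rw [← this, ← inv_pow, mul_inv_rev, hs', ht']
    simp [← mul_assoc, hs]
  have hRR (i j : ℕ) : R i * R j = u⁻¹ * ((s * t) ^ i * ((s * t) ^ j)⁻¹) * u := by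
    rw [← hsemi]; simp [hR, mul_assoc]
  have hnot (i j : ℕ) (h₁ : R i = r₁) (h₂ : R j = r₂) : False := by
    refine hr k hk ?_
    have hc : Commute ((s * t) ^ i) ((s * t) ^ j)⁻¹ :=
      ((Commute.refl (s * t)).pow_pow i j).inv_right
    have hconj := conj_pow (a := u⁻¹) (b := (s * t) ^ i * ((s * t) ^ j)⁻¹) (i := k)
    rw [inv_inv] at hconj
    rw [← h₁, ← h₂, hRR, hconj, hc.mul_pow, inv_pow, ← pow_mul, ← pow_mul, mul_comm i,
      mul_comm j, pow_mul, pow_mul, hst]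
    simp
  by_cases h : ∃ i, R i = r₁
  · obtain ⟨i, hi⟩ := h
    refine ⟨FreeGroup.of true, fun j => if R j = r₁ then 1 else 0, fun j => ?_⟩
    have h₂ : R j ≠ r₂ := fun h₂ => hnot i j hi h₂
    change wallLabel r₁ r₂ (R j) = _
    unfold wallLabel
    split_ifs <;> simp_all
  · push Not at h
    refine ⟨FreeGroup.of false, fun j => if R j = r₂ then 1 else 0, fun j => ?_⟩
    change wallLabel r₁ r₂ (R j) = _
    unfold wallLabel
    simp only [h j, if_false]
    split_ifs <;> simp

/-- Such a dihedral residue is crossed with the same labels along either side. -/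
lemma prod_wallLabel_eq {s t : W} (hs : s * s = 1) (ht : t * t = 1) {k : ℕ} (hk : 0 < k)
    (hst : (s * t) ^ k = 1) {r₁ r₂ : W} (hr : ∀ n : ℕ, 0 < n → (r₁ * r₂) ^ n ≠ 1) (u : W) :
    ((List.range k).map fun j => wallLabel r₁ r₂ (u⁻¹ * ((s * t) ^ j * s) * u)).prod =
      ((List.range k).map fun j => wallLabel r₁ r₂ (u⁻¹ * ((t * s) ^ j * t) * u)).prod := by
  obtain ⟨q, e, he⟩ := exists_wallLabel_eq_pow hs ht hk hst hr u
  have hs' := inv_eq_of_mul_eq_one_left hs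
  have ht' := inv_eq_of_mul_eq_one_left ht
  have hprod (g : ℕ → ℕ) (n : ℕ) :
      ((List.range n).map fun j => q ^ g j).prod = q ^ ∑ j ∈ Finset.range n, g j := by
    induction n with
    | zero => simp
    | succ n ih => rw [List.prod_range_succ, ih, Finset.sum_range_succ, pow_add]
  have hrev (j : ℕ) (hj : j < k) : (t * s) ^ j * t = (s * t) ^ (k - 1 - j) * s := by
    have hinv : (t * s) ^ j = ((s * t) ^ j)⁻¹ := by rw [← inv_pow, mul_inv_rev, hs', ht']
    have hkj : (s * t) ^ (j + 1) * (s * t) ^ (k - 1 - j) = 1 := by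
      rw [← pow_add, ← hst]; congr 1; omega
    rw [hinv, eq_inv_of_mul_eq_one_right hkj, pow_succ', mul_inv_rev, mul_inv_rev, hs', ht']
    simp [mul_assoc, hs]
  have hrev' : ((List.range k).map fun j => wallLabel r₁ r₂ (u⁻¹ * ((t * s) ^ j * t) * u)) =
      (List.range k).map fun j => q ^ e (k - 1 - j) := by
    refine List.map_congr_left fun j hj => ?_
    rw [hrev j (List.mem_range.mp hj), he]
  simp only [hrev', he, hprod, Finset.sum_range_reflect]

end WallCrossing

/-- The generators `ρ x` of `W` are involutions satisfying the relations of the Coxeter group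
of `m`. -/
structure IsCoxeterFamily {X W : Type*} [Group W] (m : X → X → ℕ∞) (ρ : X → W) : Prop where
  mul_self : ∀ x, ρ x * ρ x = 1
  mul_pow : ∀ x y (k : ℕ), x ≠ y → m x y = k → (ρ x * ρ y) ^ k = 1

section Action

variable {X W : Type*} [Group W] {m : X → X → ℕ∞} {ρ : X → W} {r₁ r₂ : W}

/-- The action of the Artin group on `FreeGroup Bool × W` by wall crossings. -/
noncomputable def crossHom (hm : ∀ x y : X, x ≠ y → 2 ≤ m x y) (hρ : IsCoxeterFamily m ρ)
    (hr : ∀ n : ℕ, 0 < n → (r₁ * r₂) ^ n ≠ 1) :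
    ArtinGroup m →* Equiv.Perm (FreeGroup Bool × W) :=
  PresentedGroup.toGroup (f := crossPerm ρ hρ.mul_self r₁ r₂) <| by
    rintro _ ⟨x, y, k, hxy, hk, rfl⟩
    have hk0 : 0 < k := by
      have := hm x y hxy
      rw [hk] at this
      have : 2 ≤ k := by exact_mod_cast this
      omega
    rw [map_mul, map_inv, mul_inv_eq_one]
    ext1 ⟨f, w⟩
    have hpow := hρ.mul_pow x y k hxy hk
    have hW : FreeGroup.lift ρ (altProd k x y) = FreeGroup.lift ρ (altProd k y x) := by
      rw [← mul_inv_eq_one, lift_altProd_mul_inv ρ hρ.mul_self, hpow]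
    rw [lift_crossPerm_altProd ρ hρ.mul_self r₁ r₂ k x y f w _ rfl,
      lift_crossPerm_altProd ρ hρ.mul_self r₁ r₂ k y x f w _ (congrArg (· * w) hW),
      prod_wallLabel_eq (hρ.mul_self x) (hρ.mul_self y) hk0 hpow hr]

lemma crossHom_gen (hm : ∀ x y : X, x ≠ y → 2 ≤ m x y) (hρ : IsCoxeterFamily m ρ)
    (hr : ∀ n : ℕ, 0 < n → (r₁ * r₂) ^ n ≠ 1) (x : X) :
    crossHom hm hρ hr (artinGen m x) = crossPerm ρ hρ.mul_self r₁ r₂ x :=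
  PresentedGroup.toGroup.of _

/-- The number of sign changes in the recorded label, started from the sign `σ`. -/
def labelSignChanges (σ : Bool) (z : FreeGroup Bool × W) : ℕ := signChanges σ z.1.toWord

lemma labelSignChanges_crossPerm_le (hρ : ∀ x, ρ x * ρ x = 1) (x : X)
    (z : FreeGroup Bool × W) :
    labelSignChanges true (crossPerm ρ hρ r₁ r₂ x z) ≤ labelSignChanges true z := by
  change signChanges true (wallLabel r₁ r₂ (z.2⁻¹ * ρ x * z.2) * z.1).toWord ≤ _
  rcases wallLabel_eq r₁ r₂ (z.2⁻¹ * ρ x * z.2) with h | ⟨i, h⟩ <;> rw [h]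
  · simp [labelSignChanges]
  · exact signChanges_toWord_mk_mul_le true i z.1

lemma labelSignChanges_le_crossPerm (hρ : ∀ x, ρ x * ρ x = 1) (x : X)
    (z : FreeGroup Bool × W) :
    labelSignChanges false z ≤ labelSignChanges false (crossPerm ρ hρ r₁ r₂ x z) := by
  change _ ≤ signChanges false (wallLabel r₁ r₂ (z.2⁻¹ * ρ x * z.2) * z.1).toWord
  rcases wallLabel_eq r₁ r₂ (z.2⁻¹ * ρ x * z.2) with h | ⟨i, h⟩ <;> rw [h]
  · simp [labelSignChanges]
  · have h' := signChanges_toWord_mk_mul_le false i (FreeGroup.of i * z.1)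
    have : FreeGroup.mk [(i, false)] * (FreeGroup.of i * z.1) = z.1 :=
      inv_mul_cancel_left (FreeGroup.of i) z.1
    rwa [this] at h'

variable (hm : ∀ x y : X, x ≠ y → 2 ≤ m x y) (hρ : IsCoxeterFamily m ρ)
  (hr : ∀ n : ℕ, 0 < n → (r₁ * r₂) ^ n ≠ 1)

lemma labelSignChanges_crossHom_of_mem {g : ArtinGroup m} (hg : g ∈ artinMonoid m)
    (z : FreeGroup Bool × W) :
    labelSignChanges true (crossHom hm hρ hr g z) ≤ labelSignChanges true z ∧
      labelSignChanges false z ≤ labelSignChanges false (crossHom hm hρ hr g z) := by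
  induction hg using Submonoid.closure_induction generalizing z with
  | mem g hg =>
    obtain ⟨x, rfl⟩ := hg
    rw [crossHom_gen]
    exact ⟨labelSignChanges_crossPerm_le _ x z, labelSignChanges_le_crossPerm _ x z⟩
  | one => simp
  | mul g h _ _ ihg ihh =>
    rw [map_mul, Equiv.Perm.mul_apply]
    exact ⟨(ihg _).1.trans (ihh z).1, (ihh z).2.trans (ihg _).2⟩

lemma labelSignChanges_crossHom_list_prod (l : List (ArtinGroup m))
    (hl : ∀ g ∈ l, g ∈ artinMonoid m ∨ g⁻¹ ∈ artinMonoid m) (z : FreeGroup Bool × W) :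
    labelSignChanges true (crossHom hm hρ hr l.prod z) ≤
      labelSignChanges true z + 2 * l.length := by
  induction l with
  | nil => simp
  | cons g l ih =>
    have ih' := ih fun h hh => hl h (List.mem_cons_of_mem _ hh)
    rw [List.prod_cons, map_mul, Equiv.Perm.mul_apply, List.length_cons]
    set z' := crossHom hm hρ hr l.prod z
    rcases hl g List.mem_cons_self with hg | hg
    · have := (labelSignChanges_crossHom_of_mem hm hρ hr hg z').1
      omega
    · clear_value z'
      have h := (labelSignChanges_crossHom_of_mem hm hρ hr hg (crossHom hm hρ hr g z')).2
      rw [← Equiv.Perm.mul_apply, ← map_mul, inv_mul_cancel, map_one, Equiv.Perm.one_apply] at h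
      have h₁ := signChanges_le_add_one true false (crossHom hm hρ hr g z').1.toWord
      have h₂ := signChanges_le_add_one false true z'.1.toWord
      simp only [labelSignChanges] at *
      omega

end Action

lemma exists_list_of_artinGroup {X : Type*} {m : X → X → ℕ∞} (g : ArtinGroup m) :
    ∃ l : List (ArtinGroup m),
      (∀ h ∈ l, h ∈ artinMonoid m ∨ h⁻¹ ∈ artinMonoid m) ∧ g = l.prod := by
  have hg : g ∈ Submonoid.closure (Set.range (artinGen m) ∪ (Set.range (artinGen m))⁻¹) := by
    have h : Subgroup.closure (Set.range (artinGen m)) = ⊤ :=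
      PresentedGroup.closure_range_of (artinRels m)
    rw [← Subgroup.closure_toSubmonoid, h]
    trivial
  obtain ⟨l, hl, rfl⟩ := Submonoid.exists_list_of_mem_closure hg
  exact ⟨l, fun h hh => (hl h hh).imp (fun h => Submonoid.subset_closure h)
    fun h => Submonoid.subset_closure h, rfl⟩

/-- If some quotient of the Coxeter group contains generators `a, b, c` such that the product of
the reflections `a` and `cbc` has infinite order, but `ab` has finite order, then the monoid Cayley
graph has infinite diameter. -/
theorem exists_lt_monoidDist_of_infinite_order {X W : Type*} [Group W] {m : X → X → ℕ∞}
    {ρ : X → W} (hm : ∀ x y : X, x ≠ y → 2 ≤ m x y) (hρ : IsCoxeterFamily m ρ) {a b c : X}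
    (hab : ∃ k : ℕ, 0 < k ∧ (ρ a * ρ b) ^ k = 1)
    (hr : ∀ n : ℕ, 0 < n → (ρ a * (ρ c * ρ b * ρ c)) ^ n ≠ 1) (n : ℕ) :
    ∃ g : ArtinGroup m, n < monoidDist (artinMonoid m) 1 g := by
  obtain ⟨k, hk, habk⟩ := hab
  have hinv (x : X) : (ρ x)⁻¹ = ρ x := inv_eq_of_mul_eq_one_left (hρ.mul_self x)
  have hca : ρ c ≠ ρ a := fun h => hr k hk <| by
    have hba : ρ a * (ρ c * ρ b * ρ c) = (ρ a * ρ b)⁻¹ := by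
      rw [h, mul_inv_rev, hinv, hinv, ← mul_assoc, ← mul_assoc, hρ.mul_self, one_mul]
    rw [hba, inv_pow, habk, inv_one]
  have hcb : ρ c ≠ ρ c * ρ b * ρ c := fun h => hr k hk <| by
    have hbc : ρ b * ρ c = 1 := by simpa [mul_assoc] using h
    rwa [mul_assoc, hbc, mul_one, ← hinv c, ← eq_inv_of_mul_eq_one_left hbc]
  have hne : ρ c * ρ b * ρ c ≠ ρ a := fun h => hr 1 one_pos <| by
    rw [h, hρ.mul_self, one_pow]
  set Φ := crossHom hm hρ hr with hΦ
  have hΦs (x : X) (f : FreeGroup Bool) (w : W) : Φ (artinGen m x) (f, w) =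
      (wallLabel (ρ a) (ρ c * ρ b * ρ c) (w⁻¹ * ρ x * w) * f, ρ x * w) := by
    rw [hΦ, crossHom_gen]; rfl
  have hΦs' (x : X) (f : FreeGroup Bool) (w : W) : Φ (artinGen m x)⁻¹ (f, w) =
      ((wallLabel (ρ a) (ρ c * ρ b * ρ c) (w⁻¹ * ρ x * w))⁻¹ * f, ρ x * w) := by
    rw [hΦ, map_inv, crossHom_gen]; rfl
  set A := artinGen m a
  set B := artinGen m b
  set C := artinGen m c
  have hstep (f : FreeGroup Bool) :
      Φ (C * B⁻¹ * B⁻¹ * C⁻¹ * (A * A)) (f, 1) = (alternatingElt * f, 1) := by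
    have hA (f : FreeGroup Bool) : Φ A (f, 1) = (FreeGroup.of true * f, ρ a) := by
      rw [hΦs]; simp [wallLabel]
    have hA' (f : FreeGroup Bool) : Φ A (f, ρ a) = (FreeGroup.of true * f, 1) := by
      rw [hΦs]; simp [wallLabel, hρ.mul_self]
    have hB (f : FreeGroup Bool) :
        Φ B⁻¹ (f, ρ c) = ((FreeGroup.of false)⁻¹ * f, ρ b * ρ c) := by
      rw [hΦs']; simp [wallLabel, hinv, hne]
    have hB' (f : FreeGroup Bool) :
        Φ B⁻¹ (f, ρ b * ρ c) = ((FreeGroup.of false)⁻¹ * f, ρ c) := by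
      rw [hΦs']
      simp [wallLabel, ← mul_assoc, hinv, hne, hρ.mul_self, mul_assoc (ρ c * ρ b) (ρ b) (ρ b)]
    have hC (f : FreeGroup Bool) : Φ C⁻¹ (f, 1) = (f, ρ c) := by
      rw [hΦs']; simp [wallLabel, hca, hcb]
    have hC' (f : FreeGroup Bool) : Φ C (f, ρ c) = (f, 1) := by
      rw [hΦs]; simp [wallLabel, hca, hcb, hρ.mul_self]
    simp only [map_mul Φ, Equiv.Perm.mul_apply, hA, hA', hB, hB', hC, hC', alternatingElt,
      mul_assoc]
  have hpow (N : ℕ) :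
      Φ ((C * B⁻¹ * B⁻¹ * C⁻¹ * (A * A)) ^ N) (1, 1) = (alternatingElt ^ N, 1) := by
    induction N with
    | zero => simp
    | succ N ih => rw [pow_succ', map_mul, Equiv.Perm.mul_apply, ih, hstep, pow_succ']
  refine ⟨(C * B⁻¹ * B⁻¹ * C⁻¹ * (A * A)) ^ (n + 1), ?_⟩
  obtain ⟨l, hl, hg⟩ := exists_list_of_artinGroup ((C * B⁻¹ * B⁻¹ * C⁻¹ * (A * A)) ^ (n + 1))
  refine Nat.lt_of_succ_le (le_csInf ⟨l.length, l, rfl, hl, by rw [inv_one, one_mul, hg]⟩ ?_)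
  rintro _ ⟨l, rfl, hl, hg⟩
  have h := labelSignChanges_crossHom_list_prod hm hρ hr l hl (1, 1)
  rw [← hg, inv_one, one_mul, ← hΦ, hpow] at h
  simp only [labelSignChanges, toWord_alternatingElt_pow, signChanges_alternatingWord,
    FreeGroup.toWord_one, signChanges] at h
  omega

/-! ### The geometric representation -/

section GeometricRepresentation

variable {X : Type*} (m : X → X → ℕ∞)

open Classical in
/-- Twice the Gram matrix of the geometric representation. For `m x y = ⊤` the angle is
`π / 0 = 0`, so that the entry is `-2`. -/
noncomputable def gramEntry (x y : X) : ℝ :=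
  if x = y then 2 else -2 * Real.cos (Real.pi / (m x y).toNat)

lemma gramEntry_self (x : X) : gramEntry m x x = 2 := by simp [gramEntry]

/-- Twice the pairing with a simple root. -/
noncomputable def coroot (x : X) : Module.Dual ℝ (X →₀ ℝ) :=
  Finsupp.linearCombination ℝ (gramEntry m x)

lemma coroot_single (x y : X) : coroot m x (Finsupp.single y 1) = gramEntry m x y := by
  simp [coroot]

lemma coroot_single_self (x : X) : coroot m x (Finsupp.single x 1) = 2 := by
  rw [coroot_single, gramEntry_self]

/-- The simple reflections of the geometric representation. -/
noncomputable def simpleReflection (x : X) : (X →₀ ℝ) ≃ₗ[ℝ] (X →₀ ℝ) :=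
  Module.reflection (coroot_single_self m x)

lemma simpleReflection_apply (x : X) (v : X →₀ ℝ) :
    simpleReflection m x v = v - coroot m x v • Finsupp.single x 1 := rfl

variable {m}

lemma gramEntry_comm (hsymm : ∀ x y : X, m x y = m y x) (x y : X) :
    gramEntry m x y = gramEntry m y x := by
  rcases eq_or_ne x y with rfl | h
  · rfl
  · simp [gramEntry, hsymm x y, h, h.symm]

lemma gramEntry_nonpos (hm : ∀ x y : X, x ≠ y → 2 ≤ m x y) {x y : X} (hxy : x ≠ y) :
    gramEntry m x y ≤ 0 := by
  have hpi := Real.pi_pos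
  have hcos : 0 ≤ Real.cos (Real.pi / (m x y).toNat) := by
    rcases eq_or_ne (m x y) ⊤ with h | h
    · simp [h]
    · have h2 : 2 ≤ (m x y).toNat := by
        have := hm x y hxy
        rw [← ENat.natCast_toNat h] at this
        exact_mod_cast this
      have h2' : (2 : ℝ) ≤ (m x y).toNat := by exact_mod_cast h2
      exact Real.cos_nonneg_of_neg_pi_div_two_le_of_le
        (by have : 0 ≤ Real.pi / (m x y).toNat := by positivity
            linarith) (div_le_div_of_nonneg_left hpi.le two_pos h2')
  simp only [gramEntry, hxy, if_false]
  linarith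

lemma gramEntry_le_neg_sqrt_two {x y : X} (hxy : x ≠ y) (h4 : 4 ≤ m x y) :
    gramEntry m x y ≤ -√2 := by
  have hpi := Real.pi_pos
  have hcos : √2 / 2 ≤ Real.cos (Real.pi / (m x y).toNat) := by
    rw [← Real.cos_pi_div_four]
    rcases eq_or_ne (m x y) ⊤ with h | h
    · simpa [h, Real.cos_pi_div_four] using Real.cos_le_one (Real.pi / 4)
    · have h4' : 4 ≤ (m x y).toNat := by
        rw [← ENat.natCast_toNat h] at h4
        exact_mod_cast h4
      have h4'' : (4 : ℝ) ≤ (m x y).toNat := by exact_mod_cast h4'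
      exact Real.cos_le_cos_of_nonneg_of_le_pi (by positivity) (by linarith)
        (div_le_div_of_nonneg_left hpi.le four_pos h4'')
  simp only [gramEntry, hxy, if_false]
  linarith

lemma simpleReflection_mul_pow (hsymm : ∀ x y : X, m x y = m y x)
    {x y : X} {k : ℕ} (hk : 2 ≤ k) (hxy : x ≠ y) (hmk : m x y = k) :
    (simpleReflection m x * simpleReflection m y) ^ k = 1 := by
  have hpi := Real.pi_pos
  have hxy' : gramEntry m x y = -2 * Real.cos (Real.pi / k) := by simp [gramEntry, hxy, hmk]
  have hyx' : gramEntry m y x = -2 * Real.cos (Real.pi / k) := by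
    rw [gramEntry_comm hsymm, hxy']
  rcases hk.eq_or_lt with rfl | hk
  · have h₁ : gramEntry m x y = 0 := by rw [hxy']; simp
    have h₂ : gramEntry m y x = 0 := by rw [hyx']; simp
    ext1 v
    simp only [pow_two, LinearEquiv.mul_apply, simpleReflection_apply, map_sub, map_smul,
      coroot_single, gramEntry_self, h₁, h₂, LinearEquiv.coe_one, id_eq]
    module
  set θ : ℝ := 2 * (Real.pi / k) with hθ
  have hk0 : (0 : ℝ) < k := by positivity
  have hkθ : k * θ = 2 * Real.pi := by rw [hθ]; field_simp
  have hk2 : (2 : ℝ) < k := by exact_mod_cast hk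
  have hsin : Real.sin θ ≠ 0 := by
    refine (Real.sin_pos_of_pos_of_lt_pi (by positivity) ?_).ne'
    nlinarith
  have ht : 2 * Real.cos θ = coroot m x (Finsupp.single y 1) * coroot m y (Finsupp.single x 1)
      - 2 := by
    rw [coroot_single, coroot_single, hxy', hyx', hθ, Real.cos_two_mul]; ring
  have hS (i : ℤ) := Polynomial.Chebyshev.S_two_mul_real_cos θ i
  ext1 v
  refine (Module.reflection_mul_reflection_pow_apply (coroot_single_self m x)
    (coroot_single_self m y) k v _ ht).trans ?_
  have hadd (i j : ℤ) (hij : i + j + 2 = k) :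
      (Polynomial.Chebyshev.S ℝ i).eval (2 * Real.cos θ) +
        (Polynomial.Chebyshev.S ℝ j).eval (2 * Real.cos θ) = 0 := by
    refine (mul_eq_zero.mp ?_).resolve_right hsin
    have hj : ((j : ℝ) + 1) * θ = 2 * Real.pi - (i + 1) * θ := by
      have : (j : ℝ) = k - 2 - i := by
        have : (i : ℝ) + j + 2 = k := by exact_mod_cast hij
        linarith
      rw [this, ← hkθ]; ring
    rw [add_mul, hS, hS, hj, Real.sin_two_pi_sub, add_neg_cancel]
  rcases Nat.even_or_odd' k with ⟨l, hl | hl⟩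
  · have h₁ : ((k : ℤ) - 2) / 2 = l - 1 := by omega
    have h₂ : ((k : ℤ) - 1) / 2 = l - 1 := by omega
    have h := hadd (l - 1) (l - 1) (by omega)
    have h0 : (Polynomial.Chebyshev.S ℝ (l - 1)).eval (2 * Real.cos θ) = 0 := by linarith
    rw [h₁, h₂, h0]
    simp
  · have h₁ : ((k : ℤ) - 3) / 2 = l - 1 := by omega
    have h₂ : ((k : ℤ) - 1) / 2 = l := by omega
    have h₃ : ((k : ℤ) - 2) / 2 = l - 1 := by omega
    have h₄ : (k : ℤ) / 2 = l := by omega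
    rw [h₁, h₂, h₃, h₄, hadd l (l - 1) (by omega)]
    simp

lemma isCoxeterFamily_simpleReflection (hsymm : ∀ x y : X, m x y = m y x)
    (hm : ∀ x y : X, x ≠ y → 2 ≤ m x y) : IsCoxeterFamily m (simpleReflection m) where
  mul_self x := by
    ext1 v
    exact Module.involutive_reflection (coroot_single_self m x) v
  mul_pow x y k hxy hk := by
    refine simpleReflection_mul_pow hsymm ?_ hxy hk
    have := hm x y hxy
    rw [hk] at this
    exact_mod_cast this

lemma simpleReflection_infinite_order (hsymm : ∀ x y : X, m x y = m y x)
    (hm : ∀ x y : X, x ≠ y → 2 ≤ m x y) {a b c : X} (hab : a ≠ b) (hbc : b ≠ c) (hac : a ≠ c)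
    (hbc4 : 4 ≤ m b c) (hac4 : 4 ≤ m a c) (n : ℕ) (hn : 0 < n) :
    (simpleReflection m a * (simpleReflection m c * simpleReflection m b *
      simpleReflection m c)) ^ n ≠ 1 := by
  set κ : ℝ := gramEntry m a c * gramEntry m b c - gramEntry m a b with hκ
  have hκ2 : 2 ≤ κ := by
    have h₁ := gramEntry_nonpos hm hab
    have h₂ := gramEntry_le_neg_sqrt_two hbc hbc4
    have h₃ := gramEntry_le_neg_sqrt_two hac hac4
    have h₄ : √2 * √2 = 2 := Real.mul_self_sqrt (by norm_num)
    nlinarith [Real.sqrt_nonneg 2]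
  set r := simpleReflection m a * (simpleReflection m c * simpleReflection m b *
    simpleReflection m c)
  set α : X →₀ ℝ := Finsupp.single a 1
  set β : X →₀ ℝ := Finsupp.single b 1 - gramEntry m b c • Finsupp.single c 1
  have hr (p q : ℝ) : r (p • α + q • β) =
      (κ * (κ * p - q) - p) • α + (κ * p - q) • β := by
    simp only [r, α, β, LinearEquiv.mul_apply, simpleReflection_apply, map_sub, map_add, map_smul,
      coroot_single, gramEntry_self, gramEntry_comm hsymm c b,
      gramEntry_comm hsymm c a, gramEntry_comm hsymm b a, hκ]
    module
  have hpow (n : ℕ) : ∃ p q : ℝ, 0 ≤ q ∧ q + 1 ≤ p ∧ n + 1 ≤ p ∧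
      (r ^ n) α = p • α + q • β := by
    induction n with
    | zero => exact ⟨1, 0, by simp⟩
    | succ n ih =>
      obtain ⟨p, q, hq, hqp, hnp, h⟩ := ih
      have hq' : p + 1 ≤ κ * p - q := by nlinarith
      have hp' : 2 * (κ * p - q) ≤ κ * (κ * p - q) :=
        mul_le_mul_of_nonneg_right hκ2 (by linarith)
      refine ⟨κ * (κ * p - q) - p, κ * p - q, ?_, ?_, ?_, ?_⟩
      · linarith
      · linarith
      · push_cast; linarith
      · rw [pow_succ', LinearEquiv.mul_apply, h, hr]
  intro h1
  obtain ⟨p, q, -, -, hnp, h⟩ := hpow n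
  have ha := DFunLike.congr_fun h a
  rw [h1] at ha
  have hn' : (0 : ℝ) < n := by exact_mod_cast hn
  have : p = 1 := by
    simpa [α, β, hab, hac, hab.symm, hac.symm, eq_comm] using ha
  linarith

/-- A triangle with two labels at least `4` and a finite third label forces infinite diameter. -/
theorem exists_lt_monoidDist_of_four_le (hsymm : ∀ x y : X, m x y = m y x)
    (hm : ∀ x y : X, x ≠ y → 2 ≤ m x y) {a b c : X} (hab : a ≠ b) (hbc : b ≠ c) (hac : a ≠ c)
    (hab_fin : m a b ≠ ⊤) (hbc4 : 4 ≤ m b c) (hac4 : 4 ≤ m a c) (n : ℕ) :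
    ∃ g : ArtinGroup m, n < monoidDist (artinMonoid m) 1 g := by
  have hfam := isCoxeterFamily_simpleReflection hsymm hm
  refine exists_lt_monoidDist_of_infinite_order hm hfam ⟨(m a b).toNat, ?_, ?_⟩
    (simpleReflection_infinite_order hsymm hm hab hbc hac hbc4 hac4) n
  · have := hm a b hab
    rw [← ENat.natCast_toNat hab_fin] at this
    have : 2 ≤ (m a b).toNat := by exact_mod_cast this
    omega
  · exact hfam.mul_pow a b _ hab (ENat.natCast_toNat hab_fin).symm

end GeometricRepresentation

/-- If `Γ` contains a triangle all of whose labels are finite, with no label equal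
to `3` and at most one label equal to `2`, then the monoid Cayley graph of `A_Γ` has infinite
diameter. -/
theorem artin_infinite_diameter_of_three_free_triangle {X : Type*} [Fintype X] (m : X → X → ℕ∞)
    (hsymm : ∀ x y : X, m x y = m y x) (hge2 : ∀ x y : X, x ≠ y → 2 ≤ m x y)
    (a b c : X) (hab : a ≠ b) (hbc : b ≠ c) (hac : a ≠ c)
    (hab_fin : m a b ≠ ⊤) (hbc_fin : m b c ≠ ⊤) (hac_fin : m a c ≠ ⊤)
    (hab3 : m a b ≠ 3) (hbc3 : m b c ≠ 3) (hac3 : m a c ≠ 3)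
    (h2ab_bc : ¬(m a b = 2 ∧ m b c = 2))
    (h2ab_ac : ¬(m a b = 2 ∧ m a c = 2))
    (h2bc_ac : ¬(m b c = 2 ∧ m a c = 2)) :
    ∀ n : ℕ, ∃ g : ArtinGroup m, n < monoidDist (artinMonoid m) 1 g := by
  have four_le {x y : X} (hxy : x ≠ y) (h2 : m x y ≠ 2) (h3 : m x y ≠ 3) : 4 ≤ m x y := by
    have h := hge2 x y hxy
    generalize m x y = k at *
    induction k using ENat.recTopCoe with
    | top => exact le_top
    | coe k =>
      norm_cast at *
      omega
  by_cases hbc2 : m b c = 2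
  · exact exists_lt_monoidDist_of_four_le hsymm hge2 hbc hac.symm hab.symm hbc_fin
      (hsymm a c ▸ four_le hac (fun h => h2bc_ac ⟨hbc2, h⟩) hac3)
      (hsymm a b ▸ four_le hab (fun h => h2ab_bc ⟨h, hbc2⟩) hab3)
  by_cases hac2 : m a c = 2
  · exact exists_lt_monoidDist_of_four_le hsymm hge2 hac hbc.symm hab hac_fin
      (hsymm b c ▸ four_le hbc hbc2 hbc3)
      (four_le hab (fun h => h2ab_ac ⟨h, hac2⟩) hab3)
  exact exists_lt_monoidDist_of_four_le hsymm hge2 hab hbc hac hab_fin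
    (four_le hbc hbc2 hbc3) (four_le hac hac2 hac3)
end

section
/- Let $A_\Gamma$ be an Artin group of large type, i.e., $m(x,y) \geq 3$ (possibly $\infty$) for all distinct $x,y \in X$. Then $A_\Gamma$ has preserved signed suffixes. -/
namespace LargeArtin

section Words

variable {X G : Type*} [Group G] (f : X → G)

/-- The group element of a letter. -/
def letterVal (x : X × Bool) : G := if x.2 then f x.1 else (f x.1)⁻¹

/-- The inverse letter. -/
def invLetter (x : X × Bool) : X × Bool := (x.1, !x.2)

/-- The value of a word stored in reverse: the head of the list is the last letter. -/
def revVal : Word X → G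
  | [] => 1
  | x :: w => revVal w * letterVal f x

/-- Geodesic words, in the reversed convention. -/
def RevGeodesic (w : Word X) : Prop :=
  ∀ v : Word X, revVal f v = revVal f w → w.length ≤ v.length

/-- Word length of a group element. -/
noncomputable def wordLen (g : G) : ℕ := sInf {n | ∃ w : Word X, w.length = n ∧ revVal f w = g}

@[simp] lemma letterVal_invLetter (x : X × Bool) :
    letterVal f (invLetter x) = (letterVal f x)⁻¹ := by
  rcases x with ⟨a, _ | _⟩ <;> simp [letterVal, invLetter]

@[simp] lemma invLetter_invLetter (x : X × Bool) : invLetter (invLetter x) = x := by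
  simp [invLetter]

@[simp] lemma invLetter_fst (x : X × Bool) : (invLetter x).1 = x.1 := rfl

@[simp] lemma revVal_nil : revVal f [] = 1 := rfl

@[simp] lemma revVal_cons (x : X × Bool) (w : Word X) :
    revVal f (x :: w) = revVal f w * letterVal f x := rfl

@[simp] lemma revVal_append (u w : Word X) : revVal f (u ++ w) = revVal f w * revVal f u := by
  induction u with
  | nil => simp
  | cons x u ih => simp [ih, mul_assoc]

lemma evalWord_eq_revVal (w : Word X) : evalWord f w = revVal f w.reverse := by
  induction w with
  | nil => simp [evalWord]
  | cons x w ih =>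
    have : evalWord f (x :: w) = letterVal f x * evalWord f w := by
      simp [evalWord, letterVal]
    rw [this, ih]; simp

lemma isGeodesic_iff (w : Word X) : IsGeodesic f w ↔ RevGeodesic f w.reverse := by
  constructor
  · intro h v hv
    have := h v.reverse (by rw [evalWord_eq_revVal, evalWord_eq_revVal, List.reverse_reverse, hv])
    simpa using this
  · intro h v hv
    have := h v.reverse (by rw [← evalWord_eq_revVal, hv, evalWord_eq_revVal])
    simpa using this

variable {f}

lemma exists_revVal (hf : Subgroup.closure (Set.range f) = ⊤) (g : G) :
    ∃ w : Word X, revVal f w = g := by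
  have hg : g ∈ Subgroup.closure (Set.range f) := hf ▸ Subgroup.mem_top g
  induction hg using Subgroup.closure_induction_right with
  | one => exact ⟨[], rfl⟩
  | mul_right x y hx hy ih =>
    obtain ⟨a, rfl⟩ := hy
    obtain ⟨w, rfl⟩ := ih
    exact ⟨(a, true) :: w, by simp [letterVal]⟩
  | mul_inv_cancel x y hx hy ih =>
    obtain ⟨a, rfl⟩ := hy
    obtain ⟨w, rfl⟩ := ih
    exact ⟨(a, false) :: w, by simp [letterVal]⟩

lemma wordLen_le (w : Word X) : wordLen f (revVal f w) ≤ w.length :=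
  Nat.sInf_le ⟨w, rfl, rfl⟩

lemma RevGeodesic.wordLen_eq {w : Word X} (h : RevGeodesic f w) :
    wordLen f (revVal f w) = w.length := by
  refine le_antisymm (wordLen_le w) ?_
  obtain ⟨v, hv, hv'⟩ := Nat.sInf_mem (s := {n | ∃ v : Word X, v.length = n ∧
    revVal f v = revVal f w}) ⟨_, w, rfl, rfl⟩
  have h2 := h v hv'
  rw [hv] at h2
  exact h2

lemma revGeodesic_of_wordLen {w : Word X} (h : wordLen f (revVal f w) = w.length) :
    RevGeodesic f w := by
  intro v hv
  rw [← h, ← hv]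
  exact wordLen_le v

lemma RevGeodesic.of_append {u w : Word X} (h : RevGeodesic f (u ++ w)) : RevGeodesic f w := by
  intro v hv
  have := h (u ++ v) (by simp [hv])
  simpa using this

lemma RevGeodesic.of_cons {x : X × Bool} {w : Word X} (h : RevGeodesic f (x :: w)) :
    RevGeodesic f w := RevGeodesic.of_append (u := [x]) h

lemma exists_geodesic (hf : Subgroup.closure (Set.range f) = ⊤) (g : G) :
    ∃ w : Word X, revVal f w = g ∧ RevGeodesic f w := by
  obtain ⟨w0, hw0⟩ := exists_revVal hf g
  obtain ⟨v, hv, hv'⟩ := Nat.sInf_mem (s := {n | ∃ v : Word X, v.length = n ∧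
    revVal f v = g}) ⟨_, w0, rfl, hw0⟩
  exact ⟨v, hv', revGeodesic_of_wordLen (by rw [hv', hv]; rfl)⟩

lemma wordLen_one : wordLen f (1 : G) = 0 := Nat.le_zero.1 (wordLen_le (f := f) [])

lemma eq_one_of_wordLen (hf : Subgroup.closure (Set.range f) = ⊤) {g : G}
    (h : wordLen f g = 0) : g = 1 := by
  obtain ⟨w, rfl, hw⟩ := exists_geodesic hf g
  rw [hw.wordLen_eq, List.length_eq_zero_iff] at h
  simp [h]

lemma wordLen_mul_le (hf : Subgroup.closure (Set.range f) = ⊤) (g h : G) :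
    wordLen f (g * h) ≤ wordLen f g + wordLen f h := by
  obtain ⟨w, rfl, hw⟩ := exists_geodesic hf g
  obtain ⟨v, rfl, hv⟩ := exists_geodesic hf h
  rw [hw.wordLen_eq, hv.wordLen_eq, ← revVal_append]
  refine (wordLen_le _).trans ?_
  simp [add_comm]

lemma wordLen_letter_le (x : X × Bool) : wordLen f (letterVal f x) ≤ 1 := by
  simpa using wordLen_le (f := f) [x]

lemma wordLen_mul_letter_le (hf : Subgroup.closure (Set.range f) = ⊤) (g : G) (x : X × Bool) :
    wordLen f (g * letterVal f x) ≤ wordLen f g + 1 :=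
  (wordLen_mul_le hf _ _).trans (by gcongr; exact wordLen_letter_le x)

lemma wordLen_letter_mul_le (hf : Subgroup.closure (Set.range f) = ⊤) (g : G) (x : X × Bool) :
    wordLen f (letterVal f x * g) ≤ wordLen f g + 1 := by
  have := wordLen_mul_le hf (letterVal f x) g
  have := wordLen_letter_le (f := f) x
  omega

/-- Words with the same value have lengths of the same parity. -/
def EvenRelations (f : X → G) : Prop :=
  ∀ v w : Word X, revVal f v = revVal f w → v.length % 2 = w.length % 2

lemma wordLen_mul_parity (hf : Subgroup.closure (Set.range f) = ⊤) (hp : EvenRelations f)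
    (g h : G) : wordLen f (g * h) % 2 = (wordLen f g + wordLen f h) % 2 := by
  obtain ⟨w, rfl, hw⟩ := exists_geodesic hf g
  obtain ⟨v, rfl, hv⟩ := exists_geodesic hf h
  obtain ⟨u, hu, hug⟩ := exists_geodesic hf (revVal f w * revVal f v)
  rw [hw.wordLen_eq, hv.wordLen_eq, ← hu, hug.wordLen_eq]
  have := hp u (v ++ w) (by simp [hu])
  simpa [add_comm] using this

lemma wordLen_letter (hp : EvenRelations f) (x : X × Bool) : wordLen f (letterVal f x) = 1 := by
  have h1 : RevGeodesic f [x] := by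
    intro v hv
    have := hp v [x] hv
    simp at this ⊢
    omega
  simpa using h1.wordLen_eq

lemma wordLen_mul_letter (hf : Subgroup.closure (Set.range f) = ⊤) (hp : EvenRelations f)
    (g : G) (x : X × Bool) : wordLen f (g * letterVal f x) = wordLen f g + 1 ∨
      wordLen f (g * letterVal f x) + 1 = wordLen f g := by
  have h1 := wordLen_mul_letter_le hf g x
  have h2 := wordLen_mul_letter_le hf (g * letterVal f x) (invLetter x)
  have h3 := wordLen_mul_parity hf hp g (letterVal f x)
  rw [wordLen_letter hp] at h3
  rw [letterVal_invLetter, mul_inv_cancel_right] at h2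
  omega

lemma wordLen_letter_mul (hf : Subgroup.closure (Set.range f) = ⊤) (hp : EvenRelations f)
    (g : G) (x : X × Bool) : wordLen f (letterVal f x * g) = wordLen f g + 1 ∨
      wordLen f (letterVal f x * g) + 1 = wordLen f g := by
  have h1 := wordLen_letter_mul_le hf g x
  have h2 := wordLen_letter_mul_le hf (letterVal f x * g) (invLetter x)
  have h3 := wordLen_mul_parity hf hp (letterVal f x) g
  rw [wordLen_letter hp] at h3
  rw [letterVal_invLetter, inv_mul_cancel_left] at h2
  omega

lemma revGeodesic_cons_iff {x : X × Bool} {w : Word X} (hw : RevGeodesic f w)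
    (hf : Subgroup.closure (Set.range f) = ⊤) :
    RevGeodesic f (x :: w) ↔ wordLen f (revVal f w) < wordLen f (revVal f w * letterVal f x) := by
  constructor
  · intro h
    have h1 := h.wordLen_eq
    rw [revVal_cons] at h1
    rw [h1, hw.wordLen_eq]
    simp
  · intro h
    apply revGeodesic_of_wordLen
    have h2 := wordLen_mul_letter_le hf (revVal f w) x
    rw [hw.wordLen_eq] at h h2
    simp only [revVal_cons, List.length_cons]
    omega

lemma wordLen_map_le {H Y : Type*} [Group H] {k : Y → H}
    (hf : Subgroup.closure (Set.range f) = ⊤) (φ : G →* H) (i : X → Y)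
    (hφ : ∀ x, φ (f x) = k (i x)) (g : G) : wordLen k (φ g) ≤ wordLen f g := by
  obtain ⟨w, rfl, hw⟩ := exists_geodesic hf g
  have key : ∀ w : Word X, φ (revVal f w) = revVal k (w.map fun x => (i x.1, x.2)) := by
    intro w
    induction w with
    | nil => simp
    | cons x w ih => rcases x with ⟨a, _ | _⟩ <;> simp [ih, letterVal, hφ]
  rw [key, hw.wordLen_eq]
  simpa using wordLen_le (f := k) (w.map fun x => (i x.1, x.2))

end Words

section Artin

/-- The alternating product of length `n` starting with `a`. -/
def alt {G : Type*} [Group G] : ℕ → G → G → G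
  | 0, _, _ => 1
  | n + 1, a, b => a * alt n b a

variable {X : Type*} (m : X → X → ℕ∞)

lemma lift_altProd {G : Type*} [Group G] (f : X → G) (n : ℕ) (x y : X) :
    FreeGroup.lift f (altProd n x y) = alt n (f x) (f y) := by
  induction n generalizing x y with
  | zero => simp [altProd, alt]
  | succ n ih => simp [altProd, alt, ih]

/-- The universal property of an Artin group. -/
lemma exists_hom_of_alt {G : Type*} [Group G] (f : X → G)
    (h : ∀ (x y : X) (k : ℕ), x ≠ y → m x y = k → alt k (f x) (f y) = alt k (f y) (f x)) :
    ∃ φ : ArtinGroup m →* G, ∀ x, φ (artinGen m x) = f x := by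
  have hr : ∀ r ∈ artinRels m, FreeGroup.lift f r = 1 := by
    rintro r ⟨x, y, k, hxy, hk, rfl⟩
    rw [map_mul, map_inv, lift_altProd, lift_altProd, h x y k hxy hk, mul_inv_cancel]
  exact ⟨PresentedGroup.toGroup hr, fun x => PresentedGroup.toGroup.of hr⟩

lemma alt_artinGen {x y : X} {k : ℕ} (hxy : x ≠ y) (hk : m x y = k) :
    alt k (artinGen m x) (artinGen m y) = alt k (artinGen m y) (artinGen m x) := by
  have h1 : PresentedGroup.mk (artinRels m) (altProd k x y * (altProd k y x)⁻¹) = 1 :=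
    PresentedGroup.one_of_mem ⟨x, y, k, hxy, hk, rfl⟩
  have h2 : ∀ w, PresentedGroup.mk (artinRels m) w = FreeGroup.lift (artinGen m) w := by
    intro w
    have : PresentedGroup.mk (artinRels m) = FreeGroup.lift (artinGen m) := by
      ext x
      simp [artinGen]
      rfl
    rw [this]
  rw [h2, map_mul, map_inv, lift_altProd, lift_altProd, mul_inv_eq_one] at h1
  exact h1

lemma closure_artinGen : Subgroup.closure (Set.range (artinGen m)) = ⊤ :=
  PresentedGroup.closure_range_of _

lemma evenRelations_artinGen : EvenRelations (artinGen m) := by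
  obtain ⟨φ, hφ⟩ := exists_hom_of_alt m
    (fun _ => (Multiplicative.ofAdd (1 : ZMod 2))) (fun _ _ _ _ _ => rfl)
  have key : ∀ w : Word X, Multiplicative.toAdd (φ (revVal (artinGen m) w)) = (w.length : ZMod 2) := by
    intro w
    induction w with
    | nil => simp
    | cons x w ih =>
      rcases x with ⟨a, _ | _⟩
      · simp [ih, letterVal, hφ, ZMod.neg_eq_self_mod_two]
      · simp [ih, letterVal, hφ]
  intro v w h
  have := congrArg (fun g => Multiplicative.toAdd (φ g)) h
  simp only [key] at this
  exact (ZMod.natCast_eq_natCast_iff' _ _ 2).1 this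

end Artin

section DihedralModel

/-- States of the normal form automaton of a dihedral Artin group: a stack of maximal proper
alternating positive words, a bottom word, the current last letter and the exponent of the
Garside element. -/
abbrev RawState := List ℕ × ℕ × Bool × ℤ

variable (M : ℕ)

/-- States all of whose words are proper. -/
def ValidState (s : RawState) : Prop := (∀ l ∈ s.1, 1 ≤ l ∧ l < M) ∧ s.2.1 < M

/-- Right multiplication by the generator `c`. -/
def rawStep (c : Bool) : RawState → RawState
  | ([], z, σ, k) =>
    if c = σ then (if z + 1 < M then ([], z + 1, !σ, k) else ([], 0, !σ, k + 1))
    else ([1], z, σ, k)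
  | (l :: L, z, σ, k) =>
    if c = σ then (if l + 1 < M then ((l + 1) :: L, z, !σ, k) else (L, z, σ, k + 1))
    else (1 :: l :: L, z, σ, k)

/-- Right multiplication by the inverse of the generator `c`. -/
def rawStepInv (c : Bool) : RawState → RawState
  | ([], z, σ, k) =>
    if c = !σ then (if 1 ≤ z then ([], z - 1, !σ, k) else ([], M - 1, !σ, k - 1))
    else ([M - 1], z, σ, k - 1)
  | (l :: L, z, σ, k) =>
    if c = !σ then (if 2 ≤ l then ((l - 1) :: L, z, !σ, k) else (L, z, σ, k))
    else ((M - 1) :: l :: L, z, σ, k - 1)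

variable {M}

lemma ValidState.step (hM : 3 ≤ M) (c : Bool) {s : RawState} (h : ValidState M s) :
    ValidState M (rawStep M c s) := by
  obtain ⟨_ | ⟨l, L⟩, z, σ, k⟩ := s
  · simp only [rawStep, ValidState] at *
    split_ifs <;> simp_all
    all_goals omega
  · simp only [rawStep, ValidState, List.mem_cons, forall_eq_or_imp] at *
    split_ifs <;> simp_all <;> omega

lemma ValidState.stepInv (hM : 3 ≤ M) (c : Bool) {s : RawState} (h : ValidState M s) :
    ValidState M (rawStepInv M c s) := by
  obtain ⟨_ | ⟨l, L⟩, z, σ, k⟩ := s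
  · simp only [rawStepInv, ValidState] at *
    split_ifs <;> simp_all <;> omega
  · simp only [rawStepInv, ValidState, List.mem_cons, forall_eq_or_imp] at *
    split_ifs <;> simp_all <;> omega

lemma rawStepInv_rawStep (hM : 3 ≤ M) (c : Bool) {s : RawState} (h : ValidState M s) :
    rawStepInv M c (rawStep M c s) = s := by
  obtain ⟨_ | ⟨l, _ | ⟨l', L⟩⟩, z, σ, k⟩ := s
  all_goals
    simp only [ValidState, List.mem_cons, forall_eq_or_imp] at h
    by_cases hc : c = σ
    · subst hc
      simp only [rawStep, if_true]
      split_ifs <;> simp [rawStepInv] <;> omega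
    · have : c = !σ := by cases c <;> cases σ <;> simp_all
      subst this
      simp [rawStep, rawStepInv]

lemma rawStep_rawStepInv (hM : 3 ≤ M) (c : Bool) {s : RawState} (h : ValidState M s) :
    rawStep M c (rawStepInv M c s) = s := by
  have h2 : ¬ (M - 1 + 1 < M) := by omega
  by_cases hc : c = !s.2.2.1
  · obtain ⟨_ | ⟨l, L⟩, z, σ, k⟩ := s <;>
      simp only [ValidState, List.mem_cons, forall_eq_or_imp] at h hc <;> subst hc
    · obtain _ | z := z
      · simp [rawStep, rawStepInv, h2]
      · simp [rawStep, rawStepInv, h.2]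
    · obtain _ | _ | l := l
      · omega
      · cases L <;> simp [rawStep, rawStepInv]
      · simp [rawStep, rawStepInv, h.1.1]
  · obtain ⟨L, z, σ, k⟩ := s
    obtain rfl : c = σ := by cases c <;> cases σ <;> simp_all
    cases L <;> simp [rawStep, rawStepInv, h2]

/-- The letter reached after `n` alternations from `c`. -/
def flipN (n : ℕ) (c : Bool) : Bool := xor c n.bodd

lemma flipN_zero (c : Bool) : flipN 0 c = c := by simp [flipN]

lemma flipN_succ (n : ℕ) (c : Bool) : flipN (n + 1) c = flipN n (!c) := by
  simp only [flipN, Nat.bodd_succ]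
  cases c <;> cases n.bodd <;> rfl

lemma flipN_not (n : ℕ) (c : Bool) : flipN n (!c) = !flipN n c := by
  simp only [flipN]
  cases c <;> cases n.bodd <;> rfl

lemma flipN_flipN (n n' : ℕ) (c : Bool) : flipN n (flipN n' c) = flipN (n' + n) c := by
  simp only [flipN, Nat.bodd_add]
  cases c <;> cases n.bodd <;> cases n'.bodd <;> rfl

variable (M) in
/-- Alternating walk of length `n` starting with the letter `c`. -/
def rawWalk : ℕ → Bool → RawState → RawState
  | 0, _, s => s
  | n + 1, c, s => rawWalk n (!c) (rawStep M c s)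

lemma rawWalk_add (i j : ℕ) (c : Bool) (s : RawState) :
    rawWalk M (i + j) c s = rawWalk M j (flipN i c) (rawWalk M i c s) := by
  induction i generalizing c s with
  | zero => simp [rawWalk, flipN_zero]
  | succ i ih => rw [add_right_comm, rawWalk, ih, rawWalk, flipN_succ]

lemma rawWalk_cons (j l : ℕ) (L : List ℕ) (z : ℕ) (σ : Bool) (k : ℤ) (h : l + j < M) :
    rawWalk M j σ (l :: L, z, σ, k) = ((l + j) :: L, z, flipN j σ, k) := by
  induction j generalizing l σ with
  | zero => simp [rawWalk, flipN_zero]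
  | succ j ih =>
    have : l + 1 < M := by omega
    rw [rawWalk, rawStep, if_pos rfl, if_pos this, ih _ _ (by omega), flipN_succ]
    congr 2; omega

lemma rawWalk_nil (j z : ℕ) (σ : Bool) (k : ℤ) (h : z + j < M) :
    rawWalk M j σ ([], z, σ, k) = ([], z + j, flipN j σ, k) := by
  induction j generalizing z σ with
  | zero => simp [rawWalk, flipN_zero]
  | succ j ih =>
    have : z + 1 < M := by omega
    rw [rawWalk, rawStep, if_pos rfl, if_pos this, ih _ _ (by omega), flipN_succ]
    congr 2; omega

lemma rawWalk_pop (j l : ℕ) (L : List ℕ) (z : ℕ) (σ : Bool) (k : ℤ) (h : l + j + 1 = M) :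
    rawWalk M (j + 1) σ (l :: L, z, σ, k) = (L, z, flipN j σ, k + 1) := by
  rw [rawWalk_add, rawWalk_cons _ _ _ _ _ _ (by omega)]
  have : ¬ (l + j + 1 < M) := by omega
  simp [rawWalk, rawStep, this]

lemma rawStep_push (L : List ℕ) (z : ℕ) (σ : Bool) (k : ℤ) :
    rawStep M (!σ) (L, z, σ, k) = (1 :: L, z, σ, k) := by
  cases L <;> simp [rawStep]

lemma flipN_congr {n n' : ℕ} (h : n % 2 = n' % 2) (c : Bool) : flipN n c = flipN n' c := by
  rw [Nat.mod_two_of_bodd, Nat.mod_two_of_bodd] at h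
  simp only [flipN]
  cases hn : n.bodd <;> cases hn' : n'.bodd <;> simp_all

/-- The Garside element acts independently of the starting letter. -/
lemma rawWalk_full (hM : 3 ≤ M) (c : Bool) (L : List ℕ) (z : ℕ) (σ : Bool) (k : ℤ)
    (h : ValidState M (L, z, σ, k)) :
    rawWalk M M c (L, z, σ, k) = (L, z, flipN M σ, k + 1) := by
  by_cases hc : c = σ
  · subst hc
    obtain _ | ⟨l, L⟩ := L
    · simp only [ValidState] at h
      obtain ⟨j, hj⟩ : ∃ j, M = j + 1 + z := ⟨M - 1 - z, by omega⟩
      nth_rw 2 [hj]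
      rw [rawWalk_add, rawWalk_add, rawWalk_nil _ _ _ _ (by omega)]
      have : ¬ (z + j + 1 < M) := by omega
      simp only [rawWalk, rawStep, if_true, this, if_false]
      have h1 : flipN (j + 1) c = !flipN j c := by rw [flipN_succ, flipN_not]
      rw [h1, rawWalk_nil _ _ _ _ (by omega), ← h1, flipN_flipN, ← hj, zero_add]
    · simp only [ValidState, List.mem_cons, forall_eq_or_imp] at h
      obtain ⟨j, hj⟩ : ∃ j, M = (j + 1) + (1 + (l - 1)) := ⟨M - 1 - l, by omega⟩
      nth_rw 2 [hj]
      rw [rawWalk_add, rawWalk_add, rawWalk_pop _ _ _ _ _ _ (by omega)]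
      simp only [rawWalk]
      rw [flipN_succ j, flipN_not, rawStep_push, flipN_succ, flipN_zero, Bool.not_not,
        rawWalk_cons _ _ _ _ _ _ (by omega), flipN_flipN,
        flipN_congr (n := j + (l - 1)) (n' := M) (by omega)]
      congr 2; omega
  · obtain rfl : c = !σ := by cases c <;> cases σ <;> simp_all
    obtain ⟨j, hj⟩ : ∃ j, M = 1 + (j + 1) := ⟨M - 2, by omega⟩
    nth_rw 2 [hj]
    rw [rawWalk_add]
    simp only [rawWalk]
    rw [rawStep_push]
    have := rawWalk_pop (M := M) j 1 L z σ k (by omega)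
    rw [rawWalk] at this
    rw [flipN_succ, flipN_zero]
    simp only [Bool.not_not]
    rw [this,
      flipN_congr (n := j) (n' := M) (by omega)]

/-- The permutation of the valid states induced by a generator. -/
def stepPerm (hM : 3 ≤ M) (c : Bool) : Equiv.Perm {s : RawState // ValidState M s} where
  toFun s := ⟨rawStep M c s, s.2.step hM c⟩
  invFun s := ⟨rawStepInv M c s, s.2.stepInv hM c⟩
  left_inv s := Subtype.ext (rawStepInv_rawStep hM c s.2)
  right_inv s := Subtype.ext (rawStep_rawStepInv hM c s.2)

open MulOpposite in
lemma unop_alt_stepPerm (hM : 3 ≤ M) (n : ℕ) (c : Bool) (s : {s : RawState // ValidState M s}) :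
    (((alt n (op (stepPerm hM c)) (op (stepPerm hM (!c)))).unop s : _) : RawState) =
      rawWalk M n c s := by
  induction n generalizing c s with
  | zero => simp [alt, rawWalk]
  | succ n ih =>
    have := ih (!c) (stepPerm hM c s)
    rw [Bool.not_not] at this
    simp only [alt, unop_mul, Equiv.Perm.mul_apply, unop_op]
    rw [this]
    rfl

variable (M) in
/-- The labels of a dihedral Artin group. -/
abbrev dihLabel (k : ℕ∞) : Bool → Bool → ℕ∞ := fun _ _ => k

open MulOpposite in
lemma exists_state (hM : 3 ≤ M) : ∃ st : ArtinGroup (dihLabel (M : ℕ∞)) → RawState,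
    st 1 = ([], 0, true, 0) ∧ (∀ h, ValidState M (st h)) ∧
    ∀ h c, st (h * artinGen _ c) = rawStep M c (st h) := by
  obtain ⟨φ, hφ⟩ := exists_hom_of_alt (dihLabel (M : ℕ∞))
    (fun c => op (stepPerm hM c)) (by
      intro x y k hxy hk
      obtain rfl : M = k := by simpa using hk
      obtain rfl : y = !x := by cases x <;> cases y <;> simp_all
      apply unop_injective
      ext1 s
      apply Subtype.ext
      have h1 := unop_alt_stepPerm hM M x s
      have h2 := unop_alt_stepPerm hM M (!x) s
      rw [Bool.not_not] at h2
      rw [h1, h2]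
      obtain ⟨⟨L, z, σ, k⟩, hs⟩ := s
      simp only
      rw [rawWalk_full hM _ _ _ _ _ hs, rawWalk_full hM _ _ _ _ _ hs])
  have hb : ValidState M ([], 0, true, 0) := ⟨by simp, by simp; omega⟩
  refine ⟨fun h => ((φ h).unop ⟨_, hb⟩ : {s // ValidState M s}), by simp, fun h => Subtype.prop _,
    fun h c => ?_⟩
  simp [hφ]
  rfl

end DihedralModel

section DihedralLength

variable {M : ℕ}

/-- The contribution of a proper alternating word of length `l` to the length functional. -/
def cost (p l : ℕ) : ℤ := min (l : ℤ) (2 * p - l)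

variable (M) in
/-- The family of length functionals on states; the word length is their maximum. -/
def rawF (p : ℕ) (s : RawState) : ℤ :=
  (2 * p - M) * s.2.2.2 + cost p s.2.1 + (s.1.map (cost p)).sum

/-- The length of the top word of a state. -/
def rawTop : RawState → ℕ
  | ([], z, _, _) => z
  | (l :: _, _, _, _) => l

/-- The length of the longest alternating positive word ending the state that can be continued
by the letter `c`. -/
def rawR (c : Bool) (s : RawState) : ℕ := if c = s.2.2.1 then rawTop s else 0

lemma rawF_step (hM : 3 ≤ M) {p : ℕ} (hp : p ≤ M) (c : Bool) {s : RawState}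
    (h : ValidState M s) :
    rawF M p (rawStep M c s) = rawF M p s + if rawR c s < p then 1 else -1 := by
  obtain ⟨_ | ⟨l, L⟩, z, σ, k⟩ := s
  · simp only [ValidState] at h
    by_cases hc : c = σ
    · subst hc
      by_cases hz : z + 1 < M
      · simp only [rawStep, rawF, cost, rawR, rawTop, hz, if_true, List.map_nil, List.sum_nil]
        split_ifs <;> push_cast <;> omega
      · obtain rfl : M = z + 1 := by omega
        simp only [rawStep, rawF, cost, rawR, rawTop, hz, if_true, if_false, List.map_nil,
          List.sum_nil, mul_add]
        split_ifs <;> push_cast <;> omega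
    · simp only [rawStep, rawF, cost, rawR, hc, if_false, List.map_nil, List.sum_nil,
        List.map_cons, List.sum_cons]
      split_ifs <;> push_cast <;> omega
  · simp only [ValidState, List.mem_cons, forall_eq_or_imp] at h
    by_cases hc : c = σ
    · subst hc
      by_cases hz : l + 1 < M
      · simp only [rawStep, rawF, cost, rawR, rawTop, hz, if_true, List.map_cons, List.sum_cons]
        split_ifs <;> push_cast <;> omega
      · obtain rfl : M = l + 1 := by omega
        simp only [rawStep, rawF, cost, rawR, rawTop, hz, if_true, if_false, List.map_cons,
          List.sum_cons, mul_add]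
        split_ifs <;> push_cast <;> omega
    · simp only [rawStep, rawF, cost, rawR, hc, if_false, List.map_cons, List.sum_cons]
      split_ifs <;> push_cast <;> omega

lemma rawR_zero (b : Bool) (s : RawState) : rawR b s = 0 ∨ rawR (!b) s = 0 := by
  simp only [rawR]
  cases b <;> cases s.2.2.1 <;> simp

lemma rawR_lt {s : RawState} (h : ValidState M s) (b : Bool) : rawR b s < M := by
  obtain ⟨_ | ⟨l, L⟩, z, σ, k⟩ := s <;>
    simp only [ValidState, List.mem_cons, forall_eq_or_imp] at h <;>
    simp only [rawR, rawTop] <;> split_ifs <;> omega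

lemma rawR_step {s : RawState} (h : ValidState M s) (b : Bool)
    (hb : rawR b s + 1 < M) :
    rawR b (rawStep M b s) = 0 ∧ rawR (!b) (rawStep M b s) = rawR b s + 1 := by
  obtain ⟨_ | ⟨l, L⟩, z, σ, k⟩ := s <;> by_cases hc : b = σ
  · subst hc
    simp only [rawR, rawTop, if_true] at hb
    simp [rawStep, rawR, rawTop, hb]
  · obtain rfl : b = !σ := by cases b <;> cases σ <;> simp_all
    simp [rawStep, rawR, rawTop]
  · subst hc
    simp only [rawR, rawTop, if_true] at hb
    simp [rawStep, rawR, rawTop, hb]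
  · obtain rfl : b = !σ := by cases b <;> cases σ <;> simp_all
    simp [rawStep, rawR, rawTop]

lemma rawR_step_full (hM : 3 ≤ M) {s : RawState} (b : Bool)
    (hb : rawR b s + 1 = M) : rawR (!b) (rawStep M b s) = 0 := by
  obtain ⟨_ | ⟨l, L⟩, z, σ, k⟩ := s <;> by_cases hc : b = σ
  · subst hc
    simp only [rawR, rawTop, if_true] at hb
    simp [rawStep, rawR, rawTop, hb]
  · simp only [rawR, hc, if_false] at hb
    omega
  · subst hc
    simp only [rawR, rawTop, if_true] at hb
    simp [rawStep, rawR, hb]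
  · simp only [rawR, hc, if_false] at hb
    omega

lemma cost_concave {p r q : ℕ} (h1 : p < r) (h2 : r < q) (l : ℕ) :
    (q - r) * cost p l + (r - p) * cost q l ≤ (q - p) * cost r l := by
  have hp1 : cost p l ≤ l := min_le_left _ _
  have hp2 : cost p l ≤ 2 * p - l := min_le_right _ _
  have hq1 : cost q l ≤ l := min_le_left _ _
  have hq2 : cost q l ≤ 2 * q - l := min_le_right _ _
  have e1 : (0 : ℤ) < q - r := by omega
  have e2 : (0 : ℤ) < r - p := by omega
  rcases min_choice (l : ℤ) (2 * r - l) with h | h <;> rw [cost.eq_1 r, h] <;> nlinarith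

lemma cost_concave_self {p r q : ℕ} (h1 : p < r) (h2 : r < q) :
    (q - r) * cost p r + (r - p) * cost q r < (q - p) * cost r r := by
  have e0 : cost r r = r := by simp [cost]; omega
  have ep : cost p r = 2 * p - r := by simp [cost]; omega
  have eq : cost q r = r := by simp [cost]; omega
  rw [e0, ep, eq]
  have e1 : (0 : ℤ) < q - r := by omega
  have e2 : (0 : ℤ) < r - p := by omega
  nlinarith

lemma sum_cost_concave {p r q : ℕ} (h1 : p < r) (h2 : r < q) (L : List ℕ) :
    (q - r) * (L.map (cost p)).sum + (r - p) * (L.map (cost q)).sum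
      ≤ (q - p) * (L.map (cost r)).sum := by
  induction L with
  | nil => simp
  | cons l L ih =>
    have := cost_concave h1 h2 l
    simp only [List.map_cons, List.sum_cons, mul_add]
    linarith

lemma rawF_concave {p q : ℕ} {s : RawState} (h1 : p < rawTop s) (h2 : rawTop s < q) :
    (q - rawTop s) * rawF M p s + (rawTop s - p) * rawF M q s
      < (q - p) * rawF M (rawTop s) s := by
  obtain ⟨_ | ⟨l, L⟩, z, σ, k⟩ := s
  · simp only [rawTop] at h1 h2
    have := cost_concave_self h1 h2
    simp only [rawF, rawTop, List.map_nil, List.sum_nil]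
    linarith
  · simp only [rawTop] at h1 h2
    have := cost_concave_self h1 h2
    have h3 := cost_concave h1 h2 z
    have h4 := sum_cost_concave h1 h2 L
    simp only [rawF, rawTop, List.map_cons, List.sum_cons]
    linarith

lemma sum_cost_parity (p q : ℕ) (L : List ℕ) :
    ((L.map (cost p)).sum - (L.map (cost q)).sum) % 2 = 0 := by
  induction L with
  | nil => simp
  | cons l L ih =>
    simp only [List.map_cons, List.sum_cons, cost] at ih ⊢
    omega

lemma rawF_parity (p q : ℕ) (s : RawState) : (rawF M p s - rawF M q s) % 2 = 0 := by
  have h1 := sum_cost_parity p q s.1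
  have h2 := sum_cost_parity p q [s.2.1]
  simp only [List.map_cons, List.map_nil, List.sum_cons, List.sum_nil] at h2
  have h3 : rawF M p s - rawF M q s = 2 * ((p - q) * s.2.2.2) +
      (cost p s.2.1 + 0 - (cost q s.2.1 + 0)) +
      ((s.1.map (cost p)).sum - (s.1.map (cost q)).sum) := by
    simp only [rawF]; ring
  omega

variable (M) in
/-- The alternating product of length `n` ending in the generator `c`. -/
def altE : ℕ → Bool → ArtinGroup (dihLabel (M : ℕ∞))
  | 0, _ => 1
  | n + 1, c => altE n (!c) * artinGen _ c

lemma altE_succ' (n : ℕ) (c : Bool) :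
    altE M (n + 1) c = artinGen _ (flipN n c) * altE M n c := by
  induction n generalizing c with
  | zero => simp [altE, flipN_zero]
  | succ n ih => rw [altE, ih, altE, flipN_succ, mul_assoc]

lemma altE_eq_alt (n : ℕ) (c : Bool) :
    altE M n c = alt n (artinGen _ (!flipN n c)) (artinGen _ (flipN n c)) := by
  induction n generalizing c with
  | zero => simp [altE, alt]
  | succ n ih =>
    rw [altE_succ', ih, alt, flipN_succ, flipN_not, Bool.not_not]

variable (M) in
/-- The Garside element. -/
def garside : ArtinGroup (dihLabel (M : ℕ∞)) := altE M M true

lemma altE_full (c : Bool) : altE M M c = garside M := by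
  have h : altE M M false = altE M M true := by
    have e : flipN M false = !flipN M true := flipN_not M true
    rw [altE_eq_alt, altE_eq_alt, e, Bool.not_not]
    exact alt_artinGen _ (by simp) rfl
  cases c
  · exact h
  · rfl

lemma garside_mul (c : Bool) :
    garside M * artinGen _ c = artinGen _ (flipN M c) * garside M := by
  rw [← altE_full (!c)]
  have h := altE_succ' (M := M) M c
  rw [altE] at h
  rw [h, altE_full, altE_full]

lemma altE_mul_garside (n : ℕ) (c : Bool) :
    altE M n (flipN M c) * garside M = garside M * altE M n c := by
  induction n generalizing c with
  | zero => simp [altE]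
  | succ n ih =>
    rw [altE, altE, mul_assoc, ← garside_mul, ← mul_assoc, ← flipN_not, ih, mul_assoc]

variable (M) in
/-- The group element represented by a state. -/
def rawVal : RawState → ArtinGroup (dihLabel (M : ℕ∞))
  | ([], z, σ, k) => garside M ^ k * altE M z (!σ)
  | (l :: L, z, σ, k) => rawVal (L, z, flipN (l - 1) σ, k) * altE M l (!σ)

lemma rawVal_mul_garside (L : List ℕ) (z : ℕ) (σ : Bool) (k : ℤ) :
    rawVal M (L, z, flipN M σ, k) * garside M = rawVal M (L, z, σ, k + 1) := by
  induction L generalizing σ with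
  | nil =>
    rw [rawVal, rawVal, ← flipN_not, mul_assoc, altE_mul_garside, ← mul_assoc, zpow_add_one]
  | cons l L ih =>
    rw [rawVal, rawVal, ← flipN_not, mul_assoc, altE_mul_garside, ← mul_assoc, ← ih, flipN_flipN,
      flipN_flipN, add_comm]

lemma rawVal_step (c : Bool) {s : RawState} (h : ValidState M s) :
    rawVal M (rawStep M c s) = rawVal M s * artinGen _ c := by
  obtain ⟨_ | ⟨l, L⟩, z, σ, k⟩ := s <;>
    simp only [ValidState, List.mem_cons, forall_eq_or_imp] at h <;> by_cases hc : c = σ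
  · subst hc
    simp only [rawStep, if_true]
    split_ifs with hz
    · rw [rawVal, rawVal, Bool.not_not, altE, mul_assoc]
    · obtain rfl : M = z + 1 := by omega
      rw [rawVal, rawVal, zpow_add_one, mul_assoc, mul_assoc, Bool.not_not]
      congr 1
      rw [← altE_full c, altE, altE, mul_one]
  · obtain rfl : c = !σ := by cases c <;> cases σ <;> simp_all
    simp [rawStep, rawVal, altE, flipN_zero]
  · subst hc
    simp only [rawStep, if_true]
    split_ifs with hz
    · rw [rawVal, rawVal, Bool.not_not, altE, mul_assoc, Nat.add_sub_cancel, ← flipN_succ,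
        flipN_congr (n := l + 1) (n' := l - 1) (by omega)]
    · rw [rawVal, ← rawVal_mul_garside, flipN_congr (n := M) (n' := l - 1) (by omega), mul_assoc]
      congr 1
      rw [← altE_full c]
      obtain rfl : M = l + 1 := by omega
      rw [altE]
  · obtain rfl : c = !σ := by cases c <;> cases σ <;> simp_all
    simp [rawStep, rawVal, altE, flipN_zero]

end DihedralLength

section DihedralData

variable {M : ℕ}

/-- The length functionals `F` and the run lengths `R` of a dihedral Artin group. -/
structure DihData (M : ℕ) (F : ℕ → ArtinGroup (dihLabel (M : ℕ∞)) → ℤ)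
    (R : Bool → ArtinGroup (dihLabel (M : ℕ∞)) → ℕ) : Prop where
  F_one : ∀ p, F p 1 = 0
  R_one : ∀ b, R b 1 = 0
  F_mul : ∀ p h b, p ≤ M → F p (h * artinGen _ b) = F p h + if R b h < p then 1 else -1
  R_zero : ∀ b h, R b h = 0 ∨ R (!b) h = 0
  R_lt : ∀ b h, R b h < M
  R_mul : ∀ b h, R b h + 1 < M → R b (h * artinGen _ b) = 0 ∧
    R (!b) (h * artinGen _ b) = R b h + 1
  R_mul_full : ∀ b h, R b h + 1 = M → R (!b) (h * artinGen _ b) = 0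
  F_parity : ∀ p q h, (F p h - F q h) % 2 = 0
  /-- Away from the identity some letter lowers all maximal functionals at once. -/
  exists_desc : ∀ h, h ≠ 1 → ∀ n : ℤ, (∀ p ≤ M, F p h ≤ n) →
    ∃ x : Bool × Bool, ∀ p ≤ M, F p h = n → F p (h * letterVal (artinGen _) x) = n - 1

lemma exists_dihData (hM : 3 ≤ M) : ∃ F R, DihData M F R := by
  obtain ⟨st, hst1, hst, hmul⟩ := exists_state hM
  have hF : ∀ p h b, p ≤ M → rawF M p (st (h * artinGen _ b)) =
      rawF M p (st h) + if rawR b (st h) < p then 1 else -1 := fun p h b hp => by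
    rw [hmul, rawF_step hM hp _ (hst h)]
  have hval : ∀ h, rawVal M (st h) = h := by
    intro h
    have hh : h ∈ Subgroup.closure (Set.range (artinGen (dihLabel (M : ℕ∞)))) :=
      closure_artinGen _ ▸ Subgroup.mem_top h
    induction hh using Subgroup.closure_induction_right with
    | one => rw [hst1]; simp [rawVal, altE]
    | mul_right x y hx hy ih =>
      obtain ⟨c, rfl⟩ := hy
      rw [hmul, rawVal_step _ (hst x), ih]
    | mul_inv_cancel x y hx hy ih =>
      obtain ⟨c, rfl⟩ := hy
      have h1 := hmul (x * (artinGen _ c)⁻¹) c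
      rw [inv_mul_cancel_right] at h1
      rw [eq_mul_inv_iff_mul_eq, ← rawVal_step _ (hst _), ← h1, ih]
  refine ⟨fun p h => rawF M p (st h), fun b h => rawR b (st h), ?_, ?_, hF, fun b h => rawR_zero _ _,
    fun b h => rawR_lt (hst h) b, ?_, ?_, fun p q h => rawF_parity p q _, ?_⟩
  · intro p; simp [hst1, rawF, cost]
  · intro b; simp [hst1, rawR, rawTop]
  · intro b h hb
    rw [hmul]
    exact rawR_step (hst h) b hb
  · intro b h hb
    rw [hmul]
    exact rawR_step_full hM b hb
  · intro h h1 n hn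
    obtain ⟨c, hc⟩ : ∃ c, c = (st h).2.2.1 := ⟨_, rfl⟩
    have hRc : rawR c (st h) = rawTop (st h) := by simp [rawR, hc]
    have hRc' : rawR (!c) (st h) = 0 := by simp [rawR, hc]
    have hpos : ∀ p ≤ M, p ≤ rawTop (st h) → rawF M p (st h) = n →
        rawF M p (st (h * letterVal (artinGen _) (c, true))) = n - 1 := by
      intro p hp hpr hpn
      simp only [letterVal, if_true]
      rw [hF _ _ _ hp, hRc, if_neg (by omega), hpn]
      rfl
    have hR' : rawR (!c) (st (h * (artinGen _ (!c))⁻¹)) + 1 =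
        if rawTop (st h) = 0 then M else rawTop (st h) := by
      have e := hmul (h * (artinGen _ (!c))⁻¹) (!c)
      rw [inv_mul_cancel_right] at e
      have hv := hst (h * (artinGen _ (!c))⁻¹)
      have hl := rawR_lt hv (!c)
      by_cases hf : rawR (!c) (st (h * (artinGen _ (!c))⁻¹)) + 1 = M
      · have := rawR_step_full hM _ hf
        rw [← e, Bool.not_not, hRc] at this
        rw [this, if_pos rfl, hf]
      · have := (rawR_step hv (!c) (by omega)).2
        rw [← e, Bool.not_not, hRc] at this
        rw [this, if_neg (by omega)]
    have hneg : ∀ p ≤ M, (if rawTop (st h) = 0 then M else rawTop (st h)) ≤ p →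
        rawF M p (st h) = n →
        rawF M p (st (h * letterVal (artinGen _) (!c, false))) = n - 1 := by
      intro p hp hpr hpn
      simp only [letterVal, Bool.false_eq_true, if_false]
      have := hF p (h * (artinGen _ (!c))⁻¹) (!c) hp
      rw [inv_mul_cancel_right, if_pos (by omega)] at this
      omega
    by_cases ht : rawTop (st h) = 0
    · have hv := hst h
      have hvh := hval h
      obtain ⟨L, z, σ, k, hs⟩ : ∃ L z σ k, st h = (L, z, σ, k) := ⟨_, _, _, _, rfl⟩
      rw [hs] at hv hvh ht hpos hneg hn
      obtain _ | ⟨l, L⟩ := L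
      · simp only [rawTop] at ht
        subst ht
        have hFk : ∀ p, rawF M p ([], 0, σ, k) = (2 * p - M) * k := by simp [rawF, cost]
        have hk : k ≠ 0 := by
          rintro rfl
          exact h1 (by rw [← hvh]; simp [rawVal, altE])
        have hM0 := hn M le_rfl
        have h00 := hn 0 (by omega)
        rw [hFk] at hM0 h00
        rcases lt_or_gt_of_ne hk with hk | hk
        · refine ⟨(c, true), fun p hp hpn => ?_⟩
          rw [hs] at hpn
          refine hpos p hp ?_ hpn
          rw [hFk] at hpn
          by_contra hp0
          simp only [rawTop] at hp0
          have : (0 : ℤ) < p := by omega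
          push_cast at h00
          nlinarith
        · refine ⟨(!c, false), fun p hp hpn => ?_⟩
          rw [hs] at hpn
          refine hneg p hp ?_ hpn
          rw [hFk] at hpn
          by_contra hp0
          simp only [rawTop, if_true] at hp0
          have : (p : ℤ) < M := by omega
          nlinarith
      · simp only [ValidState, List.mem_cons, forall_eq_or_imp] at hv
        simp only [rawTop] at ht
        omega
    · by_cases hex : ∃ p ≤ M, p < rawTop (st h) ∧ rawF M p (st h) = n
      · obtain ⟨p, hpM, hpr, hpn⟩ := hex
        refine ⟨(c, true), fun q hq hqn => hpos q hq ?_ hqn⟩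
        by_contra! hlt
        have := rawF_concave (M := M) hpr hlt
        rw [hpn, hqn] at this
        have h3 := hn (rawTop (st h)) (by omega)
        have : (p : ℤ) < q := by omega
        nlinarith
      · push Not at hex
        refine ⟨(!c, false), fun q hq hqn => hneg q hq ?_ hqn⟩
        rw [if_neg ht]
        by_contra! hlt
        exact hex q hq hlt hqn

variable {F : ℕ → ArtinGroup (dihLabel (M : ℕ∞)) → ℤ}
  {R : Bool → ArtinGroup (dihLabel (M : ℕ∞)) → ℕ}

namespace DihData

variable (hD : DihData M F R)
include hD

/-- A run that has not been extended to the maximum. -/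
lemma R_mul_inv {b : Bool} {h : ArtinGroup (dihLabel (M : ℕ∞))} :
    R b (h * (artinGen _ b)⁻¹) + 1 = if R (!b) h = 0 then M else R (!b) h := by
  have hl := hD.R_lt b (h * (artinGen _ b)⁻¹)
  by_cases hf : R b (h * (artinGen _ b)⁻¹) + 1 = M
  · have := hD.R_mul_full _ _ hf
    rw [inv_mul_cancel_right] at this
    rw [this, if_pos rfl, hf]
  · have := (hD.R_mul b (h * (artinGen _ b)⁻¹) (by omega)).2
    rw [inv_mul_cancel_right] at this
    rw [this, if_neg (by omega)]

lemma F_mul_inv {p : ℕ} (hp : p ≤ M) (h : ArtinGroup (dihLabel (M : ℕ∞))) (b : Bool) :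
    F p (h * (artinGen _ b)⁻¹) =
      F p h + if p < (if R (!b) h = 0 then M else R (!b) h) then 1 else -1 := by
  have h1 := hD.F_mul p (h * (artinGen _ b)⁻¹) b hp
  have h2 := hD.R_mul_inv (b := b) (h := h)
  rw [inv_mul_cancel_right] at h1
  rw [← h2]
  split_ifs at h1 ⊢ <;> omega

lemma F_letter {p : ℕ} (hp : p ≤ M) (h : ArtinGroup (dihLabel (M : ℕ∞))) (x : Bool × Bool) :
    F p (h * letterVal (artinGen _) x) = F p h + 1 ∨
      F p (h * letterVal (artinGen _) x) = F p h - 1 := by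
  obtain ⟨b, _ | _⟩ := x
  · simp only [letterVal, Bool.false_eq_true, if_false]
    rw [hD.F_mul_inv hp]
    split_ifs <;> omega
  · simp only [letterVal, if_true]
    rw [hD.F_mul _ _ _ hp]
    split_ifs <;> omega

lemma F_le {p : ℕ} (hp : p ≤ M) (w : Word Bool) : F p (revVal (artinGen _) w) ≤ w.length := by
  induction w with
  | nil => simp [hD.F_one]
  | cons x w ih =>
    have := hD.F_letter hp (revVal (artinGen _) w) x
    simp only [revVal_cons, List.length_cons]
    push_cast
    omega

lemma F_letter_extreme (h : ArtinGroup (dihLabel (M : ℕ∞))) (x : Bool × Bool) :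
    F M (h * letterVal (artinGen _) x) = F M h + (if x.2 then 1 else -1) ∧
      F 0 (h * letterVal (artinGen _) x) = F 0 h - (if x.2 then 1 else -1) := by
  obtain ⟨b, _ | _⟩ := x
  · have h1 := hD.F_mul_inv (p := M) le_rfl h b
    have h2 := hD.F_mul_inv (p := 0) (by omega) h b
    have := hD.R_lt (!b) h
    simp only [letterVal, Bool.false_eq_true, if_false]
    rw [h1, h2, if_neg (by split_ifs <;> omega), if_pos (by split_ifs <;> omega)]
    omega
  · simp only [letterVal, if_true]
    rw [hD.F_mul _ _ _ le_rfl, hD.F_mul _ _ _ (Nat.zero_le _), if_pos (hD.R_lt _ _),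
      if_neg (by omega)]
    omega

lemma F_anti (h : ArtinGroup (dihLabel (M : ℕ∞))) : F 0 h = - F M h := by
  obtain ⟨w, rfl⟩ := exists_revVal (closure_artinGen _) h
  induction w with
  | nil => simp [hD.F_one]
  | cons x w ih =>
    have := hD.F_letter_extreme (revVal (artinGen _) w) x
    rw [revVal_cons, this.1, this.2, ih]
    ring

lemma wordLen_le_of_F (n : ℕ) (h : ArtinGroup (dihLabel (M : ℕ∞)))
    (hn : ∀ p ≤ M, F p h ≤ n) : wordLen (artinGen (dihLabel (M : ℕ∞))) h ≤ n := by
  induction n generalizing h with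
  | zero =>
    by_cases h1 : h = 1
    · rw [h1, wordLen_one]
    · obtain ⟨x, hx⟩ := hD.exists_desc h h1 _ hn
      have h2 := hD.F_anti h
      have h3 := hD.F_anti (h * letterVal (artinGen _) x)
      have h4 := hn M le_rfl
      have h5 := hn 0 (Nat.zero_le _)
      have h6 := hx M le_rfl
      have h7 := hx 0 (Nat.zero_le _)
      omega
  | succ n ih =>
    by_cases h1 : h = 1
    · rw [h1, wordLen_one]; omega
    by_cases hn' : ∀ p ≤ M, F p h ≤ n
    · have := ih h hn'
      omega
    push Not at hn'
    obtain ⟨q, hq, hqn⟩ := hn'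
    obtain ⟨x, hx⟩ := hD.exists_desc h h1 _ hn
    have h2 := ih (h * letterVal (artinGen _) x) (by
      intro p hp
      have h3 := hD.F_letter hp h x
      have h4 := hx p hp
      have h5 := hn p hp
      have h6 := hn q hq
      have h7 := hD.F_parity p q h
      push_cast at *
      omega)
    have h3 := wordLen_mul_letter_le (closure_artinGen _) (h * letterVal (artinGen _) x)
      (invLetter x)
    rw [letterVal_invLetter, mul_inv_cancel_right] at h3
    omega

/-- A word is geodesic if and only if one of the functionals attains its length. -/
lemma revGeodesic_iff (w : Word Bool) : RevGeodesic (artinGen (dihLabel (M : ℕ∞))) w ↔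
    ∃ p ≤ M, F p (revVal (artinGen _) w) = w.length := by
  constructor
  · intro h
    by_contra! hne
    obtain _ | ⟨x, w⟩ := w
    · exact hne 0 (Nat.zero_le _) (by simp [hD.F_one])
    have := hD.wordLen_le_of_F w.length (revVal (artinGen _) (x :: w)) (fun p hp => by
      have h1 := hD.F_le hp (x :: w)
      have h2 := hne p hp
      simp only [List.length_cons] at h1 h2
      omega)
    rw [h.wordLen_eq] at this
    simp at this
  · rintro ⟨p, hp, h⟩ v hv
    have := hD.F_le hp v
    rw [hv, h] at this
    exact_mod_cast this

end DihData

end DihedralData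

section DihedralWords

/-- The length of the maximal alternating run of constant sign at the head of a reversed word. -/
def altRun : Word Bool → ℕ
  | [] => 0
  | [_] => 1
  | x :: y :: w => if x.2 = y.2 ∧ x.1 ≠ y.1 then altRun (y :: w) + 1 else 1

lemma altRun_cons_pos (x : Bool × Bool) (w : Word Bool) : 1 ≤ altRun (x :: w) := by
  cases w <;> simp only [altRun]
  · rfl
  · split_ifs <;> omega

lemma altRun_append {u : Word Bool} {a c : Bool} (h : ∃ y ∈ u, y.2 ≠ c) :
    altRun (u ++ [(a, c)]) = altRun u := by
  induction u with
  | nil => simp at h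
  | cons x u ih =>
    obtain _ | ⟨y, w⟩ := u
    · simp at h
      simp [altRun, h]
    · simp only [List.cons_append, altRun]
      split_ifs with hxy
      · rw [← List.cons_append, ih]
        obtain ⟨t, ht, htc⟩ := h
        rcases List.mem_cons.1 ht with rfl | ht
        · exact ⟨y, by simp, by rw [← hxy.1]; exact htc⟩
        · exact ⟨t, ht, htc⟩
      · rfl

/-- The bound on alternating runs of the sign of `x`. -/
def runBound (M p : ℕ) (x : Bool × Bool) : ℕ := if x.2 then p else M - p

variable {M : ℕ} {F : ℕ → ArtinGroup (dihLabel (M : ℕ∞)) → ℤ}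
  {R : Bool → ArtinGroup (dihLabel (M : ℕ∞)) → ℕ}

/-- The functional `F p` attains the length of the word. -/
def IsGood (F : ℕ → ArtinGroup (dihLabel (M : ℕ∞)) → ℤ) (p : ℕ) (w : Word Bool) : Prop :=
  F p (revVal (artinGen _) w) = w.length

namespace DihData

variable (hD : DihData M F R)
include hD

lemma isGood_nil (p : ℕ) : IsGood F p [] := by simp [IsGood, hD.F_one]

lemma isGood_cons_iff {p : ℕ} (hp : p ≤ M) (x : Bool × Bool) (w : Word Bool) :
    IsGood F p (x :: w) ↔ IsGood F p w ∧ F p (revVal (artinGen _) w * letterVal (artinGen _) x) =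
      F p (revVal (artinGen _) w) + 1 := by
  have h1 := hD.F_letter hp (revVal (artinGen _) w) x
  have h2 := hD.F_le hp w
  simp only [IsGood, revVal_cons, List.length_cons]
  push_cast
  omega

lemma isGood_top_iff (w : Word Bool) : IsGood F M w ↔ ∀ x ∈ w, x.2 = true := by
  induction w with
  | nil => simp [hD.isGood_nil]
  | cons x w ih =>
    rw [hD.isGood_cons_iff le_rfl, ih, (hD.F_letter_extreme _ x).1]
    obtain ⟨b, _ | _⟩ := x <;> simp

lemma isGood_zero_iff (w : Word Bool) : IsGood F 0 w ↔ ∀ x ∈ w, x.2 = false := by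
  induction w with
  | nil => simp [hD.isGood_nil]
  | cons x w ih =>
    rw [hD.isGood_cons_iff (Nat.zero_le _), ih, (hD.F_letter_extreme _ x).2]
    obtain ⟨b, _ | _⟩ := x <;> simp
    omega

lemma isGood_cons_aux {p : ℕ} (hM : 3 ≤ M) (h0 : 0 < p) (hp : p < M) (x : Bool × Bool)
    (w : Word Bool) (hw : IsGood F p w)
    (hst : ∀ y ∈ w.head?, (y.2 = true → R y.1 (revVal (artinGen _) w) = 0 ∧
        R (!y.1) (revVal (artinGen _) w) = altRun w ∧ altRun w ≤ p) ∧
      (y.2 = false → R y.1 (revVal (artinGen _) w) + altRun w = M ∧ altRun w ≤ M - p)) :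
    (IsGood F p (x :: w) ↔ w.head? ≠ some (invLetter x) ∧ altRun (x :: w) ≤ runBound M p x) ∧
    (IsGood F p (x :: w) → (x.2 = true → R x.1 (revVal (artinGen _) (x :: w)) = 0 ∧
        R (!x.1) (revVal (artinGen _) (x :: w)) = altRun (x :: w)) ∧
      (x.2 = false → R x.1 (revVal (artinGen _) (x :: w)) + altRun (x :: w) = M)) := by
  rw [hD.isGood_cons_iff hp.le]
  obtain ⟨b, s⟩ := x
  have hrun : ∀ y w', w = y :: w' → 1 ≤ altRun w := by
    rintro y w' rfl; exact altRun_cons_pos _ _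
  have hz := hD.R_zero b (revVal (artinGen _) w)
  simp only [revVal_cons, hw, true_and]
  generalize hv : revVal (artinGen (dihLabel (M : ℕ∞))) w = v at *
  cases s
  · simp only [letterVal, Bool.false_eq_true, if_false, false_imp_iff,
      true_and, runBound, forall_const]
    rw [hD.F_mul_inv hp.le]
    have hi := hD.R_mul_inv (b := b) (h := v)
    obtain _ | ⟨⟨c, t⟩, w⟩ := w
    · simp only [revVal_nil] at hv
      subst hv
      simp only [hD.R_one, if_true] at hi ⊢
      simp only [List.head?_nil, altRun, hp, if_true, true_iff]
      refine ⟨⟨by simp, by omega⟩, fun _ => by omega⟩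
    · have hr := hrun _ _ rfl
      clear hv
      simp only [List.head?_cons, Option.mem_some_iff, forall_eq'] at hst
      by_cases hcb : c = b
      · subst hcb
        cases t
        · have h1 := (hst.2 rfl).1
          have h2 := (hst.2 rfl).2
          have h3 : R (!c) v = 0 := by omega
          rw [h3] at hi ⊢
          simp only [if_true] at hi
          simp [altRun, invLetter, hp]
          omega
        · have h1 := (hst.1 rfl).2
          rw [if_neg (by split_ifs <;> omega)]
          simp [invLetter]
      · obtain rfl : c = !b := by cases b <;> cases c <;> simp_all
        cases t
        · have h1 := (hst.2 rfl).1
          have h2 := (hst.2 rfl).2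
          have h3 : R (!b) v ≠ 0 := by omega
          rw [if_neg h3] at hi ⊢
          simp [altRun, invLetter]
          omega
        · have h1 := (hst.1 rfl).1
          rw [h1] at hi ⊢
          simp only [if_true] at hi
          simp [altRun, invLetter, hp]
          omega
  · simp only [letterVal, if_true, Bool.true_eq_false, false_imp_iff,
      and_true, runBound, forall_const]
    rw [hD.F_mul _ _ _ hp.le]
    have hi := hD.R_mul b v
    obtain _ | ⟨⟨c, t⟩, w⟩ := w
    · simp only [revVal_nil] at hv
      subst hv
      simp only [hD.R_one] at hi ⊢
      have := hi (by omega)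
      simp [altRun, h0]
      exact ⟨by omega, this⟩
    · have hr := hrun _ _ rfl
      clear hv
      simp only [List.head?_cons, Option.mem_some_iff, forall_eq'] at hst
      by_cases hcb : c = b
      · subst hcb
        cases t
        · have h1 := (hst.2 rfl).1
          have h2 := (hst.2 rfl).2
          rw [if_neg (by omega)]
          simp [invLetter]
        · have h1 := (hst.1 rfl).1
          rw [h1] at hi ⊢
          have := hi (by omega)
          simp [altRun, invLetter, h0]
          exact ⟨by omega, this⟩
      · obtain rfl : c = !b := by cases b <;> cases c <;> simp_all
        cases t
        · have h1 := (hst.2 rfl).1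
          have h2 := (hst.2 rfl).2
          have h3 : R b v = 0 := by omega
          rw [h3] at hi ⊢
          have := hi (by omega)
          simp [altRun, invLetter, h0]
          exact ⟨by omega, this⟩
        · have h1 := (hst.1 rfl).2
          simp only [Bool.not_not] at h1
          rw [h1.1] at hi ⊢
          simp [altRun, invLetter]
          exact fun h => hi (by omega)

lemma isGood_state {p : ℕ} (hM : 3 ≤ M) (h0 : 0 < p) (hp : p < M) (w : Word Bool)
    (hw : IsGood F p w) :
    ∀ y ∈ w.head?, (y.2 = true → R y.1 (revVal (artinGen _) w) = 0 ∧
        R (!y.1) (revVal (artinGen _) w) = altRun w ∧ altRun w ≤ p) ∧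
      (y.2 = false → R y.1 (revVal (artinGen _) w) + altRun w = M ∧ altRun w ≤ M - p) := by
  induction w with
  | nil => simp
  | cons x w ih =>
    have h1 := ((hD.isGood_cons_iff hp.le x w).1 hw).1
    have h2 := hD.isGood_cons_aux hM h0 hp x w h1 (ih h1)
    have h3 := h2.1.1 hw
    have h4 := h2.2 hw
    intro y hy
    obtain rfl : x = y := by simpa using hy
    have h5 := h3.2
    refine ⟨fun h => ⟨(h4.1 h).1, (h4.1 h).2, ?_⟩, fun h => ⟨h4.2 h, ?_⟩⟩ <;>
    · simp only [runBound, h] at h5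
      simpa using h5

lemma isGood_cons {p : ℕ} (hM : 3 ≤ M) (h0 : 0 < p) (hp : p < M) (x : Bool × Bool)
    (w : Word Bool) : IsGood F p (x :: w) ↔
      IsGood F p w ∧ w.head? ≠ some (invLetter x) ∧ altRun (x :: w) ≤ runBound M p x := by
  constructor
  · intro h
    have h1 := ((hD.isGood_cons_iff hp.le x w).1 h).1
    exact ⟨h1, (hD.isGood_cons_aux hM h0 hp x w h1 (hD.isGood_state hM h0 hp w h1)).1.1 h⟩
  · rintro ⟨h1, h2⟩
    exact (hD.isGood_cons_aux hM h0 hp x w h1 (hD.isGood_state hM h0 hp w h1)).1.2 h2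

end DihData

end DihedralWords

section DihedralFacts

/-- The facts on geodesics used from the dihedral Artin groups of large type. -/
structure DihWords {D : Type*} [Group D] (d : Bool → D) : Prop where
  closure : Subgroup.closure (Set.range d) = ⊤
  even : EvenRelations d
  head_sign : ∀ s w₁ w₂, RevGeodesic d ((s, true) :: w₁) → RevGeodesic d ((s, false) :: w₂) →
    revVal d ((s, true) :: w₁) ≠ revVal d ((s, false) :: w₂)
  double : ∀ x y : Bool × Bool, ∀ w, RevGeodesic d (y :: x :: w) →
    RevGeodesic d (y :: x :: x :: w)
  turn : ∀ x y z : Bool × Bool, ∀ n, y.1 ≠ x.1 → y.1 = z.1 →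
    RevGeodesic d (y :: x :: List.replicate n z)
  extend : ∀ (a b : Bool) (w : Word Bool), RevGeodesic d (w ++ [(a, true)]) →
    RevGeodesic d ((b, true) :: w) → RevGeodesic d ((b, true) :: (w ++ [(a, true)]))

namespace DihData

variable {M : ℕ} {F : ℕ → ArtinGroup (dihLabel (M : ℕ∞)) → ℤ}
  {R : Bool → ArtinGroup (dihLabel (M : ℕ∞)) → ℕ} (hD : DihData M F R)
include hD

lemma geodesic_of_isGood {p : ℕ} (hp : p ≤ M) {w : Word Bool} (h : IsGood F p w) :
    RevGeodesic (artinGen (dihLabel (M : ℕ∞))) w := (hD.revGeodesic_iff w).2 ⟨p, hp, h⟩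

lemma exists_isGood {w : Word Bool} (h : RevGeodesic (artinGen (dihLabel (M : ℕ∞))) w) :
    IsGood F M w ∨ IsGood F 0 w ∨ ∃ p, 0 < p ∧ p < M ∧ IsGood F p w := by
  obtain ⟨p, hp, h⟩ := (hD.revGeodesic_iff w).1 h
  rcases Nat.eq_zero_or_pos p with rfl | h0
  · exact Or.inr (Or.inl h)
  rcases hp.eq_or_lt with rfl | hp
  · exact Or.inl h
  · exact Or.inr (Or.inr ⟨p, h0, hp, h⟩)

lemma head_sign (hM : 3 ≤ M) (s : Bool) (w₁ w₂ : Word Bool)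
    (h1 : RevGeodesic (artinGen (dihLabel (M : ℕ∞))) ((s, true) :: w₁))
    (h2 : RevGeodesic (artinGen (dihLabel (M : ℕ∞))) ((s, false) :: w₂)) :
    revVal (artinGen (dihLabel (M : ℕ∞))) ((s, true) :: w₁) ≠
      revVal (artinGen (dihLabel (M : ℕ∞))) ((s, false) :: w₂) := by
  intro heq
  have hl : ((s, true) :: w₁).length = ((s, false) :: w₂).length := by
    rw [← h1.wordLen_eq, ← h2.wordLen_eq, heq]
  have hg : ∀ p, IsGood F p ((s, true) :: w₁) → IsGood F p ((s, false) :: w₂) := by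
    intro p h
    rw [IsGood, ← heq, ← hl]
    exact h
  rcases hD.exists_isGood h1 with h | h | ⟨p, h0, hp, h⟩
  · have := (hD.isGood_top_iff _).1 (hg _ h) _ List.mem_cons_self
    simp at this
  · have := (hD.isGood_zero_iff _).1 h _ List.mem_cons_self
    simp at this
  · have h3 := ((hD.isGood_state hM h0 hp _ h (s, true) rfl).1 rfl).1
    have h4 := (hD.isGood_state hM h0 hp _ (hg p h) (s, false) rfl).2 rfl
    rw [heq] at h3
    simp only at h3 h4
    omega

lemma double (hM : 3 ≤ M) (x y : Bool × Bool) (w : Word Bool)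
    (h : RevGeodesic (artinGen (dihLabel (M : ℕ∞))) (y :: x :: w)) :
    RevGeodesic (artinGen (dihLabel (M : ℕ∞))) (y :: x :: x :: w) := by
  rcases hD.exists_isGood h with h | h | ⟨p, h0, hp, h⟩
  · refine hD.geodesic_of_isGood le_rfl ((hD.isGood_top_iff _).2 ?_)
    simpa using (hD.isGood_top_iff _).1 h
  · refine hD.geodesic_of_isGood (Nat.zero_le _) ((hD.isGood_zero_iff _).2 ?_)
    simpa using (hD.isGood_zero_iff _).1 h
  · refine hD.geodesic_of_isGood hp.le ?_
    rw [hD.isGood_cons hM h0 hp] at h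
    rw [hD.isGood_cons hM h0 hp, hD.isGood_cons hM h0 hp]
    obtain ⟨hx, hc, hr⟩ := h
    have hx2 := ((hD.isGood_cons hM h0 hp _ _).1 hx).2.2
    have hr1 := altRun_cons_pos x w
    refine ⟨⟨hx, ?_, ?_⟩, ?_, ?_⟩
    · simp [invLetter, Prod.ext_iff]
    · simp [altRun]
      omega
    · simp [invLetter, Prod.ext_iff] at hc ⊢
      exact hc
    · simp only [altRun, ne_eq, not_true_eq_false, and_false, if_false] at hr ⊢
      split_ifs at hr ⊢ <;> omega

lemma isGood_replicate (hM : 3 ≤ M) {p : ℕ} (h0 : 0 < p) (hp : p < M) (z : Bool × Bool) (n : ℕ) :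
    IsGood F p (List.replicate n z) := by
  induction n with
  | zero => exact hD.isGood_nil p
  | succ n ih =>
    rw [List.replicate_succ, hD.isGood_cons hM h0 hp]
    refine ⟨ih, ?_, ?_⟩
    · cases n <;> simp [List.replicate_succ, invLetter, Prod.ext_iff]
    · have : altRun (z :: List.replicate n z) = 1 := by
        cases n <;> simp [List.replicate_succ, altRun]
      rw [this, runBound]
      split_ifs <;> omega

lemma turn (hM : 3 ≤ M) (x y z : Bool × Bool) (n : ℕ) (hxy : y.1 ≠ x.1) (hyz : y.1 = z.1) :
    RevGeodesic (artinGen (dihLabel (M : ℕ∞))) (y :: x :: List.replicate n z) := by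
  have key : ∀ p, 0 < p → p < M → altRun [x, z] ≤ runBound M p x →
      altRun [y, x, z] ≤ runBound M p y →
      RevGeodesic (artinGen (dihLabel (M : ℕ∞))) (y :: x :: List.replicate n z) := by
    intro p h0 hp h1 h2
    refine hD.geodesic_of_isGood hp.le ?_
    rw [hD.isGood_cons hM h0 hp, hD.isGood_cons hM h0 hp]
    have hr : altRun (x :: List.replicate n z) ≤ altRun [x, z] ∧
        altRun (y :: x :: List.replicate n z) ≤ altRun [y, x, z] := by
      obtain _ | n := n
      · simp only [List.replicate_zero, altRun]
        split_ifs <;> omega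
      · have : altRun (z :: List.replicate n z) = 1 := by
          cases n <;> simp [List.replicate_succ, altRun]
        simp only [List.replicate_succ, altRun, this]
        simp
    refine ⟨⟨hD.isGood_replicate hM h0 hp z n, ?_, hr.1.trans h1⟩, ?_, hr.2.trans h2⟩
    · cases n <;> simp [List.replicate_succ, invLetter, Prod.ext_iff]
      intro h3
      exact absurd (hyz.trans h3) hxy
    · simp only [List.head?_cons, invLetter, ne_eq, Option.some.injEq, Prod.ext_iff]
      exact fun h3 => hxy h3.1.symm
  obtain ⟨x, s⟩ := x
  obtain ⟨y, t⟩ := y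
  obtain ⟨z, u⟩ := z
  simp only at hxy hyz
  subst hyz
  have hxy' : x ≠ y := fun h => hxy h.symm
  have k2 := key 2 (by omega) (by omega)
  have k3 := key (M - 2) (by omega) (by omega)
  simp only [altRun, runBound, ne_eq, hxy, hxy', not_false_eq_true, and_true] at k2 k3
  cases s <;> cases t <;> cases u
  · refine hD.geodesic_of_isGood (Nat.zero_le _) ((hD.isGood_zero_iff _).2 ?_)
    simp [List.mem_replicate]
  · refine k3 ?_ ?_ <;> simp <;> omega
  · refine k3 ?_ ?_ <;> simp <;> omega
  · refine k3 ?_ ?_ <;> simp <;> omega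
  · refine k2 ?_ ?_ <;> simp <;> omega
  · refine k2 ?_ ?_ <;> simp <;> omega
  · refine k2 ?_ ?_ <;> simp
  · refine hD.geodesic_of_isGood le_rfl ((hD.isGood_top_iff _).2 ?_)
    simp [List.mem_replicate]

lemma isGood_max (hM : 3 ≤ M) {p q : ℕ} (hp0 : 0 < p) (hp : p < M) (hq0 : 0 < q) (hq : q < M)
    (a : Bool) (w : Word Bool) (h1 : IsGood F p (w ++ [(a, true)])) (h2 : IsGood F q w) :
    IsGood F (max p q) (w ++ [(a, true)]) := by
  have hm0 : 0 < max p q := by omega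
  have hm : max p q < M := by omega
  induction w with
  | nil =>
    rw [List.nil_append, hD.isGood_cons hM hm0 hm]
    exact ⟨hD.isGood_nil _, by simp, by simp [altRun, runBound]; omega⟩
  | cons x w ih =>
    rw [List.cons_append, hD.isGood_cons hM hp0 hp] at h1
    rw [hD.isGood_cons hM hq0 hq] at h2
    rw [List.cons_append, hD.isGood_cons hM hm0 hm]
    refine ⟨ih h1.1 h2.1, h1.2.1, ?_⟩
    have h3 := h1.2.2
    have h4 := h2.2.2
    obtain ⟨b, _ | _⟩ := x
    · have h5 : altRun ((b, false) :: (w ++ [(a, true)])) = altRun ((b, false) :: w) := by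
        rw [← List.cons_append]
        exact altRun_append ⟨(b, false), by simp, by simp⟩
      simp only [runBound, Bool.false_eq_true, if_false] at *
      omega
    · simp only [runBound, if_true] at *
      omega

lemma extend (hM : 3 ≤ M) (a b : Bool) (w : Word Bool)
    (h1 : RevGeodesic (artinGen (dihLabel (M : ℕ∞))) (w ++ [(a, true)]))
    (h2 : RevGeodesic (artinGen (dihLabel (M : ℕ∞))) ((b, true) :: w)) :
    RevGeodesic (artinGen (dihLabel (M : ℕ∞))) ((b, true) :: (w ++ [(a, true)])) := by
  by_cases hpos : ∀ x ∈ w, x.2 = true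
  · refine hD.geodesic_of_isGood le_rfl ((hD.isGood_top_iff _).2 ?_)
    intro x hx
    simp only [List.mem_cons, List.mem_append, List.not_mem_nil, or_false] at hx
    rcases hx with rfl | hx | rfl
    · rfl
    · exact hpos _ hx
    · rfl
  have hneg : ∃ y ∈ (b, true) :: w, y.2 ≠ true := by
    push Not at hpos
    obtain ⟨y, hy, hy'⟩ := hpos
    exact ⟨y, List.mem_cons_of_mem _ hy, by simpa using hy'⟩
  rcases hD.exists_isGood h1 with h | h | ⟨p, hp0, hp, h1⟩
  · exact absurd (fun x hx => (hD.isGood_top_iff _).1 h x (by simp [hx])) hpos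
  · have := (hD.isGood_zero_iff _).1 h (a, true) (by simp)
    simp at this
  rcases hD.exists_isGood h2 with h | h | ⟨q, hq0, hq, h2⟩
  · exact absurd (fun x hx => (hD.isGood_top_iff _).1 h x (by simp [hx])) hpos
  · have := (hD.isGood_zero_iff _).1 h (b, true) (by simp)
    simp at this
  rw [hD.isGood_cons hM hq0 hq] at h2
  have hm0 : 0 < max p q := by omega
  have hm : max p q < M := by omega
  refine hD.geodesic_of_isGood hm.le ?_
  rw [hD.isGood_cons hM hm0 hm]
  refine ⟨hD.isGood_max hM hp0 hp hq0 hq a w h1 h2.1, ?_, ?_⟩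
  · obtain _ | ⟨x, w⟩ := w
    · simp [invLetter]
    · exact h2.2.1
  · rw [← List.cons_append, altRun_append hneg]
    have := h2.2.2
    simp only [runBound, if_true] at *
    omega

end DihData

lemma dihWords_natCast {M : ℕ} (hM : 3 ≤ M) : DihWords (artinGen (dihLabel (M : ℕ∞))) := by
  obtain ⟨F, R, hD⟩ := exists_dihData hM
  exact ⟨closure_artinGen _, evenRelations_artinGen _, hD.head_sign hM, hD.double hM, hD.turn hM,
    hD.extend hM⟩

/-- For words of bounded length, geodesics of the free group are geodesics of a dihedral Artin
group with a large label. -/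
lemma exists_geodesic_transfer (N : ℕ) : ∃ M : ℕ, 3 ≤ M ∧ ∀ w : Word Bool, w.length ≤ N →
    (RevGeodesic (artinGen (dihLabel ⊤)) w ↔ RevGeodesic (artinGen (dihLabel (M : ℕ∞))) w) := by
  obtain ⟨M, hM⟩ : ∃ M, M = 2 * N + 3 := ⟨_, rfl⟩
  refine ⟨M, by omega, fun w hw => ?_⟩
  obtain ⟨F, R, hD⟩ := exists_dihData (M := M) (by omega)
  constructor
  · intro h
    refine hD.geodesic_of_isGood (p := N + 1) (by omega) ?_
    have hrun : ∀ w : Word Bool, altRun w ≤ w.length := by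
      intro w
      induction w with
      | nil => simp [altRun]
      | cons x w ih =>
        obtain _ | ⟨y, w⟩ := w
        · simp [altRun]
        · simp only [altRun, List.length_cons] at *
          split_ifs <;> omega
    induction w with
    | nil => exact hD.isGood_nil _
    | cons x w ih =>
      rw [hD.isGood_cons (by omega) (by omega) (by omega)]
      refine ⟨ih (by simp at hw; omega) h.of_cons, ?_, (hrun _).trans ?_⟩
      · intro hx
        obtain ⟨w', rfl⟩ : ∃ w', w = invLetter x :: w' := by
          cases w with
          | nil => simp at hx
          | cons y w => exact ⟨w, by simpa using hx⟩
        have := h w' (by simp)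
        simp at this
      · rw [runBound]
        split_ifs <;> omega
  · intro h
    obtain ⟨φ, hφ⟩ := exists_hom_of_alt (dihLabel ⊤) (artinGen (dihLabel (M : ℕ∞))) (by simp)
    apply revGeodesic_of_wordLen
    refine le_antisymm (wordLen_le w) ?_
    have h1 := wordLen_map_le (closure_artinGen _) φ id hφ (revVal (artinGen (dihLabel ⊤)) w)
    have h2 : φ (revVal (artinGen (dihLabel ⊤)) w) = revVal (artinGen (dihLabel (M : ℕ∞))) w := by
      clear h1 h hw
      induction w with
      | nil => simp
      | cons x w ih => rcases x with ⟨a, _ | _⟩ <;> simp [ih, letterVal, hφ]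
    rw [h2, h.wordLen_eq] at h1
    exact h1

lemma dihWords_top : DihWords (artinGen (dihLabel ⊤)) := by
  refine ⟨closure_artinGen _, evenRelations_artinGen _, ?_, ?_, ?_, ?_⟩
  · intro s w₁ w₂ h1 h2 heq
    obtain ⟨M, hM, ht⟩ := exists_geodesic_transfer (max ((s, true) :: w₁).length
      ((s, false) :: w₂).length)
    rw [ht _ (by omega)] at h1 h2
    refine (dihWords_natCast hM).head_sign s w₁ w₂ h1 h2 ?_
    obtain ⟨φ, hφ⟩ := exists_hom_of_alt (dihLabel ⊤) (artinGen (dihLabel (M : ℕ∞))) (by simp)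
    have h2 : ∀ w, φ (revVal (artinGen (dihLabel ⊤)) w) =
        revVal (artinGen (dihLabel (M : ℕ∞))) w := by
      intro w
      induction w with
      | nil => simp
      | cons x w ih => rcases x with ⟨a, _ | _⟩ <;> simp [ih, letterVal, hφ]
    rw [← h2, ← h2, heq]
  · intro x y w h
    obtain ⟨M, hM, ht⟩ := exists_geodesic_transfer (y :: x :: x :: w).length
    rw [ht _ (by simp)] at h ⊢
    exact (dihWords_natCast hM).double x y w h
  · intro x y z n hxy hyz
    obtain ⟨M, hM, ht⟩ := exists_geodesic_transfer (y :: x :: List.replicate n z).length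
    rw [ht _ le_rfl]
    exact (dihWords_natCast hM).turn x y z n hxy hyz
  · intro a b w h1 h2
    obtain ⟨M, hM, ht⟩ := exists_geodesic_transfer (w.length + 2)
    rw [ht _ (by simp)] at h1 h2 ⊢
    exact (dihWords_natCast hM).extend a b w h1 h2

lemma dihWords {k : ℕ∞} (hk : 3 ≤ k) : DihWords (artinGen (dihLabel k)) := by
  induction k using ENat.recTopCoe with
  | top => exact dihWords_top
  | coe k => exact dihWords_natCast (by exact_mod_cast hk)

end DihedralFacts

section Signs

variable {X G : Type*} [Group G] {f : X → G}

/-- The exponent of a letter. -/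
def sgn (x : X × Bool) : ℤ := if x.2 then 1 else -1

lemma letterVal_eq_zpow (x : X × Bool) : letterVal f x = f x.1 ^ sgn x := by
  rcases x with ⟨a, _ | _⟩ <;> simp [letterVal, sgn]

lemma sgn_invLetter (x : X × Bool) : sgn (invLetter x) = - sgn x := by
  rcases x with ⟨a, _ | _⟩ <;> simp [invLetter, sgn]

lemma sgn_cases (x : X × Bool) : sgn x = 1 ∨ sgn x = -1 := by
  rcases x with ⟨a, _ | _⟩ <;> simp [sgn]

lemma letter_ext {x y : X × Bool} (h : x.1 = y.1) (hs : sgn x = sgn y) : x = y := by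
  rcases x with ⟨a, _ | _⟩ <;> rcases y with ⟨b, _ | _⟩ <;> simp_all [sgn]

lemma exists_geodesic_cons (hf : Subgroup.closure (Set.range f) = ⊤) {g : G} {x : X × Bool}
    (h : wordLen f (g * letterVal f (invLetter x)) < wordLen f g) :
    ∃ w, RevGeodesic f (x :: w) ∧ revVal f (x :: w) = g := by
  obtain ⟨w, hw, hwg⟩ := exists_geodesic hf (g * letterVal f (invLetter x))
  have hg : revVal f (x :: w) = g := by simp [hw]
  refine ⟨w, ?_, hg⟩
  rw [revGeodesic_cons_iff hwg hf, ← revVal_cons, hg, hw]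
  exact h

end Signs

namespace DihWords

variable {D : Type*} [Group D] {d : Bool → D} (hd : DihWords d)
include hd

lemma not_both_desc (h : D) (x : Bool × Bool) :
    ¬ (wordLen d (h * letterVal d x) < wordLen d h ∧
      wordLen d (h * letterVal d (invLetter x)) < wordLen d h) := by
  have key : ∀ s, wordLen d (h * letterVal d (s, true)) < wordLen d h →
      wordLen d (h * letterVal d (s, false)) < wordLen d h → False := by
    intro s h1 h2
    obtain ⟨w₁, hw₁, e₁⟩ := exists_geodesic_cons hd.closure (x := (s, false)) h1
    obtain ⟨w₂, hw₂, e₂⟩ := exists_geodesic_cons hd.closure (x := (s, true)) h2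
    exact hd.head_sign s _ _ hw₂ hw₁ (e₂.trans e₁.symm)
  rintro ⟨h1, h2⟩
  obtain ⟨s, _ | _⟩ := x
  · exact key s h2 h1
  · exact key s h1 h2

lemma double_asc {h : D} {x y : Bool × Bool}
    (h1 : wordLen d (h * letterVal d (invLetter x)) < wordLen d h)
    (h2 : wordLen d h < wordLen d (h * letterVal d y)) :
    wordLen d (h * letterVal d x) < wordLen d (h * letterVal d x * letterVal d y) := by
  obtain ⟨w, hw, rfl⟩ := exists_geodesic_cons hd.closure h1
  have h3 := hd.double x y w ((revGeodesic_cons_iff hw hd.closure).2 h2)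
  have h4 := (revGeodesic_cons_iff h3.of_cons hd.closure).1 h3
  simpa using h4

lemma turn_replicate (x y z : Bool × Bool) (k n : ℕ) (hxy : y.1 ≠ x.1) (hyz : y.1 = z.1) :
    RevGeodesic d (y :: (List.replicate (k + 1) x ++ List.replicate n z)) := by
  induction k with
  | zero => exact hd.turn x y z n hxy hyz
  | succ k ih =>
    exact hd.double x y (List.replicate k x ++ List.replicate n z) ih

omit hd in
lemma exists_revVal_replicate (b : Bool) (k : ℤ) : ∃ (x : Bool × Bool) (n : ℕ),
    x.1 = b ∧ revVal d (List.replicate n x) = d b ^ k ∧ (n : ℤ) = |k| ∧ (k ≠ 0 → k = n * sgn x) := by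
  have key : ∀ (x : Bool × Bool) (n : ℕ), revVal d (List.replicate n x) = letterVal d x ^ n := by
    intro x n
    induction n with
    | zero => simp
    | succ n ih => rw [List.replicate_succ, revVal_cons, ih, pow_succ]
  obtain ⟨n, rfl | rfl⟩ := k.eq_nat_or_neg
  · exact ⟨(b, true), n, rfl, by simp [key, letterVal], by simp, by simp [sgn]⟩
  · exact ⟨(b, false), n, rfl, by simp [key, letterVal], by simp, by simp [sgn]⟩

lemma turn_asc (b : Bool) (l k : ℤ) (hk : k ≠ 0) (s : Bool) :
    wordLen d (d b ^ l * d (!b) ^ k) <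
      wordLen d (d b ^ l * d (!b) ^ k * letterVal d (b, s)) := by
  obtain ⟨z, n, hz, hzv, hn, -⟩ := exists_revVal_replicate (d := d) b l
  obtain ⟨x, k', hx, hxv, hk', -⟩ := exists_revVal_replicate (d := d) (!b) k
  obtain ⟨k', rfl⟩ : ∃ j, k' = j + 1 := by
    refine ⟨k' - 1, ?_⟩
    have : |k| ≠ 0 := abs_ne_zero.2 hk
    omega
  have h1 := hd.turn_replicate x (b, s) z k' n (by simp [hx]) hz.symm
  have h2 := (revGeodesic_cons_iff h1.of_cons hd.closure).1 h1
  rwa [revVal_append, hzv, hxv] at h2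

lemma exists_exponent (b : Bool) (h : D) :
    ∃ k : ℤ, ∀ j : ℤ, (wordLen d (h * d b ^ j) : ℤ) = wordLen d (h * d b ^ (-k)) + |j + k| := by
  set L : ℤ → ℤ := fun j => wordLen d (h * d b ^ j) with hL
  have hstep : ∀ j, L (j + 1) = L j + 1 ∨ L (j + 1) = L j - 1 := by
    intro j
    have := wordLen_mul_letter hd.closure hd.even (h * d b ^ j) (b, true)
    simp only [letterVal, if_true, mul_assoc, ← zpow_add_one] at this
    simp only [hL]
    omega
  have hmax : ∀ j, ¬ (L (j + 1) < L j ∧ L (j - 1) < L j) := by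
    intro j
    have := hd.not_both_desc (h * d b ^ j) (b, true)
    simp only [letterVal, invLetter, if_true, mul_assoc, ← zpow_add_one, Bool.not_true,
      Bool.false_eq_true, if_false, ← zpow_sub_one] at this
    simp only [hL]
    omega
  obtain ⟨j0, hj0⟩ : ∃ j0, ∀ j, L j0 ≤ L j := by
    obtain ⟨j0, hj0⟩ := exists_minimal_of_wellFoundedLT
      (fun n : ℕ => ∃ j : ℤ, wordLen d (h * d b ^ j) = n) ⟨_, 0, rfl⟩
    obtain ⟨i, hi⟩ := hj0.1
    refine ⟨i, fun j => ?_⟩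
    by_contra! hlt
    simp only [hL] at hlt
    have := hj0.2 ⟨j, rfl⟩ (by omega)
    omega
  have hup : ∀ n : ℕ, L (j0 + n) = L j0 + n ∧ L (j0 + (n + 1 : ℕ)) = L j0 + (n + 1 : ℕ) := by
    intro n
    induction n with
    | zero =>
      have h1 := hstep j0
      have h2 := hj0 (j0 + 1)
      simp
      omega
    | succ n ih =>
      refine ⟨ih.2, ?_⟩
      have h1 := hstep (j0 + (n + 1 : ℕ))
      have h2 := hmax (j0 + (n + 1 : ℕ))
      have e1 : j0 + ((n + 1 : ℕ) : ℤ) - 1 = j0 + n := by push_cast; ring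
      have e2 : j0 + ((n + 1 : ℕ) : ℤ) + 1 = j0 + ((n + 1 + 1 : ℕ) : ℤ) := by push_cast; ring
      rw [e2] at h1
      rw [e1, e2, ih.1, ih.2] at h2
      rw [ih.2] at h1
      push_cast at *
      omega
  have hdown : ∀ n : ℕ, L (j0 - n) = L j0 + n ∧ L (j0 - (n + 1 : ℕ)) = L j0 + (n + 1 : ℕ) := by
    intro n
    induction n with
    | zero =>
      have h1 := hstep (j0 - 1)
      have h2 := hj0 (j0 - 1)
      rw [sub_add_cancel] at h1
      simp
      omega
    | succ n ih =>
      refine ⟨ih.2, ?_⟩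
      have h1 := hstep (j0 - (n + 1 + 1 : ℕ))
      have h2 := hmax (j0 - (n + 1 : ℕ))
      have e1 : j0 - ((n + 1 : ℕ) : ℤ) + 1 = j0 - n := by push_cast; ring
      have e2 : j0 - ((n + 1 : ℕ) : ℤ) - 1 = j0 - ((n + 1 + 1 : ℕ) : ℤ) := by push_cast; ring
      have e3 : j0 - ((n + 1 + 1 : ℕ) : ℤ) + 1 = j0 - ((n + 1 : ℕ) : ℤ) := by push_cast; ring
      rw [e3] at h1
      rw [e1, e2, ih.1, ih.2] at h2
      rw [ih.2] at h1
      push_cast at *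
      omega
  refine ⟨-j0, fun j => ?_⟩
  rw [neg_neg]
  change L j = L j0 + |j + -j0|
  obtain ⟨n, hn⟩ := (j - j0).eq_nat_or_neg
  have e : j + -j0 = j - j0 := by ring
  rcases hn with hn | hn
  · obtain rfl : j = j0 + n := by omega
    rw [e, hn, (hup n).1]; simp
  · obtain rfl : j = j0 - n := by omega
    rw [e, hn, (hdown n).1]; simp

end DihWords

section Exponent

variable {D : Type*} [Group D]

open Classical in
/-- The exponent of the maximal power of the generator `b` at the end of `h`. -/
noncomputable def expo (d : Bool → D) (b : Bool) (h : D) : ℤ :=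
  if hk : ∃ k : ℤ, ∀ j : ℤ,
    (wordLen d (h * d b ^ j) : ℤ) = wordLen d (h * d b ^ (-k)) + |j + k| then hk.choose else 0

end Exponent

namespace DihWords

variable {D : Type*} [Group D] {d : Bool → D} (hd : DihWords d)
include hd

lemma wordLen_zpow (b : Bool) (h : D) (j : ℤ) :
    (wordLen d (h * d b ^ j) : ℤ) = wordLen d (h * d b ^ (-expo d b h)) + |j + expo d b h| := by
  have hk := hd.exists_exponent b h
  rw [expo, dif_pos hk]
  exact hk.choose_spec j

lemma expo_eq {b : Bool} {h : D} {k : ℤ} (hk : ∀ j : ℤ,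
    (wordLen d (h * d b ^ j) : ℤ) = wordLen d (h * d b ^ (-k)) + |j + k|) : expo d b h = k := by
  have h1 := hk (-expo d b h)
  have h2 := hd.wordLen_zpow b h (-k)
  have h3 := abs_nonneg (-k + expo d b h)
  have h4 : |-expo d b h + k| = 0 := by
    have := abs_nonneg (-expo d b h + k)
    omega
  have := abs_eq_zero.1 h4
  omega

lemma expo_mul_zpow (b : Bool) (h : D) (i : ℤ) : expo d b (h * d b ^ i) = expo d b h + i := by
  refine hd.expo_eq fun j => ?_
  have e1 : i + -(expo d b h + i) = -expo d b h := by ring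
  have e2 : j + (expo d b h + i) = i + j + expo d b h := by ring
  rw [mul_assoc, ← zpow_add, mul_assoc, ← zpow_add, hd.wordLen_zpow, e1, e2]

lemma asc_iff (h : D) (x : Bool × Bool) :
    wordLen d h < wordLen d (h * letterVal d x) ↔ 0 ≤ expo d x.1 h * sgn x := by
  have h0 := hd.wordLen_zpow x.1 h 0
  have h1 := hd.wordLen_zpow x.1 h (sgn x)
  rw [← letterVal_eq_zpow] at h1
  rw [zpow_zero, mul_one] at h0
  rw [← Int.ofNat_lt, h0, h1]
  generalize expo d x.1 h = k
  rw [zero_add]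
  rcases sgn_cases x with hs | hs <;> rw [hs] <;> constructor <;> intro h2 <;>
    rcases abs_cases k with h3 | h3
  · rcases abs_cases (1 + k) with h4 | h4 <;> omega
  · rcases abs_cases (1 + k) with h4 | h4 <;> omega
  · rcases abs_cases (1 + k) with h4 | h4 <;> omega
  · rcases abs_cases (1 + k) with h4 | h4 <;> omega
  · rcases abs_cases (-1 + k) with h4 | h4 <;> omega
  · rcases abs_cases (-1 + k) with h4 | h4 <;> omega
  · rcases abs_cases (-1 + k) with h4 | h4 <;> omega
  · rcases abs_cases (-1 + k) with h4 | h4 <;> omega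

lemma expo_of_asc (h : D) (b : Bool) (hasc : ∀ s, wordLen d h < wordLen d (h * letterVal d (b, s))) :
    expo d b h = 0 := by
  have h1 := (hd.asc_iff h (b, true)).1 (hasc true)
  have h2 := (hd.asc_iff h (b, false)).1 (hasc false)
  simp [sgn] at h1 h2
  omega

lemma expo_turn (b : Bool) (l k : ℤ) (hk : k ≠ 0) : expo d b (d b ^ l * d (!b) ^ k) = 0 :=
  hd.expo_of_asc _ _ (hd.turn_asc b l k hk)

lemma expo_one (b : Bool) : expo d b 1 = 0 := by
  have := hd.wordLen_zpow b 1 0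
  rw [zpow_zero, mul_one, wordLen_one] at this
  have h2 := abs_nonneg (0 + expo d b 1)
  have h3 : |0 + expo d b 1| = 0 := by push_cast at this; omega
  simpa using h3

lemma expo_zpow (b : Bool) (j : ℤ) : expo d b (d b ^ j) = j := by
  have := hd.expo_mul_zpow b 1 j
  rwa [one_mul, hd.expo_one, zero_add] at this

lemma expo_zpow_not (b : Bool) (j : ℤ) : expo d (!b) (d b ^ j) = 0 := by
  by_cases hj : j = 0
  · rw [hj, zpow_zero, hd.expo_one]
  · have := hd.expo_turn (!b) 0 j hj
    simpa using this

lemma eq_one_of_expo {h : D} (hb : ∀ b, expo d b h = 0) : h = 1 := by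
  obtain ⟨w, rfl, hw⟩ := exists_geodesic hd.closure h
  obtain _ | ⟨x, w⟩ := w
  · rfl
  · have h1 := (hd.asc_iff (revVal d (x :: w)) (invLetter x)).2 (by rw [hb]; simp)
    have h2 := (revGeodesic_cons_iff hw.of_cons hd.closure).1 hw
    rw [revVal_cons, letterVal_invLetter, mul_inv_cancel_right] at h1
    omega

lemma expo_double {h : D} {x : Bool × Bool} (hx : 0 < expo d x.1 h * sgn x)
    (h0 : expo d (!x.1) h = 0) : expo d (!x.1) (h * letterVal d x) = 0 := by
  refine hd.expo_of_asc _ _ fun s => ?_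
  refine hd.double_asc ?_ ((hd.asc_iff _ _).2 (by simp [h0]))
  have h1 := (hd.asc_iff h (invLetter x)).not.2 (by
    rw [sgn_invLetter, invLetter_fst]; linarith [mul_neg (expo d x.1 h) (sgn x)])
  have := wordLen_mul_letter hd.closure hd.even h (invLetter x)
  omega

lemma extend_asc (a b : Bool) (h : D) (h1 : wordLen d h < wordLen d (d a * h)) :
    wordLen d (h * d b) < wordLen d (d a * h * d b) := by
  obtain ⟨w, rfl, hw⟩ := exists_geodesic hd.closure h
  have e1 : d a * revVal d w = revVal d (w ++ [(a, true)]) := by simp [letterVal]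
  have h2 := wordLen_letter_mul_le hd.closure (revVal d w) (a, true)
  simp only [letterVal, if_true] at h2
  have g1 : RevGeodesic d (w ++ [(a, true)]) := by
    apply revGeodesic_of_wordLen
    rw [← e1]
    rw [hw.wordLen_eq] at *
    simp
    omega
  have h3 := wordLen_mul_letter hd.closure hd.even (revVal d w) (b, true)
  have h4 := wordLen_mul_letter hd.closure hd.even (d a * revVal d w) (b, true)
  simp only [letterVal, if_true] at h3 h4
  by_cases hb : wordLen d (revVal d w) < wordLen d (revVal d w * letterVal d (b, true))
  · have g2 := hd.extend a b w g1 ((revGeodesic_cons_iff hw hd.closure).2 hb)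
    have h5 := (revGeodesic_cons_iff g1 hd.closure).1 g2
    rw [← e1] at h5
    simp only [letterVal, if_true] at h5
    omega
  · simp only [letterVal, if_true] at hb
    omega

end DihWords

/-- A family of dihedral groups indexed by the edges of a complete graph. -/
structure EdgeSystem (X E : Type*) (D : E → Type*) [∀ e, Group (D e)] where
  /-- The two endpoints of an edge. -/
  vert : E → Bool → X
  /-- The two generators of the group of an edge. -/
  gen : ∀ e, Bool → D e
  dih : ∀ e, DihWords (gen e)
  vert_inj : ∀ e b, vert e b ≠ vert e (!b)
  exists_edge : ∀ s t, s ≠ t → ∃ e b, vert e b = s ∧ vert e (!b) = t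
  edge_unique : ∀ e e' b b', vert e b = vert e' b' → vert e (!b) = vert e' (!b') → e = e'

namespace EdgeSystem

variable {X E : Type*} {D : E → Type*} [∀ e, Group (D e)] (S : EdgeSystem X E D)

lemma vert_injective (e : E) : Function.Injective (S.vert e) := by
  intro b c h
  by_contra hbc
  have : c = !b := by cases b <;> cases c <;> simp_all
  exact S.vert_inj e b (this ▸ h)

/-- A state: an integer for each vertex and a group element for each edge. -/
structure State where
  /-- The exponent of a vertex. -/
  K : X → ℤ
  /-- The tail in the group of an edge. -/
  T : ∀ e, D e

variable {S}

open Classical in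
/-- The exponents after appending a letter. -/
noncomputable def stepK (S : EdgeSystem X E D) (x : X × Bool) (σ : State (X := X) (D := D))
    (s : X) : ℤ :=
  if s = x.1 then σ.K s + sgn x
  else if h : ∃ p : E × Bool, S.vert p.1 p.2 = s ∧ S.vert p.1 (!p.2) = x.1 then
    expo (S.gen h.choose.1) h.choose.2
      (σ.T h.choose.1 * letterVal (S.gen h.choose.1) (!h.choose.2, x.2))
  else 0

open Classical in
/-- The state after appending a letter. -/
noncomputable def step (S : EdgeSystem X E D) (x : X × Bool) (σ : State (X := X) (D := D)) :
    State (X := X) (D := D) where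
  K := stepK S x σ
  T e :=
    if h : ∃ b, S.vert e b = x.1 then σ.T e * letterVal (S.gen e) (h.choose, x.2)
    else if h : ∃ b, stepK S x σ (S.vert e b) ≠ 0 then
      S.gen e h.choose ^ stepK S x σ (S.vert e h.choose)
    else 1

lemma step_K_self (x : X × Bool) (σ : State (X := X) (D := D)) :
    (step S x σ).K x.1 = σ.K x.1 + sgn x := by
  simp [step, stepK]

lemma step_K_other {x : X × Bool} (σ : State (X := X) (D := D)) {e : E} {b : Bool}
    (h : S.vert e b = x.1) :
    (step S x σ).K (S.vert e (!b)) =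
      expo (S.gen e) (!b) (σ.T e * letterVal (S.gen e) (b, x.2)) := by
  have h1 : S.vert e (!b) ≠ x.1 := fun h' => S.vert_inj e b (h.trans h'.symm)
  have h2 : ∃ p : E × Bool, S.vert p.1 p.2 = S.vert e (!b) ∧ S.vert p.1 (!p.2) = x.1 :=
    ⟨(e, !b), rfl, by simpa using h⟩
  change stepK S x σ _ = _
  rw [stepK, if_neg h1, dif_pos h2]
  have h3 := h2.choose_spec
  generalize h2.choose = p at h3 ⊢
  obtain ⟨e', b'⟩ := p
  obtain rfl : e = e' := S.edge_unique e e' (!b) b' h3.1.symm (by simp [h3.2, h])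
  obtain rfl : b' = !b := S.vert_injective _ h3.1
  simp

lemma step_T_mem {x : X × Bool} (σ : State (X := X) (D := D)) {e : E} {b : Bool}
    (h : S.vert e b = x.1) :
    (step S x σ).T e = σ.T e * letterVal (S.gen e) (b, x.2) := by
  have h1 : ∃ b, S.vert e b = x.1 := ⟨b, h⟩
  have h2 : h1.choose = b := S.vert_injective e (h1.choose_spec.trans h.symm)
  simp only [step]
  rw [dif_pos h1, h2]

lemma step_T_not_mem {x : X × Bool} (σ : State (X := X) (D := D)) {e : E} {b : Bool}
    (h : ∀ b, S.vert e b ≠ x.1) (h0 : (step S x σ).K (S.vert e (!b)) = 0) :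
    (step S x σ).T e = S.gen e b ^ (step S x σ).K (S.vert e b) := by
  have h1 : ¬ ∃ b, S.vert e b = x.1 := fun ⟨b, hb⟩ => h b hb
  change stepK S x σ _ = 0 at h0
  change _ = S.gen e b ^ stepK S x σ (S.vert e b)
  simp only [step]
  rw [dif_neg h1]
  split_ifs with h2
  · have h3 := h2.choose_spec
    have : h2.choose = b := by
      by_contra hne
      have : h2.choose = !b := by
        generalize h2.choose = c at hne
        cases b <;> cases c <;> simp_all
      rw [this] at h3
      exact h3 h0
    rw [this]
  · simp only [not_exists, not_not] at h2
    rw [h2 b, zpow_zero]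

/-- The invariants of the states of geodesics. -/
structure Inv (S : EdgeSystem X E D) (σ : State (X := X) (D := D)) : Prop where
  expo_eq : ∀ e b, expo (S.gen e) b (σ.T e) = σ.K (S.vert e b)
  eq_zpow : ∀ e b t, t ≠ S.vert e b → σ.K (S.vert e b) ≠ 0 → σ.K t ≠ 0 → S.vert e (!b) ≠ t →
    σ.T e = S.gen e b ^ σ.K (S.vert e b)

section Inv

variable {σ σ' : State (X := X) (D := D)}

lemma Inv.eq_one (h : Inv S σ) {e : E} {b : Bool} (h1 : σ.K (S.vert e b) = 0)
    (h2 : σ.K (S.vert e (!b)) = 0) : σ.T e = 1 := by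
  refine (S.dih e).eq_one_of_expo fun c => ?_
  rw [h.expo_eq]
  by_cases hc : c = b
  · rw [hc, h1]
  · obtain rfl : c = !b := by cases b <;> cases c <;> simp_all
    exact h2

lemma Inv.eq_zero (h : Inv S σ) {s t r : X} (hst : s ≠ t) (hsr : s ≠ r) (htr : t ≠ r)
    (hs : σ.K s ≠ 0) (ht : σ.K t ≠ 0) : σ.K r = 0 := by
  by_contra hr
  obtain ⟨e, b, rfl, rfl⟩ := S.exists_edge s r hsr
  have h1 := h.eq_zpow e b t hst.symm hs ht htr.symm
  have h2 := h.expo_eq e (!b)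
  rw [h1, (S.dih e).expo_zpow_not] at h2
  exact hr h2.symm

lemma Inv.step_tail (h : Inv S σ) {x : X × Bool} (hx : 0 ≤ σ.K x.1 * sgn x) {t : X}
    (hta : t ≠ x.1) (ht : (step S x σ).K t ≠ 0) {e : E} {b : Bool} (hb : S.vert e b = x.1)
    (hut : S.vert e (!b) ≠ t) :
    σ.T e = S.gen e b ^ σ.K x.1 := by
  obtain ⟨f, c, hc, rfl⟩ := S.exists_edge x.1 t hta.symm
  have h1 := step_K_other σ hc
  rw [h1] at ht
  by_cases ha : σ.K x.1 = 0 <;> by_cases ht0 : σ.K (S.vert f (!c)) = 0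
  · rw [h.eq_one (hc.symm ▸ ha) ht0, one_mul, letterVal_eq_zpow, (S.dih f).expo_zpow_not] at ht
    exact absurd rfl ht
  · by_cases hu : σ.K (S.vert e (!b)) = 0
    · rw [ha, zpow_zero]
      exact h.eq_one (hb.symm ▸ ha) hu
    · have h2 := h.eq_zpow f (!c) _ hut ht0 hu (by
        rw [Bool.not_not, hc, ← hb]; exact S.vert_inj e b)
      refine absurd ?_ ht
      rw [h2, letterVal_eq_zpow]
      have := (S.dih f).expo_turn (!c) (σ.K (S.vert f !c)) (sgn (c, x.2)) (by
        rcases sgn_cases (c, x.2) with h | h <;> simp [h])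
      simpa using this
  · refine absurd ((S.dih f).expo_double (x := (c, x.2)) ?_ (by rw [h.expo_eq]; exact ht0)) ht
    rw [h.expo_eq]
    change 0 < σ.K (S.vert f c) * sgn x
    rw [hc]
    refine lt_of_le_of_ne hx (Ne.symm (mul_ne_zero ha ?_))
    rcases sgn_cases x with h | h <;> simp [h]
  · have := h.eq_zpow e b _ (hb ▸ hta) (hb ▸ ha) ht0 hut
    rwa [hb] at this

lemma Inv.step_zpow (h : Inv S σ) {x : X × Bool} (hx : 0 ≤ σ.K x.1 * sgn x) {t : X}
    (hta : t ≠ x.1) (ht : (step S x σ).K t ≠ 0) {e : E} {b : Bool} (hb : S.vert e b = x.1)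
    (hut : S.vert e (!b) ≠ t) :
    (step S x σ).T e = S.gen e b ^ (step S x σ).K x.1 := by
  rw [step_T_mem σ hb, h.step_tail hx hta ht hb hut, letterVal_eq_zpow, ← zpow_add, step_K_self]
  rfl

lemma Inv.step_eq_zero (h : Inv S σ) {x : X × Bool} (hx : 0 ≤ σ.K x.1 * sgn x) {t u : X}
    (hta : t ≠ x.1) (ht : (step S x σ).K t ≠ 0) (hua : u ≠ x.1) (hut : u ≠ t) :
    (step S x σ).K u = 0 := by
  obtain ⟨e, b, hb, rfl⟩ := S.exists_edge x.1 u hua.symm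
  rw [step_K_other σ hb, ← step_T_mem σ hb, h.step_zpow hx hta ht hb hut, (S.dih e).expo_zpow_not]

lemma Inv.step (h : Inv S σ) {x : X × Bool} (hx : 0 ≤ σ.K x.1 * sgn x) :
    Inv S (step S x σ) where
  expo_eq e b := by
    by_cases hb : S.vert e b = x.1
    · rw [step_T_mem σ hb, letterVal_eq_zpow, (S.dih e).expo_mul_zpow, h.expo_eq, hb, step_K_self]
      rfl
    by_cases hb' : S.vert e (!b) = x.1
    · have := step_K_other σ hb'
      rw [Bool.not_not] at this
      rw [step_T_mem σ hb', this]
    have hn : ∀ c, S.vert e c ≠ x.1 := by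
      intro c
      by_cases hc : c = b
      · rwa [hc]
      · obtain rfl : c = !b := by cases b <;> cases c <;> simp_all
        exact hb'
    by_cases h0 : (EdgeSystem.step S x σ).K (S.vert e (!b)) = 0
    · rw [step_T_not_mem σ hn h0, (S.dih e).expo_zpow]
    · have h1 := h.step_eq_zero hx hb' h0 hb (S.vert_inj e b)
      have h2 := step_T_not_mem σ (b := !b) hn (by rwa [Bool.not_not])
      have h3 := (S.dih e).expo_zpow_not (!b) ((EdgeSystem.step S x σ).K (S.vert e !b))
      rw [Bool.not_not] at h3
      rw [h2, h1, h3]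
  eq_zpow e b t htb hK ht htb' := by
    by_cases hb : S.vert e b = x.1
    · rw [hb] at htb
      rw [hb]
      exact h.step_zpow hx htb ht hb htb'
    obtain rfl : t = x.1 := by
      by_contra hta
      exact ht (h.step_eq_zero hx hb hK hta htb)
    refine step_T_not_mem σ ?_ (h.step_eq_zero hx hb hK htb' (S.vert_inj e b).symm)
    intro c
    by_cases hc : c = b
    · rwa [hc]
    · obtain rfl : c = !b := by cases b <;> cases c <;> simp_all
      exact htb'

lemma Inv.ext (h : Inv S σ) (h' : Inv S σ') {e : E} {b : Bool} (he : σ.T e = σ'.T e)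
    (h1 : σ.K (S.vert e b) ≠ 0) (h2 : σ.K (S.vert e (!b)) ≠ 0) : σ = σ' := by
  have key : ∀ c, σ.K (S.vert e c) = σ'.K (S.vert e c) := fun c => by
    rw [← h.expo_eq, ← h'.expo_eq, he]
  have hne := S.vert_inj e b
  have h1' := key b ▸ h1
  have h2' := key (!b) ▸ h2
  have hz : ∀ r, S.vert e b ≠ r → S.vert e (!b) ≠ r → σ.K r = 0 := fun r a c =>
    h.eq_zero hne a c h1 h2
  have hz' : ∀ r, S.vert e b ≠ r → S.vert e (!b) ≠ r → σ'.K r = 0 := fun r a c =>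
    h'.eq_zero hne a c h1' h2'
  have hK : σ.K = σ'.K := by
    funext r
    by_cases hr : S.vert e b = r
    · rw [← hr, key]
    by_cases hr' : S.vert e (!b) = r
    · rw [← hr', key]
    rw [hz r hr hr', hz' r hr hr']
  have hT : σ.T = σ'.T := by
    funext g
    by_cases hg : g = e
    · rw [hg, he]
    have aux : ∀ c c', S.vert g c = S.vert e c' → σ.T g = σ'.T g := by
      intro c c' hcc
      have hn : S.vert g (!c) ≠ S.vert e (!c') := fun h => hg (S.edge_unique _ _ _ _ hcc h)
      have hK1 : ∀ c', σ.K (S.vert e c') ≠ 0 := by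
        intro c'
        by_cases hc : c' = b
        · rwa [hc]
        · obtain rfl : c' = !b := by cases b <;> cases c' <;> simp_all
          exact h2
      rw [h.eq_zpow g c (S.vert e (!c')) (hcc ▸ (S.vert_inj e c').symm) (hcc ▸ hK1 c') (hK1 _) hn,
        h'.eq_zpow g c (S.vert e (!c')) (hcc ▸ (S.vert_inj e c').symm)
          (hK ▸ hcc ▸ hK1 c') (hK ▸ hK1 _) hn, hK]
    by_cases hex : ∃ c c', S.vert g c = S.vert e c'
    · obtain ⟨c, c', hcc⟩ := hex
      exact aux c c' hcc
    · simp only [not_exists] at hex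
      rw [h.eq_one (b := b) (hz _ (Ne.symm (hex _ _)) (Ne.symm (hex _ _)))
          (hz _ (Ne.symm (hex _ _)) (Ne.symm (hex _ _))),
        h'.eq_one (b := b) (hz' _ (Ne.symm (hex _ _)) (Ne.symm (hex _ _)))
          (hz' _ (Ne.symm (hex _ _)) (Ne.symm (hex _ _)))]
  cases σ; cases σ'
  simp_all

end Inv

variable (S)

/-- The state of a word (in the reversed convention). -/
noncomputable def state : Word X → State (X := X) (D := D)
  | [] => ⟨fun _ => 0, fun _ => 1⟩
  | x :: w => step S x (state w)

/-- The locally geodesic words. -/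
def Good : Word X → Prop
  | [] => True
  | x :: w => Good w ∧ 0 ≤ (S.state w).K x.1 * sgn x

variable {S}

lemma Good.inv {w : Word X} (h : S.Good w) : Inv S (S.state w) := by
  induction w with
  | nil => exact ⟨fun e b => (S.dih e).expo_one b, fun e b t _ h => absurd rfl h⟩
  | cons x w ih => exact (ih h.1).step h.2

end EdgeSystem

namespace EdgeSystem

variable {X E : Type*} {D : E → Type*} [∀ e, Group (D e)] (S : EdgeSystem X E D)

/-- The letter of the big group corresponding to a letter of an edge group. -/
def liftLetter (e : E) (x : Bool × Bool) : X × Bool := (S.vert e x.1, x.2)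

/-- The word over `X` corresponding to a word in an edge group. -/
def liftWord (e : E) (u : Word Bool) : Word X := u.map (S.liftLetter e)

@[simp] lemma liftWord_nil (e : E) : S.liftWord e [] = [] := rfl

@[simp] lemma liftWord_cons (e : E) (x : Bool × Bool) (u : Word Bool) :
    S.liftWord e (x :: u) = S.liftLetter e x :: S.liftWord e u := rfl

@[simp] lemma length_liftWord (e : E) (u : Word Bool) : (S.liftWord e u).length = u.length := by
  simp [liftWord]

@[simp] lemma liftLetter_fst (e : E) (x : Bool × Bool) : (S.liftLetter e x).1 = S.vert e x.1 := rfl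

lemma liftLetter_injective (e : E) : Function.Injective (S.liftLetter e) := by
  rintro ⟨a, s⟩ ⟨b, t⟩ h
  simp only [liftLetter, Prod.mk.injEq] at h
  rw [S.vert_injective e h.1, h.2]

variable {S}

lemma state_liftLetter_T (e : E) (x : Bool × Bool) (w : Word X) :
    (S.state (S.liftLetter e x :: w)).T e = (S.state w).T e * letterVal (S.gen e) x :=
  step_T_mem (x := S.liftLetter e x) _ rfl

lemma Good.cons_iff {e : E} {x : Bool × Bool} {w : Word X} (hw : S.Good w) :
    S.Good (S.liftLetter e x :: w) ↔
      wordLen (S.gen e) ((S.state w).T e) <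
        wordLen (S.gen e) ((S.state w).T e * letterVal (S.gen e) x) := by
  rw [(S.dih e).asc_iff, hw.inv.expo_eq]
  exact ⟨fun h => h.2, fun h => ⟨hw, h⟩⟩

lemma state_liftWord_T {e : E} {w : Word X} (h1 : (S.state w).T e = 1) (u : Word Bool) :
    (S.state (S.liftWord e u ++ w)).T e = revVal (S.gen e) u := by
  induction u with
  | nil => exact h1
  | cons x u ih => rw [liftWord_cons, List.cons_append, state_liftLetter_T, ih, revVal_cons]

lemma good_liftWord {e : E} {w : Word X} (hw : S.Good w) (h1 : (S.state w).T e = 1)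
    {u : Word Bool} (hu : RevGeodesic (S.gen e) u) : S.Good (S.liftWord e u ++ w) := by
  induction u with
  | nil => exact hw
  | cons x u ih =>
    rw [liftWord_cons, List.cons_append, (ih hu.of_cons).cons_iff, state_liftWord_T h1]
    exact (revGeodesic_cons_iff hu.of_cons (S.dih e).closure).1 hu

lemma geodesic_cons_of_good {e : E} {w : Word X} (h1 : (S.state w).T e = 1)
    {x : Bool × Bool} {u : Word Bool} (hu : RevGeodesic (S.gen e) u)
    (h : S.Good (S.liftLetter e x :: (S.liftWord e u ++ w))) : RevGeodesic (S.gen e) (x :: u) := by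
  rw [h.1.cons_iff, state_liftWord_T h1] at h
  exact (revGeodesic_cons_iff hu (S.dih e).closure).2 h

lemma _root_.LargeArtin.DihWords.expo_head {D : Type*} [Group D] {d : Bool → D} (hd : DihWords d)
    {x : Bool × Bool} {u : Word Bool} (hu : RevGeodesic d (x :: u)) :
    0 < expo d x.1 (revVal d (x :: u)) * sgn x := by
  by_contra! h
  have h1 := (hd.asc_iff (revVal d (x :: u)) (invLetter x)).2 (by
    rw [sgn_invLetter, invLetter_fst]; linarith [mul_neg (expo d x.1 (revVal d (x :: u))) (sgn x)])
  have h2 := (revGeodesic_cons_iff hu.of_cons hd.closure).1 hu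
  rw [revVal_cons, letterVal_invLetter, mul_inv_cancel_right] at h1
  omega

lemma _root_.LargeArtin.DihWords.exists_head {D : Type*} [Group D] {d : Bool → D} (hd : DihWords d)
    {x : Bool × Bool} {h : D} (hx : 0 < expo d x.1 h * sgn x) :
    ∃ u, RevGeodesic d (x :: u) ∧ revVal d (x :: u) = h := by
  refine exists_geodesic_cons hd.closure ?_
  have h1 := (hd.asc_iff h (invLetter x)).not.2 (by
    rw [sgn_invLetter, invLetter_fst]; linarith [mul_neg (expo d x.1 h) (sgn x)])
  have := wordLen_mul_letter hd.closure hd.even h (invLetter x)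
  omega

lemma _root_.LargeArtin.DihWords.head_eq {D : Type*} [Group D] {d : Bool → D} (hd : DihWords d)
    {x y : Bool × Bool} {u v : Word Bool} (hu : RevGeodesic d (x :: u)) (hv : RevGeodesic d (y :: v))
    (h : revVal d (x :: u) = revVal d (y :: v)) (hxy : x.1 = y.1) : x = y := by
  have h1 := hd.expo_head hu
  have h2 := hd.expo_head hv
  rw [← h, ← hxy] at h2
  refine letter_ext hxy ?_
  rcases sgn_cases x with hx | hx <;> rcases sgn_cases y with hy | hy <;> rw [hx] at h1 ⊢ <;>
    rw [hy] at h2 ⊢ <;> omega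

variable (S)

/-- The equivalence of good words generated by replacing geodesics in edge groups. -/
inductive Eqv : Word X → Word X → Prop
  | nil : Eqv [] []
  | cons (x : X × Bool) {v₁ v₂ : Word X} (h₁ : S.Good (x :: v₁)) (h₂ : S.Good (x :: v₂))
      (h : Eqv v₁ v₂) : Eqv (x :: v₁) (x :: v₂)
  | swap (e : E) {x y : Bool × Bool} {u₁ u₂ : Word Bool} {w v₁ v₂ : Word X} (hxy : x.1 ≠ y.1)
      (hw : S.Good w) (h1 : (S.state w).T e = 1) (hu₁ : RevGeodesic (S.gen e) (x :: u₁))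
      (hu₂ : RevGeodesic (S.gen e) (y :: u₂))
      (hu : revVal (S.gen e) (x :: u₁) = revVal (S.gen e) (y :: u₂))
      (h₁ : Eqv v₁ (S.liftWord e u₁ ++ w)) (h₂ : Eqv v₂ (S.liftWord e u₂ ++ w)) :
      Eqv (S.liftLetter e x :: v₁) (S.liftLetter e y :: v₂)

variable {S}

lemma state_cons_congr {v w : Word X} (x : X × Bool) (h : S.state v = S.state w) :
    S.state (x :: v) = S.state (x :: w) := by
  simp only [state, h]

lemma Good.cons_congr {v w : Word X} {x : X × Bool} (hx : S.Good (x :: w)) (hv : S.Good v)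
    (h : S.state v = S.state w) : S.Good (x :: v) := ⟨hv, h ▸ hx.2⟩

lemma K_liftWord_ne_zero {e : E} {w : Word X} (hw : S.Good w) (h1 : (S.state w).T e = 1)
    {x : Bool × Bool} {u : Word Bool} (hu : RevGeodesic (S.gen e) (x :: u)) :
    0 < (S.state (S.liftWord e (x :: u) ++ w)).K (S.vert e x.1) * sgn x := by
  have h2 := (good_liftWord hw h1 hu).inv.expo_eq e x.1
  rw [← h2, state_liftWord_T h1]
  exact (S.dih e).expo_head hu

lemma state_swap {e : E} {x y : Bool × Bool} {u₁ u₂ : Word Bool} {w : Word X} (hxy : x.1 ≠ y.1)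
    (hw : S.Good w) (h1 : (S.state w).T e = 1) (hu₁ : RevGeodesic (S.gen e) (x :: u₁))
    (hu₂ : RevGeodesic (S.gen e) (y :: u₂))
    (hu : revVal (S.gen e) (x :: u₁) = revVal (S.gen e) (y :: u₂)) :
    S.state (S.liftWord e (x :: u₁) ++ w) = S.state (S.liftWord e (y :: u₂) ++ w) := by
  have g1 := (good_liftWord hw h1 hu₁).inv
  have g2 := (good_liftWord hw h1 hu₂).inv
  have k1 := left_ne_zero_of_mul (K_liftWord_ne_zero hw h1 hu₁).ne'
  have k2 := left_ne_zero_of_mul (K_liftWord_ne_zero hw h1 hu₂).ne'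
  have hT : (S.state (S.liftWord e (x :: u₁) ++ w)).T e =
      (S.state (S.liftWord e (y :: u₂) ++ w)).T e := by
    rw [state_liftWord_T h1, state_liftWord_T h1, hu]
  have hy : y.1 = !x.1 := by cases hx : x.1 <;> cases hy : y.1 <;> simp_all
  refine g1.ext g2 (b := x.1) hT k1 ?_
  rw [← hy, ← g1.expo_eq, hT, g2.expo_eq]
  exact k2

lemma Eqv.main {v w : Word X} (h : S.Eqv v w) :
    S.Good v ∧ S.Good w ∧ S.state v = S.state w ∧ v.length = w.length := by
  induction h with
  | nil => exact ⟨trivial, trivial, rfl, rfl⟩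
  | cons x h₁ h₂ h ih => exact ⟨h₁, h₂, state_cons_congr x ih.2.2.1, by simp [ih.2.2.2]⟩
  | @swap e x y u₁ u₂ w v₁ v₂ hxy hw h1 hu₁ hu₂ hu h₁ h₂ ih₁ ih₂ =>
    have g1 : S.Good (S.liftLetter e x :: (S.liftWord e u₁ ++ w)) := good_liftWord hw h1 hu₁
    have g2 : S.Good (S.liftLetter e y :: (S.liftWord e u₂ ++ w)) := good_liftWord hw h1 hu₂
    refine ⟨g1.cons_congr ih₁.1 ih₁.2.2.1, g2.cons_congr ih₂.1 ih₂.2.2.1, ?_, ?_⟩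
    · rw [state_cons_congr _ ih₁.2.2.1, state_cons_congr _ ih₂.2.2.1]
      exact state_swap hxy hw h1 hu₁ hu₂ hu
    · have e1 := hu₁.wordLen_eq
      rw [hu, hu₂.wordLen_eq] at e1
      simp only [List.length_cons, ih₁.2.2.2, ih₂.2.2.2, List.length_append, length_liftWord] at *
      omega

lemma Eqv.good_left {v w : Word X} (h : S.Eqv v w) : S.Good v := h.main.1

lemma Eqv.good_right {v w : Word X} (h : S.Eqv v w) : S.Good w := h.main.2.1

lemma Eqv.state_eq {v w : Word X} (h : S.Eqv v w) : S.state v = S.state w := h.main.2.2.1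

lemma Eqv.length_eq {v w : Word X} (h : S.Eqv v w) : v.length = w.length := h.main.2.2.2

lemma Good.refl {w : Word X} (h : S.Good w) : S.Eqv w w := by
  induction w with
  | nil => exact .nil
  | cons x w ih => exact .cons x h h (ih h.1)

lemma Eqv.symm {v w : Word X} (h : S.Eqv v w) : S.Eqv w v := by
  induction h with
  | nil => exact .nil
  | cons x h₁ h₂ h ih => exact .cons x h₂ h₁ ih
  | swap e hxy hw h1 hu₁ hu₂ hu h₁ h₂ ih₁ ih₂ => exact .swap e hxy.symm hw h1 hu₂ hu₁ hu.symm h₂ h₁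

lemma Eqv.cons_left {x : X × Bool} {v w : Word X} (h : S.Eqv v w) (hx : S.Good (x :: v)) :
    S.Eqv (x :: v) (x :: w) :=
  .cons x hx (hx.cons_congr h.good_right h.state_eq.symm) h

lemma eqv_liftWord {e : E} {w : Word X} (hw : S.Good w) (h1 : (S.state w).T e = 1)
    {u u' : Word Bool} (hu : RevGeodesic (S.gen e) u) (hu' : RevGeodesic (S.gen e) u')
    (h : revVal (S.gen e) u = revVal (S.gen e) u') :
    S.Eqv (S.liftWord e u ++ w) (S.liftWord e u' ++ w) := by
  have hlen := hu.wordLen_eq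
  rw [h, hu'.wordLen_eq] at hlen
  induction u generalizing u' with
  | nil =>
    obtain rfl := List.length_eq_zero_iff.1 hlen
    exact hw.refl
  | cons x u ih =>
    obtain _ | ⟨y, u'⟩ := u'
    · simp at hlen
    by_cases hxy : x.1 = y.1
    · obtain rfl := (S.dih e).head_eq hu hu' h hxy
      refine (ih hu.of_cons hu'.of_cons (by simpa using h) (by simpa using hlen)).cons_left ?_
      exact good_liftWord hw h1 hu
    · exact .swap e hxy hw h1 hu hu' h (good_liftWord hw h1 hu.of_cons).refl
        (good_liftWord hw h1 hu'.of_cons).refl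

lemma Eqv.liftWord {e : E} {v w : Word X} (h : S.Eqv v w) (h1 : (S.state v).T e = 1)
    {u : Word Bool} (hu : RevGeodesic (S.gen e) u) :
    S.Eqv (S.liftWord e u ++ v) (S.liftWord e u ++ w) := by
  induction u with
  | nil => exact h
  | cons x u ih => exact (ih hu.of_cons).cons_left (good_liftWord h.good_left h1 hu)

lemma Eqv.tail {x : X × Bool} {v w : Word X} (h : S.Eqv (x :: v) (x :: w)) : S.Eqv v w := by
  generalize hv : x :: v = v' at h
  generalize hw : x :: w = w' at h
  cases h with
  | nil => simp at hv
  | cons y h₁ h₂ h =>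
    simp only [List.cons.injEq] at hv hw
    rwa [hv.2, hw.2]
  | swap e hxy _ _ _ _ _ _ _ =>
    simp only [List.cons.injEq] at hv hw
    exact absurd (congrArg Prod.fst (S.liftLetter_injective e (hv.1.symm.trans hw.1))) hxy

lemma Eqv.cases_swap {x y : X × Bool} {v w : Word X} (h : S.Eqv (x :: v) (y :: w))
    (hxy : x ≠ y) : ∃ (e : E) (x' y' : Bool × Bool) (u₁ u₂ : Word Bool) (w₀ : Word X),
      x'.1 ≠ y'.1 ∧ S.liftLetter e x' = x ∧ S.liftLetter e y' = y ∧ S.Good w₀ ∧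
      (S.state w₀).T e = 1 ∧ RevGeodesic (S.gen e) (x' :: u₁) ∧ RevGeodesic (S.gen e) (y' :: u₂) ∧
      revVal (S.gen e) (x' :: u₁) = revVal (S.gen e) (y' :: u₂) ∧
      S.Eqv v (S.liftWord e u₁ ++ w₀) ∧ S.Eqv w (S.liftWord e u₂ ++ w₀) := by
  generalize hv : x :: v = v' at h
  generalize hw : y :: w = w' at h
  cases h with
  | nil => simp at hv
  | cons z h₁ h₂ h =>
    simp only [List.cons.injEq] at hv hw
    exact absurd (hv.1.trans hw.1.symm) hxy
  | @swap e x' y' u₁ u₂ w₀ _ _ hne hw₀ h1 hu₁ hu₂ hu h₁ h₂ =>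
    simp only [List.cons.injEq] at hv hw
    obtain ⟨rfl, rfl⟩ := hv
    obtain ⟨rfl, rfl⟩ := hw
    exact ⟨e, x', y', u₁, u₂, w₀, hne, rfl, rfl, hw₀, h1, hu₁, hu₂, hu, h₁, h₂⟩

lemma trans_and_cancel (n : ℕ) :
    (∀ v₁ v₂ v₃ : Word X, v₁.length = n → S.Eqv v₁ v₂ → S.Eqv v₂ v₃ → S.Eqv v₁ v₃) ∧
    (∀ (e : E) (u u' : Word Bool) (w w' : Word X), (S.liftWord e u ++ w).length = n →
      S.Eqv (S.liftWord e u ++ w) (S.liftWord e u' ++ w') → S.Good w → S.Good w' →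
      (S.state w).T e = 1 → (S.state w').T e = 1 → RevGeodesic (S.gen e) u →
      RevGeodesic (S.gen e) u' → S.Eqv w w') := by
  induction n using Nat.strong_induction_on with
  | _ n IH =>
  have TT : ∀ v₁ v₂ v₃ : Word X, v₁.length < n → S.Eqv v₁ v₂ → S.Eqv v₂ v₃ → S.Eqv v₁ v₃ :=
    fun v₁ v₂ v₃ hl => (IH _ hl).1 v₁ v₂ v₃ rfl
  have CC : ∀ (e : E) (u u' : Word Bool) (w w' : Word X), (S.liftWord e u ++ w).length < n →
      S.Eqv (S.liftWord e u ++ w) (S.liftWord e u' ++ w') → S.Good w → S.Good w' →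
      (S.state w).T e = 1 → (S.state w').T e = 1 → RevGeodesic (S.gen e) u →
      RevGeodesic (S.gen e) u' → S.Eqv w w' := fun e u u' w w' hl => (IH _ hl).2 e u u' w w' rfl
  clear IH
  constructor
  · intro v₁ v₂ v₃ hl h12 h23
    obtain _ | ⟨a, v₁⟩ := v₁
    · obtain rfl := List.length_eq_zero_iff.1 h12.length_eq.symm
      exact h23
    have l12 := h12.length_eq
    have l23 := h23.length_eq
    obtain _ | ⟨b, v₂⟩ := v₂
    · simp at l12
    obtain _ | ⟨c, v₃⟩ := v₃
    · simp at l23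
    simp only [List.length_cons] at hl l12 l23
    by_cases hab : a = b
    · subst hab
      by_cases hbc : a = c
      · subst hbc
        exact (TT _ _ _ (by omega) h12.tail h23.tail).cons_left h12.good_left
      · obtain ⟨e, x, y, u₁, u₂, w, hxy, rfl, rfl, hw, h1, hu₁, hu₂, hu, k1, k2⟩ :=
          h23.cases_swap hbc
        exact .swap e hxy hw h1 hu₁ hu₂ hu (TT _ _ _ (by omega) h12.tail k1) k2
    by_cases hbc : b = c
    · subst hbc
      obtain ⟨e, x, y, u₁, u₂, w, hxy, rfl, rfl, hw, h1, hu₁, hu₂, hu, k1, k2⟩ :=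
        h12.cases_swap hab
      exact .swap e hxy hw h1 hu₁ hu₂ hu k1 (TT _ _ _ (by omega) h23.tail.symm k2)
    obtain ⟨e, x, y, u₁, u₂, w, hxy, rfl, rfl, hw, h1, hu₁, hu₂, hu, k1, k2⟩ := h12.cases_swap hab
    obtain ⟨e', x', y', u₁', u₂', w', hxy', hb, rfl, hw', h1', hu₁', hu₂', hu', k1', k2'⟩ :=
      h23.cases_swap hbc
    have s12 := h12.state_eq
    have s23 := h23.state_eq
    have sx : S.state (S.liftLetter e x :: v₁) = S.state (S.liftWord e (x :: u₁) ++ w) :=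
      state_cons_congr _ k1.state_eq
    have sy : S.state (S.liftLetter e y :: v₂) = S.state (S.liftWord e (y :: u₂) ++ w) :=
      state_cons_congr _ k2.state_eq
    have sx' : S.state (S.liftLetter e y :: v₂) = S.state (S.liftWord e' (x' :: u₁') ++ w') := by
      rw [← hb]; exact state_cons_congr _ k1'.state_eq
    have sy' : S.state (S.liftLetter e' y' :: v₃) = S.state (S.liftWord e' (y' :: u₂') ++ w') :=
      state_cons_congr _ k2'.state_eq
    have kx := K_liftWord_ne_zero hw h1 hu₁
    have ky := K_liftWord_ne_zero hw h1 hu₂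
    have kx' := K_liftWord_ne_zero hw' h1' hu₁'
    have ky' := K_liftWord_ne_zero hw' h1' hu₂'
    rw [← sx, s12] at kx
    rw [← sy] at ky
    rw [← sx'] at kx'
    rw [← sy', ← s23] at ky'
    have hyx : y.1 = !x.1 := by
      revert hxy; generalize x.1 = p; generalize y.1 = q; cases p <;> cases q <;> simp
    have hyx' : y'.1 = !x'.1 := by
      revert hxy'; generalize x'.1 = p; generalize y'.1 = q; cases p <;> cases q <;> simp
    have hb1 : S.vert e' x'.1 = S.vert e y.1 := congrArg Prod.fst hb
    have hac : S.vert e x.1 = S.vert e' y'.1 := by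
      by_contra hac
      refine left_ne_zero_of_mul ky'.ne' (h12.good_right.inv.eq_zero
        (s := S.vert e x.1) (t := S.vert e y.1) ?_ hac ?_ (left_ne_zero_of_mul kx.ne')
        (left_ne_zero_of_mul ky.ne'))
      · exact fun h => hxy (S.vert_injective e h)
      · rw [← hb1]
        exact fun h => hxy' (S.vert_injective e' h)
    obtain rfl : e = e' := S.edge_unique e e' x.1 y'.1 hac (by
      rw [← hyx, ← hb1, hyx', Bool.not_not])
    obtain rfl : x' = y := S.liftLetter_injective e hb
    have hxy1 : x.1 = y'.1 := S.vert_injective e hac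
    obtain rfl : x = y' := by
      refine letter_ext hxy1 ?_
      rw [← hxy1] at ky'
      rcases sgn_cases x with hx | hx <;> rcases sgn_cases y' with hy | hy <;> rw [hx] at kx ⊢ <;>
        rw [hy] at ky' ⊢ <;> omega
    have hww : S.Eqv w w' := by
      refine CC e u₂ u₁' w w' ?_ (TT _ _ _ ?_ k2.symm k1') hw hw' h1 h1' hu₂.of_cons hu₁'.of_cons
      · rw [← k2.length_eq]; omega
      · rw [← k2.length_eq]; omega
    have hval : revVal (S.gen e) (x' :: u₂) = revVal (S.gen e) (x' :: u₁') := by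
      rw [← state_liftWord_T h1, ← state_liftWord_T h1', ← sy, ← sx']
    have hval' : revVal (S.gen e) u₁ = revVal (S.gen e) u₂' := by
      have := (hu.trans hval).trans hu'
      simpa using this
    have m1 := hww.liftWord h1 hu₁.of_cons
    have m2 := eqv_liftWord hw' h1' hu₁.of_cons hu₂'.of_cons hval'
    refine Eqv.cons_left (TT _ _ _ (by omega) (TT _ _ _ (by omega)
      (TT _ _ _ (by omega) k1 m1) m2) k2'.symm) h12.good_left
  · intro e u u' w w' hl h hw hw' h1 h1' hu hu'
    have hval : revVal (S.gen e) u = revVal (S.gen e) u' := by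
      rw [← state_liftWord_T h1, ← state_liftWord_T h1', h.state_eq]
    have hlen := hu.wordLen_eq
    rw [hval, hu'.wordLen_eq] at hlen
    obtain _ | ⟨x, u⟩ := u
    · obtain rfl := List.length_eq_zero_iff.1 hlen
      exact h
    obtain _ | ⟨y, u'⟩ := u'
    · simp at hlen
    simp only [liftWord_cons, List.cons_append, List.length_cons, List.length_append,
      length_liftWord] at hl h
    by_cases hxy : x = y
    · subst hxy
      exact CC e u u' w w' (by simp; omega) h.tail hw hw' h1 h1' hu.of_cons hu'.of_cons
    have hne : x.1 ≠ y.1 := fun h' => hxy ((S.dih e).head_eq hu hu' hval h')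
    obtain ⟨e', a, b, u₁, u₂, w₀, hab, ha, hb, hw₀, h10, hu₁, hu₂, -, k1, k2⟩ :=
      h.cases_swap (fun h' => hxy (S.liftLetter_injective e h'))
    have ha1 : S.vert e' a.1 = S.vert e x.1 := congrArg Prod.fst ha
    have hb1 : S.vert e' b.1 = S.vert e y.1 := congrArg Prod.fst hb
    obtain rfl : e' = e := by
      refine S.edge_unique e' e a.1 x.1 ha1 ?_
      have e1 : (!a.1) = b.1 := by
        revert hab; generalize a.1 = p; generalize b.1 = q; cases p <;> cases q <;> simp
      have e2 : (!x.1) = y.1 := by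
        revert hne; generalize x.1 = p; generalize y.1 = q; cases p <;> cases q <;> simp
      rw [e1, e2, hb1]
    have l2 := k2.length_eq
    have l0 := k1.length_eq
    simp only [List.length_cons, List.length_append, length_liftWord] at hlen l2 l0
    have c1 := CC e' u u₁ w w₀ (by simp; omega) k1 hw hw₀ h1 h10 hu.of_cons hu₁.of_cons
    have c2 := CC e' u' u₂ w' w₀ (by have := h.length_eq; simp at this; simp; omega) k2 hw' hw₀
      h1' h10 hu'.of_cons hu₂.of_cons
    exact TT _ _ _ (by omega) c1 c2.symm

lemma Eqv.trans {u v w : Word X} (h : S.Eqv u v) (h' : S.Eqv v w) : S.Eqv u w :=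
  (trans_and_cancel _).1 u v w rfl h h'

lemma exists_split (n : ℕ) :
    (∀ (w : Word X) (x : X × Bool), w.length = n → S.Good w →
      0 < (S.state w).K x.1 * sgn x → ∃ v, S.Eqv w (x :: v)) ∧
    (∀ (w : Word X) (e : E), w.length = n → S.Good w → ∃ (w₀ : Word X) (u : Word Bool),
      S.Good w₀ ∧ (S.state w₀).T e = 1 ∧ RevGeodesic (S.gen e) u ∧
      S.Eqv w (S.liftWord e u ++ w₀)) := by
  induction n using Nat.strong_induction_on with
  | _ n IH =>
  have H2 : ∀ (w : Word X) (e : E), w.length < n → S.Good w → ∃ (w₀ : Word X) (u : Word Bool),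
      S.Good w₀ ∧ (S.state w₀).T e = 1 ∧ RevGeodesic (S.gen e) u ∧
      S.Eqv w (S.liftWord e u ++ w₀) := fun w e hl => (IH _ hl).2 w e rfl
  clear IH
  have H1 : ∀ (w : Word X) (x : X × Bool), w.length = n → S.Good w →
      0 < (S.state w).K x.1 * sgn x → ∃ v, S.Eqv w (x :: v) := by
    intro w x hl hw hx
    obtain _ | ⟨y, v⟩ := w
    · simp [state] at hx
    by_cases hyx : y.1 = x.1
    · have h2 := hw.2
      have h3 := step_K_self (S := S) y (S.state v)
      change (S.state (y :: v)).K y.1 = _ at h3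
      rw [← hyx, h3] at hx
      obtain rfl : y = x := by
        refine letter_ext hyx ?_
        rcases sgn_cases x with hx' | hx' <;> rcases sgn_cases y with hy | hy <;>
          rw [hx'] at hx ⊢ <;> rw [hy] at h2 hx ⊢ <;> omega
      exact ⟨v, hw.refl⟩
    · obtain ⟨e, b, hb, hb'⟩ := S.exists_edge y.1 x.1 hyx
      obtain ⟨w₀, u, hw₀, h1, hu, hv⟩ := H2 v e (by simp at hl; omega) hw.1
      obtain ⟨y, hy⟩ : ∃ y', y = S.liftLetter e (b, y') := ⟨y.2, by rw [liftLetter, hb]⟩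
      obtain ⟨x, hx'⟩ : ∃ x', x = S.liftLetter e (!b, x') := ⟨x.2, by rw [liftLetter, hb']⟩
      subst hy hx'
      have hc := hv.cons_left hw
      have hg := geodesic_cons_of_good h1 hu hc.good_right
      have hT := state_liftWord_T h1 ((b, y) :: u)
      have hK := hc.good_right.inv.expo_eq e (!b)
      rw [liftWord_cons, List.cons_append] at hT
      rw [hT] at hK
      rw [hc.state_eq, liftLetter_fst, ← hK] at hx
      obtain ⟨u', hu', he⟩ := (S.dih e).exists_head (x := (!b, x)) hx
      exact ⟨S.liftWord e u' ++ w₀,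
        .swap e (by simp) hw₀ h1 hg hu' he.symm hv (good_liftWord hw₀ h1 hu'.of_cons).refl⟩
  refine ⟨H1, fun w e hl hw => ?_⟩
  by_cases h1 : (S.state w).T e = 1
  · exact ⟨w, [], hw, h1, fun v _ => Nat.zero_le _, hw.refl⟩
  obtain ⟨b, hb⟩ : ∃ b, expo (S.gen e) b ((S.state w).T e) ≠ 0 := by
    by_contra! h
    exact h1 ((S.dih e).eq_one_of_expo h)
  obtain ⟨s, hs⟩ : ∃ s, 0 < (S.state w).K (S.vert e b) * sgn (b, s) := by
    rw [hw.inv.expo_eq] at hb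
    rcases lt_or_gt_of_ne hb with h | h
    · exact ⟨false, by simp [sgn, h]⟩
    · exact ⟨true, by simp [sgn, h]⟩
  obtain ⟨v, hv⟩ := H1 w (S.liftLetter e (b, s)) hl hw hs
  have hvl := hv.length_eq
  obtain ⟨w₀, u, hw₀, h1, hu, hv'⟩ := H2 v e (by simp at hvl; omega) hv.good_right.1
  have hc := hv'.cons_left hv.good_right
  exact ⟨w₀, (b, s) :: u, hw₀, h1, geodesic_cons_of_good h1 hu hc.good_right, hv.trans hc⟩

lemma Good.exists_cons {w : Word X} (hw : S.Good w) {x : X × Bool}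
    (hx : 0 < (S.state w).K x.1 * sgn x) : ∃ v, S.Eqv w (x :: v) :=
  (exists_split _).1 w x rfl hw hx

lemma Good.exists_liftWord {w : Word X} (hw : S.Good w) (e : E) :
    ∃ (w₀ : Word X) (u : Word Bool), S.Good w₀ ∧ (S.state w₀).T e = 1 ∧
      RevGeodesic (S.gen e) u ∧ S.Eqv w (S.liftWord e u ++ w₀) :=
  (exists_split _).2 w e rfl hw

end EdgeSystem

section

variable {X G H : Type*} [Group G] [Group H]

lemma map_revVal (φ : G →* H) (f : X → G) (w : Word X) :
    φ (revVal f w) = revVal (fun x => φ (f x)) w := by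
  induction w with
  | nil => simp
  | cons x w ih =>
    rw [revVal_cons, map_mul, ih, revVal_cons]
    congr 1
    simp only [letterVal]
    split_ifs <;> simp

end

namespace EdgeSystem

universe u

variable {X : Type u} {E : Type*} {D : E → Type*} [∀ e, Group (D e)] (S : EdgeSystem X E D)

lemma revVal_liftWord {G : Type*} [Group G] (f : X → G) (e : E) (u : Word Bool) :
    revVal f (S.liftWord e u) = revVal (fun b => f (S.vert e b)) u := by
  induction u with
  | nil => rfl
  | cons x u ih => rw [liftWord_cons, revVal_cons, revVal_cons, ih]; rfl

/-- The relation expressing that `w'` represents the product of `w` and the letter `x`. -/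
def Next (x : X × Bool) (w w' : Word X) : Prop :=
  S.Eqv w' (x :: w) ∨ S.Eqv w (invLetter x :: w')

variable {S}

lemma Next.symm {x : X × Bool} {w w' : Word X} (h : S.Next x w w') : S.Next (invLetter x) w' w := by
  rcases h with h | h
  · exact Or.inr (by rwa [invLetter_invLetter])
  · exact Or.inl h

lemma Next.good_left {x : X × Bool} {w w' : Word X} (h : S.Next x w w') : S.Good w := by
  rcases h with h | h
  · exact h.good_right.1
  · exact h.good_left

lemma Next.good_right {x : X × Bool} {w w' : Word X} (h : S.Next x w w') : S.Good w' :=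
  h.symm.good_left

lemma Good.cons_or {w : Word X} (hw : S.Good w) (x : X × Bool) :
    S.Good (x :: w) ∨ ∃ w', S.Eqv w (invLetter x :: w') := by
  by_cases hx : 0 ≤ (S.state w).K x.1 * sgn x
  · exact Or.inl ⟨hw, hx⟩
  · refine Or.inr (hw.exists_cons ?_)
    rw [sgn_invLetter, invLetter_fst]
    linarith [mul_neg ((S.state w).K x.1) (sgn x)]

lemma not_good_and_eqv {x : X × Bool} {w w' : Word X} (h : S.Good (x :: w))
    (h' : S.Eqv w (invLetter x :: w')) : False := by
  have h1 := h.2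
  have h2 := h'.good_right.2
  have h3 := step_K_self (S := S) (invLetter x) (S.state w')
  rw [h'.state_eq] at h1
  change (S.state (invLetter x :: w')).K (invLetter x).1 = _ at h3
  rw [invLetter_fst] at h2 h3
  rw [h3] at h1
  rw [sgn_invLetter] at h1 h2
  rcases sgn_cases x with hx | hx <;> rw [hx] at h1 h2 <;> omega

lemma Good.exists_next {w : Word X} (hw : S.Good w) (x : X × Bool) : ∃ w', S.Next x w w' := by
  rcases hw.cons_or x with h | ⟨w', h⟩
  · exact ⟨x :: w, Or.inl h.refl⟩
  · exact ⟨w', Or.inr h⟩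

lemma Next.eqv {x : X × Bool} {w v w' v' : Word X} (h : S.Next x w w') (h' : S.Next x v v')
    (hwv : S.Eqv w v) : S.Eqv w' v' := by
  rcases h with h | h <;> rcases h' with h' | h'
  · exact (h.trans (hwv.cons_left h.good_right)).trans h'.symm
  · exact (not_good_and_eqv h.good_right (hwv.trans h')).elim
  · exact (not_good_and_eqv h'.good_right (hwv.symm.trans h)).elim
  · exact ((h.symm.trans hwv).trans h').tail

variable (S) in
/-- The setoid of good words. -/
def goodSetoid : Setoid {w : Word X // S.Good w} where
  r v w := S.Eqv v.1 w.1
  iseqv := ⟨fun v => v.2.refl, fun h => h.symm, fun h h' => h.trans h'⟩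

variable (S) in
/-- The classes of good words. -/
def Cls : Type u := Quotient S.goodSetoid

/-- The class of a good word. -/
def cls {w : Word X} (hw : S.Good w) : S.Cls := Quotient.mk S.goodSetoid ⟨w, hw⟩

lemma cls_eq_iff {v w : Word X} (hv : S.Good v) (hw : S.Good w) :
    cls hv = cls hw ↔ S.Eqv v w := by
  refine ⟨fun h => Quotient.exact (s := S.goodSetoid) h, fun h => ?_⟩
  exact Quotient.sound (s := S.goodSetoid) h

lemma exists_cls (c : S.Cls) : ∃ (w : Word X) (hw : S.Good w), cls hw = c := by
  obtain ⟨⟨w, hw⟩, rfl⟩ := Quotient.exists_rep c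
  exact ⟨w, hw, rfl⟩

lemma exists_act (x : X × Bool) (c : S.Cls) : ∃ c' : S.Cls, ∀ (w w' : Word X)
    (h : S.Next x w w'), cls h.good_left = c → cls h.good_right = c' := by
  obtain ⟨w, hw, rfl⟩ := exists_cls c
  obtain ⟨w', h⟩ := hw.exists_next x
  refine ⟨cls h.good_right, fun v v' h' hv => ?_⟩
  rw [cls_eq_iff] at hv ⊢
  exact h'.eqv h hv

/-- The action of a letter on the classes of good words. -/
noncomputable def act (x : X × Bool) (c : S.Cls) : S.Cls := (exists_act x c).choose

lemma act_cls {x : X × Bool} {w w' : Word X} (h : S.Next x w w') :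
    act x (cls h.good_left) = cls h.good_right :=
  ((exists_act x (cls h.good_left)).choose_spec w w' h rfl).symm

lemma act_invLetter (x : X × Bool) (c : S.Cls) : act (invLetter x) (act x c) = c := by
  obtain ⟨w, hw, rfl⟩ := exists_cls c
  obtain ⟨w', h⟩ := hw.exists_next x
  have h1 := act_cls h
  have h2 := act_cls h.symm
  rw [h1, h2]

/-- The permutation of the classes of good words given by a generator. -/
noncomputable def actPerm (x : X) : (Equiv.Perm S.Cls)ᵐᵒᵖ := .op
  { toFun := act (x, true)
    invFun := act (x, false)
    left_inv := act_invLetter (x, true)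
    right_inv := act_invLetter (x, false) }

lemma letterVal_actPerm (x : X × Bool) (c : S.Cls) :
    (letterVal (S.actPerm) x).unop c = act x c := by
  obtain ⟨a, _ | _⟩ := x <;> rfl

lemma revVal_actPerm_cons (x : X × Bool) (w : Word X) (c : S.Cls) :
    (revVal S.actPerm (x :: w)).unop c = act x ((revVal S.actPerm w).unop c) := by
  rw [revVal_cons, MulOpposite.unop_mul, Equiv.Perm.mul_apply, letterVal_actPerm]

lemma revVal_actPerm_good {w : Word X} (hw : S.Good w) :
    (revVal S.actPerm w).unop (cls (S := S) (w := []) trivial) = cls hw := by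
  induction w with
  | nil => rfl
  | cons x w ih =>
    rw [revVal_actPerm_cons, ih hw.1]
    exact act_cls (Or.inl hw.refl)

lemma next_liftWord {e : E} {w : Word X} (hw : S.Good w) (h1 : (S.state w).T e = 1)
    {v v' : Word Bool} (hv : RevGeodesic (S.gen e) v) (hv' : RevGeodesic (S.gen e) v')
    (x : Bool × Bool) (h : revVal (S.gen e) v' = revVal (S.gen e) v * letterVal (S.gen e) x) :
    S.Next (S.liftLetter e x) (S.liftWord e v ++ w) (S.liftWord e v' ++ w) := by
  have hd := S.dih e
  rcases wordLen_mul_letter hd.closure hd.even (revVal (S.gen e) v) x with hl | hl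
  · refine Or.inl (eqv_liftWord (u' := x :: v) hw h1 hv' ?_ h)
    rw [revGeodesic_cons_iff hv hd.closure]
    omega
  · have h2 : revVal (S.gen e) v = revVal (S.gen e) (invLetter x :: v') := by simp [h]
    refine Or.inr (eqv_liftWord (u' := invLetter x :: v') hw h1 hv ?_ h2)
    rw [revGeodesic_cons_iff hv' hd.closure, ← revVal_cons, ← h2, h]
    omega

lemma act_liftWord {e : E} {w : Word X} (hw : S.Good w) (h1 : (S.state w).T e = 1)
    {v v' : Word Bool} (hv : RevGeodesic (S.gen e) v) (hv' : RevGeodesic (S.gen e) v')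
    (u : Word Bool) (h : revVal (S.gen e) v' = revVal (S.gen e) v * revVal (S.gen e) u) :
    (revVal S.actPerm (S.liftWord e u)).unop (cls (good_liftWord hw h1 hv)) =
      cls (good_liftWord hw h1 hv') := by
  induction u generalizing v' with
  | nil =>
    have := (cls_eq_iff (good_liftWord hw h1 hv) (good_liftWord hw h1 hv')).2
      (eqv_liftWord hw h1 hv hv' (by simpa using h.symm))
    exact this
  | cons x u ih =>
    obtain ⟨v'', e'', hv''⟩ := exists_geodesic (S.dih e).closure
      (revVal (S.gen e) v * revVal (S.gen e) u)
    rw [liftWord_cons, revVal_actPerm_cons, ih hv'' e'']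
    exact act_cls (next_liftWord hw h1 hv'' hv' x (by rw [h, e'', revVal_cons, mul_assoc]))

lemma revVal_actPerm_liftWord (e : E) {u u' : Word Bool}
    (h : revVal (S.gen e) u = revVal (S.gen e) u') :
    revVal S.actPerm (S.liftWord e u) = revVal S.actPerm (S.liftWord e u') := by
  refine MulOpposite.unop_injective (Equiv.ext fun c => ?_)
  obtain ⟨w, hw, rfl⟩ := exists_cls c
  obtain ⟨w₀, v, hw₀, h1, hv, hwv⟩ := hw.exists_liftWord e
  rw [(cls_eq_iff hw (good_liftWord hw₀ h1 hv)).2 hwv]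
  obtain ⟨v', e', hv'⟩ := exists_geodesic (S.dih e).closure
    (revVal (S.gen e) v * revVal (S.gen e) u)
  rw [act_liftWord hw₀ h1 hv hv' u e', act_liftWord hw₀ h1 hv hv' u' (h ▸ e')]

variable (S) in
/-- The group generated by `f` is the amalgam of the groups of the edges. -/
structure Amalgam {G : Type*} [Group G] (f : X → G) : Prop where
  closure : Subgroup.closure (Set.range f) = ⊤
  even : EvenRelations f
  hom : ∀ e, ∃ ι : D e →* G, ∀ b, ι (S.gen e b) = f (S.vert e b)
  lift : ∀ {H : Type u} [Group H] (π : X → H), (∀ (e : E) (u u' : Word Bool),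
    revVal (S.gen e) u = revVal (S.gen e) u' →
      revVal π (S.liftWord e u) = revVal π (S.liftWord e u')) →
    ∃ φ : G →* H, ∀ x, φ (f x) = π x

lemma revVal_liftWord_eq_map {G : Type*} [Group G] {f : X → G} {e : E} {ι : D e →* G}
    (hι : ∀ b, ι (S.gen e b) = f (S.vert e b)) (u : Word Bool) :
    revVal f (S.liftWord e u) = ι (revVal (S.gen e) u) := by
  rw [map_revVal, S.revVal_liftWord]
  simp only [hι]

namespace Amalgam

variable {G : Type*} [Group G] {f : X → G} (hA : S.Amalgam f)
include hA

lemma eqv_of_revVal {w w' : Word X} (hw : S.Good w) (hw' : S.Good w')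
    (h : revVal f w = revVal f w') : S.Eqv w w' := by
  obtain ⟨φ, hφ⟩ := hA.lift S.actPerm fun e u u' h => revVal_actPerm_liftWord e h
  have h1 := congrArg φ h
  rw [map_revVal, map_revVal] at h1
  simp only [hφ] at h1
  rw [← cls_eq_iff hw hw', ← revVal_actPerm_good hw, ← revVal_actPerm_good hw']
  exact congrArg (fun p : (Equiv.Perm S.Cls)ᵐᵒᵖ => p.unop (cls (w := []) trivial)) h1

lemma revVal_eq {w w' : Word X} (h : S.Eqv w w') : revVal f w = revVal f w' := by
  induction h with
  | nil => rfl
  | cons x h₁ h₂ h ih => rw [revVal_cons, revVal_cons, ih]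
  | @swap e x y u₁ u₂ w v₁ v₂ hxy hw h1 hu₁ hu₂ hu h₁ h₂ ih₁ ih₂ =>
    obtain ⟨ι, hι⟩ := hA.hom e
    have e1 := congrArg ι hu
    rw [← revVal_liftWord_eq_map hι, ← revVal_liftWord_eq_map hι, liftWord_cons, liftWord_cons,
      revVal_cons, revVal_cons] at e1
    rw [revVal_cons, revVal_cons, ih₁, ih₂, revVal_append, revVal_append, mul_assoc, mul_assoc, e1]

lemma exists_good (v : Word X) :
    ∃ w, S.Good w ∧ revVal f w = revVal f v ∧ w.length ≤ v.length := by
  induction v with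
  | nil => exact ⟨[], trivial, rfl, le_rfl⟩
  | cons x v ih =>
    obtain ⟨w, hw, he, hl⟩ := ih
    rcases hw.cons_or x with h | ⟨w', h⟩
    · exact ⟨x :: w, h, by rw [revVal_cons, he, revVal_cons], by simpa using hl⟩
    · have h2 := h.length_eq
      refine ⟨w', h.good_right.1, ?_, ?_⟩
      · rw [revVal_cons, ← he, hA.revVal_eq h]; simp
      · simp at h2 ⊢; omega

lemma good_revGeodesic {w : Word X} (hw : S.Good w) : RevGeodesic f w := by
  intro v hv
  obtain ⟨w', hw', he, hl⟩ := hA.exists_good v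
  rw [(hA.eqv_of_revVal hw hw' (hv.symm.trans he.symm)).length_eq]
  exact hl

lemma exists_good_eq (g : G) : ∃ w, S.Good w ∧ revVal f w = g := by
  obtain ⟨v, rfl⟩ := exists_revVal hA.closure g
  obtain ⟨w, hw, he, -⟩ := hA.exists_good v
  exact ⟨w, hw, he⟩

lemma not_both_desc (g : G) (x : X × Bool) :
    ¬ (wordLen f (g * letterVal f x) < wordLen f g ∧
      wordLen f (g * letterVal f (invLetter x)) < wordLen f g) := by
  rintro ⟨h1, h2⟩
  obtain ⟨w, hw, rfl⟩ := hA.exists_good_eq g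
  have key : ∀ y : X × Bool, wordLen f (revVal f w * letterVal f y) < wordLen f (revVal f w) →
      ¬ 0 ≤ (S.state w).K y.1 * sgn y := by
    intro y hy hK
    have h3 : S.Good (y :: w) := ⟨hw, hK⟩
    have h4 := (revGeodesic_cons_iff (hA.good_revGeodesic hw) hA.closure).1 (hA.good_revGeodesic h3)
    omega
  have h3 := key _ h1
  have h4 := key _ h2
  rw [sgn_invLetter, invLetter_fst, mul_neg] at h4
  omega

lemma exists_factor {e : E} {ι : D e →* G} (hι : ∀ b, ι (S.gen e b) = f (S.vert e b)) (g : G) :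
    ∃ r h, g = r * ι h ∧ ∀ h', wordLen f (r * ι h') = wordLen f r + wordLen (S.gen e) h' := by
  obtain ⟨w, hw, rfl⟩ := hA.exists_good_eq g
  obtain ⟨w₀, u, hw₀, h1, hu, hwu⟩ := hw.exists_liftWord e
  refine ⟨revVal f w₀, revVal (S.gen e) u, ?_, fun h' => ?_⟩
  · rw [hA.revVal_eq hwu, revVal_append, revVal_liftWord_eq_map hι]
  · obtain ⟨v, rfl, hv⟩ := exists_geodesic (S.dih e).closure h'
    rw [← revVal_liftWord_eq_map hι, ← revVal_append,
      (hA.good_revGeodesic (good_liftWord hw₀ h1 hv)).wordLen_eq,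
      (hA.good_revGeodesic hw₀).wordLen_eq, hv.wordLen_eq]
    simp [add_comm]

end Amalgam

end EdgeSystem

namespace EdgeSystem.Amalgam

universe u

variable {X : Type u} {E : Type*} {D : E → Type*} [∀ e, Group (D e)] {S : EdgeSystem X E D}
  {G : Type*} [Group G] {f : X → G} (hA : S.Amalgam f)
include hA

lemma wordLen_gen_mul_gen (a x : X) : wordLen f (f a * f x) = 2 := by
  have hg : S.Good [(x, true), (a, true)] := by
    refine ⟨⟨trivial, by simp [state]⟩, ?_⟩
    by_cases hax : a = x
    · subst hax
      have := step_K_self (S := S) (a, true) (S.state [])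
      rw [state, this]
      simp [state, sgn]
    · obtain ⟨e, b, hb, rfl⟩ := S.exists_edge a x hax
      have := step_K_other (S := S) (x := (a, true)) (S.state []) hb
      rw [state, this, letterVal_eq_zpow]
      simp [state, (S.dih e).expo_zpow_not]
  have := (hA.good_revGeodesic hg).wordLen_eq
  simpa [letterVal] using this

lemma wordLen_mul_gen_lt_of_subsingleton [Subsingleton X] (g : G) (a x : X)
    (h : wordLen f g < wordLen f (f a * g)) :
    wordLen f (g * f x) < wordLen f (f a * g * f x) := by
  obtain rfl := Subsingleton.elim a x
  have hc : f a * g = g * f a := by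
    have hg : g ∈ Subgroup.closure (Set.range f) := hA.closure ▸ Subgroup.mem_top g
    have hle : Subgroup.closure (Set.range f) ≤ Subgroup.centralizer {f a} := by
      rw [Subgroup.closure_le]
      rintro _ ⟨b, rfl⟩
      rw [Subsingleton.elim b a, SetLike.mem_coe, Subgroup.mem_centralizer_singleton_iff]
    exact (Subgroup.mem_centralizer_singleton_iff.1 (hle hg)).symm
  have h1 := hA.not_both_desc (g * f a) (a, true)
  have h2 := wordLen_mul_letter hA.closure hA.even (g * f a) (a, true)
  rw [letterVal_invLetter] at h1
  simp only [letterVal, if_true, mul_inv_cancel_right] at h1 h2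
  rw [hc] at h ⊢
  omega

/-- If left multiplication by a generator increases the length of an element, then this remains
true after right multiplication by a generator. -/
theorem wordLen_mul_gen_lt (g : G) (a x : X) (h : wordLen f g < wordLen f (f a * g)) :
    wordLen f (g * f x) < wordLen f (f a * g * f x) := by
  induction hn : wordLen f g using Nat.strong_induction_on generalizing g x with
  | _ n IH =>
  subst hn
  obtain ⟨w, hwg, hw⟩ := exists_geodesic hA.closure g
  obtain _ | ⟨y, w⟩ := w
  · obtain rfl : 1 = g := hwg
    have := wordLen_letter_le (f := f) (x, true)
    rw [mul_one, one_mul, hA.wordLen_gen_mul_gen]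
    simp only [letterVal, if_true] at this
    omega
  obtain ⟨e, b, c, rfl, hc⟩ | hss : (∃ e b c, S.vert e b = x ∧ S.vert e c = y.1) ∨
      Subsingleton X := by
    by_cases hxy : x = y.1
    · by_cases hex : ∃ z, x ≠ z
      · obtain ⟨z, hz⟩ := hex
        obtain ⟨e, b, hb, -⟩ := S.exists_edge x z hz
        exact Or.inl ⟨e, b, b, hb, hb.trans hxy⟩
      · simp only [not_exists, not_not] at hex
        exact Or.inr ⟨fun s t => (hex s).symm.trans (hex t)⟩
    · obtain ⟨e, b, hb, hb'⟩ := S.exists_edge x y.1 hxy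
      exact Or.inl ⟨e, b, !b, hb, hb'⟩
  swap
  · exact hA.wordLen_mul_gen_lt_of_subsingleton g a x h
  obtain ⟨ι, hι⟩ := hA.hom e
  obtain ⟨r, h0, rfl, hr⟩ := hA.exists_factor hι g
  obtain ⟨k, p, hkp, hk⟩ := hA.exists_factor hι (f a * r)
  have hd := S.dih e
  have hlen : ∀ h', wordLen f (f a * (r * ι h')) = wordLen f k + wordLen (S.gen e) (p * h') := by
    intro h'
    rw [← mul_assoc, hkp, mul_assoc, ← map_mul, hk]
  have hpm : ∀ h', wordLen f k + wordLen (S.gen e) (p * h') =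
      wordLen f r + wordLen (S.gen e) h' + 1 ∨ wordLen f k + wordLen (S.gen e) (p * h') + 1 =
      wordLen f r + wordLen (S.gen e) h' := by
    intro h'
    have := wordLen_letter_mul hA.closure hA.even (r * ι h') (a, true)
    simp only [letterVal, if_true] at this
    rwa [hlen, hr] at this
  have h0r : wordLen f r < wordLen f (r * ι h0) := by
    rw [hr]
    by_contra! hlt
    obtain rfl : h0 = 1 := eq_one_of_wordLen hd.closure (by omega)
    have h1 := hr (letterVal (S.gen e) (invLetter (c, y.2)))
    rw [wordLen_letter hd.even] at h1
    have h2 := (revGeodesic_cons_iff hw.of_cons hA.closure).1 hw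
    have h3 : ∀ t, ι (letterVal (S.gen e) (c, t)) = letterVal f (y.1, t) := by
      rintro (_ | _) <;> simp [letterVal, hι, hc]
    have h3 : ι (letterVal (S.gen e) (invLetter (c, y.2))) = letterVal f (invLetter y) := h3 _
    rw [map_one, mul_one, revVal_cons] at hwg
    rw [h3, ← hwg, letterVal_invLetter, mul_inv_cancel_right] at h1
    omega
  have hb : r * ι h0 * f (S.vert e b) = r * ι (h0 * S.gen e b) := by rw [map_mul, hι, mul_assoc]
  rw [mul_assoc (f a), hb, hlen, hr]
  rw [hlen, hr] at h
  have p1 := hpm 1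
  rw [mul_one, wordLen_one] at p1
  have p2 := hpm p⁻¹
  rw [mul_inv_cancel, wordLen_one] at p2
  obtain ⟨z, rfl, hz⟩ := exists_geodesic hd.closure p
  obtain _ | ⟨⟨c', s⟩, z⟩ := z
  · simp only [revVal_nil, one_mul] at h ⊢
    omega
  have hz1 := hz.wordLen_eq
  have hz2 : wordLen (S.gen e) (revVal (S.gen e) ((c', s) :: z))⁻¹ ≠ 0 := by
    intro h'
    have := eq_one_of_wordLen hd.closure h'
    rw [inv_eq_one] at this
    rw [this, wordLen_one] at hz1
    simp at hz1
  obtain rfl : z = [] := by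
    rw [← List.length_eq_zero_iff]
    simp only [List.length_cons] at hz1
    omega
  simp only [List.length_cons, List.length_nil] at hz1
  have hkr : wordLen f k = wordLen f r := by omega
  obtain _ | _ := s
  · exfalso
    have h1 := hlen 1
    have h2 := hlen (S.gen e c')
    have h3 := hr (S.gen e c')
    have h4 := wordLen_letter hd.even (c', true)
    simp only [letterVal, if_true] at h4
    simp only [map_one, mul_one] at h1
    have h5 := IH (wordLen f r) h0r r (S.vert e c') (by omega) rfl
    rw [mul_assoc, ← hι, h2, h3] at h5
    simp [letterVal, wordLen_one] at h5
    omega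
  · have := hd.extend_asc c' b h0 (by simp [letterVal] at h; omega)
    simp only [revVal_cons, revVal_nil, one_mul, letterVal, if_true, ← mul_assoc]
    omega

end EdgeSystem.Amalgam

section Suffixes

variable {X G : Type*} [Group G] {f : X → G}

lemma evalWord_cons (x : X × Bool) (w : Word X) :
    evalWord f (x :: w) = letterVal f x * evalWord f w := by
  simp [evalWord, letterVal]

lemma evalWord_append (v w : Word X) : evalWord f (v ++ w) = evalWord f v * evalWord f w := by
  simp [evalWord]

lemma isGeodesic_iff_wordLen (w : Word X) :
    IsGeodesic f w ↔ wordLen f (evalWord f w) = w.length := by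
  rw [isGeodesic_iff, evalWord_eq_revVal, ← List.length_reverse]
  exact ⟨fun h => h.wordLen_eq, revGeodesic_of_wordLen⟩

lemma wordLen_mul_evalWord_lt (hf : ∀ (g : G) (a x : X), wordLen f g < wordLen f (f a * g) →
    wordLen f (g * f x) < wordLen f (f a * g * f x)) {u : Word X} (hu : ∀ p ∈ u, p.2 = true)
    {g : G} {a : X} (h : wordLen f g < wordLen f (f a * g)) :
    wordLen f (g * evalWord f u) < wordLen f (f a * g * evalWord f u) := by
  induction u generalizing g with
  | nil => simpa [evalWord] using h
  | cons x u ih =>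
    obtain ⟨x, s⟩ := x
    obtain rfl : s = true := hu (x, s) (by simp)
    have h1 := hf g a x h
    rw [mul_assoc] at h1
    have h2 := ih (fun p hp => hu p (by simp [hp])) h1
    rw [evalWord_cons]
    simpa [letterVal, mul_assoc] using h2

lemma preservedSignSuffixes_true (hc : Subgroup.closure (Set.range f) = ⊤)
    (hp : EvenRelations f) (hf : ∀ (g : G) (a x : X), wordLen f g < wordLen f (f a * g) →
      wordLen f (g * f x) < wordLen f (f a * g * f x)) : PreservedSignSuffixes true f := by
  rintro w y hw - u ⟨⟨v, rfl⟩, -, hu, -⟩ a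
  by_cases h : IsGeodesic f ((a, true) :: (v ++ u))
  · exact ⟨_, h, rfl, v.suffix_append u |>.trans (List.suffix_cons _ _)⟩
  have hv : ¬ wordLen f (evalWord f v) < wordLen f (f a * evalWord f v) := by
    intro hlt
    have h1 := wordLen_mul_evalWord_lt hf hu hlt
    have h2 := wordLen_letter_mul_le hc (evalWord f (v ++ u)) (a, true)
    rw [isGeodesic_iff_wordLen] at h hw
    rw [evalWord_cons] at h
    rw [mul_assoc, ← evalWord_append] at h1
    simp only [letterVal, if_true, List.length_cons] at h h2
    omega
  obtain ⟨v', hv', hg⟩ := exists_geodesic hc (f a * evalWord f v)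
  have hval : evalWord f (v'.reverse ++ u) = evalWord f ((a, true) :: (v ++ u)) := by
    rw [evalWord_append, evalWord_eq_revVal f v'.reverse, List.reverse_reverse, hv', evalWord_cons,
      evalWord_append, mul_assoc]
    rfl
  refine ⟨v'.reverse ++ u, ?_, hval, List.suffix_append _ _⟩
  have h1 := wordLen_letter_mul hc hp (evalWord f v) (a, true)
  have h2 := wordLen_letter_mul hc hp (evalWord f (v ++ u)) (a, true)
  have h3 := hg.wordLen_eq
  have h4 : wordLen f (evalWord f v) ≤ v.length := by
    rw [evalWord_eq_revVal, ← List.length_reverse]; exact wordLen_le _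
  have h5 : wordLen f (evalWord f (v'.reverse ++ u)) ≤ (v'.reverse ++ u).length := by
    rw [evalWord_eq_revVal, ← List.length_reverse]; exact wordLen_le _
  rw [isGeodesic_iff_wordLen] at h hw ⊢
  rw [hval, evalWord_cons] at h5 ⊢
  rw [evalWord_cons] at h
  rw [hv'] at h3
  simp only [letterVal, if_true, List.length_cons, List.length_append, List.length_reverse] at *
  omega

/-- The word obtained by inverting every letter without reversing the order. -/
def flipWord (w : Word X) : Word X := w.map invLetter

@[simp] lemma flipWord_flipWord (w : Word X) : flipWord (flipWord w) = w := by
  simp [flipWord, Function.comp_def]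

@[simp] lemma length_flipWord (w : Word X) : (flipWord w).length = w.length := by
  simp [flipWord]

lemma evalWord_flipWord {φ : G →* G} (hφ : ∀ x, φ (f x) = (f x)⁻¹) (w : Word X) :
    evalWord f (flipWord w) = φ (evalWord f w) := by
  induction w with
  | nil => simp [evalWord, flipWord]
  | cons x w ih =>
    change evalWord f (invLetter x :: flipWord w) = _
    rw [evalWord_cons, ih, evalWord_cons, map_mul]
    rcases x with ⟨x, _ | _⟩ <;> simp [letterVal, invLetter, hφ]

lemma isGeodesic_flipWord {φ : G →* G} (hφ : ∀ x, φ (f x) = (f x)⁻¹) {w : Word X}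
    (hw : IsGeodesic f w) : IsGeodesic f (flipWord w) := by
  intro v hv
  have := hw (flipWord v) (by
    rw [evalWord_flipWord hφ, hv, ← evalWord_flipWord hφ, flipWord_flipWord])
  simpa using this

lemma flipWord_suffix {u w : Word X} (h : u <:+ w) : flipWord u <:+ flipWord w := h.map _

lemma sign_flipWord {u : Word X} {s : Bool} (h : ∀ p ∈ u, p.2 = s) :
    ∀ p ∈ flipWord u, p.2 = !s := by
  intro p hp
  obtain ⟨q, hq, rfl⟩ := List.mem_map.1 hp
  simp [invLetter, h q hq]

lemma flipWord_ne {u w : Word X} (h : u ≠ w) : flipWord u ≠ flipWord w := fun h' =>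
  h (by rw [← flipWord_flipWord u, h', flipWord_flipWord])

lemma preservedSignSuffixes_not {φ : G →* G} (hφ : ∀ x, φ (f x) = (f x)⁻¹) {s : Bool}
    (h : PreservedSignSuffixes s f) : PreservedSignSuffixes (!s) f := by
  rintro w y hw hy u ⟨h1, h2, h3, h4⟩ a
  obtain ⟨w', hw', he, hs⟩ := h (flipWord w) y (isGeodesic_flipWord hφ hw)
    (by simp [flipWord, hy, invLetter]) (flipWord u)
    ⟨flipWord_suffix h1, flipWord_ne h2, by simpa using sign_flipWord h3, fun v v1 v2 v3 => by
      have := h4 (flipWord v) (by simpa using flipWord_suffix v1)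
        (by simpa using flipWord_ne v2) (sign_flipWord v3)
      simpa using this⟩ a
  refine ⟨flipWord w', isGeodesic_flipWord hφ hw', ?_, by simpa using flipWord_suffix hs⟩
  rw [evalWord_flipWord hφ, he, ← evalWord_flipWord hφ]
  change evalWord f (invLetter (a, s) :: flipWord (flipWord w)) = _
  rw [flipWord_flipWord]
  rfl

end Suffixes

section ArtinAmalgam

universe u

variable {X : Type u}

/-- The word underlying an alternating product. -/
def altWord {Y : Type*} : ℕ → Y → Y → Word Y
  | 0, _, _ => []
  | n + 1, a, b => altWord n b a ++ [(a, true)]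

lemma revVal_altWord {Y G : Type*} [Group G] (f : Y → G) (n : ℕ) (a b : Y) :
    revVal f (altWord n a b) = alt n (f a) (f b) := by
  induction n generalizing a b with
  | zero => rfl
  | succ n ih => rw [altWord, revVal_append, ih]; simp [alt, letterVal]

lemma alt_succ_right {G : Type*} [Group G] (n : ℕ) (a b : G) :
    alt (n + 1) a b = alt n a b * if Even n then a else b := by
  induction n generalizing a b with
  | zero => simp [alt]
  | succ n ih =>
    rw [alt, ih, alt, mul_assoc]
    by_cases hn : Even n <;> simp [hn, Nat.even_add_one]

lemma inv_alt {G : Type*} [Group G] (n : ℕ) (a b : G) :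
    (alt n a b)⁻¹ = if Even n then alt n b⁻¹ a⁻¹ else alt n a⁻¹ b⁻¹ := by
  induction n generalizing a b with
  | zero => simp [alt]
  | succ n ih =>
    rw [alt, mul_inv_rev, ih, alt_succ_right, alt_succ_right]
    by_cases hn : Even n <;> simp [hn, Nat.even_add_one]

lemma alt_inv {G : Type*} [Group G] {a b : G} {n : ℕ} (h : alt n a b = alt n b a) :
    alt n a⁻¹ b⁻¹ = alt n b⁻¹ a⁻¹ := by
  have := congrArg (·⁻¹) h
  simp only [inv_alt] at this
  split_ifs at this
  · exact this.symm
  · exact this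

/-- The edge system of an Artin group of large type. -/
def artinEdges [LinearOrder X] (m : X → X → ℕ∞) (hlarge : ∀ x y : X, x ≠ y → 3 ≤ m x y) :
    EdgeSystem X {p : X × X // p.1 < p.2}
      (fun p => ArtinGroup (dihLabel (m p.1.1 p.1.2))) where
  vert p b := if b then p.1.1 else p.1.2
  gen p := artinGen _
  dih p := dihWords (hlarge _ _ p.2.ne)
  vert_inj := by
    rintro ⟨p, hp⟩ (_ | _)
    · simpa using hp.ne'
    · simpa using hp.ne
  exists_edge s t hst := by
    rcases lt_or_gt_of_ne hst with h | h
    · exact ⟨⟨(s, t), h⟩, true, by simp⟩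
    · exact ⟨⟨(t, s), h⟩, false, by simp⟩
  edge_unique := by
    rintro ⟨⟨p, p'⟩, hp⟩ ⟨⟨q, q'⟩, hq⟩ (_ | _) (_ | _) h h' <;>
      simp only [Bool.not_true, Bool.not_false, if_true, Bool.false_eq_true, if_false] at h h' hp hq
    · subst h h'; rfl
    · subst h h'; exact absurd hp hq.asymm
    · subst h h'; exact absurd hp hq.asymm
    · subst h h'; rfl

lemma artinEdges_amalgam [LinearOrder X] (m : X → X → ℕ∞) (hsymm : ∀ x y : X, m x y = m y x)
    (hlarge : ∀ x y : X, x ≠ y → 3 ≤ m x y) : (artinEdges m hlarge).Amalgam (artinGen m) where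
  closure := closure_artinGen m
  even := evenRelations_artinGen m
  hom e := by
    refine exists_hom_of_alt _ (fun b => artinGen m ((artinEdges m hlarge).vert e b)) ?_
    intro b c k hbc hk
    refine alt_artinGen m (fun h => hbc ((artinEdges m hlarge).vert_injective e h)) ?_
    rw [← hk]
    cases b <;> cases c
    · exact absurd rfl hbc
    · exact hsymm _ _
    · rfl
    · exact absurd rfl hbc
  lift π hπ := by
    refine exists_hom_of_alt m π fun x y k hxy hk => ?_
    obtain ⟨e, b, rfl, rfl⟩ := (artinEdges m hlarge).exists_edge x y hxy
    have h1 : dihLabel (m e.1.1 e.1.2) b (!b) = k := by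
      rw [← hk]
      cases b
      · exact hsymm _ _
      · rfl
    have h2 := alt_artinGen _ (by simp) h1
    rw [← revVal_altWord, ← revVal_altWord] at h2
    have h3 := hπ e _ _ h2
    rwa [EdgeSystem.revVal_liftWord, EdgeSystem.revVal_liftWord, revVal_altWord,
      revVal_altWord] at h3

end ArtinAmalgam

end LargeArtin

/-- Every Artin group of large type (all labels `≥ 3`, possibly `∞`) has
preserved signed suffixes. -/
theorem largeType_preservedSignedSuffixes {X : Type*} [Fintype X] (m : X → X → ℕ∞)
    (hsymm : ∀ x y : X, m x y = m y x)
    (hlarge : ∀ x y : X, x ≠ y → 3 ≤ m x y) :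
    PreservedSignedSuffixes (artinGen m) := by
  let _ : LinearOrder X := IsWellOrder.linearOrder WellOrderingRel
  have hA := LargeArtin.artinEdges_amalgam m hsymm hlarge
  have hT := LargeArtin.preservedSignSuffixes_true (LargeArtin.closure_artinGen m)
    (LargeArtin.evenRelations_artinGen m) fun g a x h => hA.wordLen_mul_gen_lt g a x h
  obtain ⟨φ, hφ⟩ := LargeArtin.exists_hom_of_alt m (fun x => (artinGen m x)⁻¹)
    fun x y k hxy hk => LargeArtin.alt_inv (LargeArtin.alt_artinGen m hxy hk)
  exact ⟨hT, LargeArtin.preservedSignSuffixes_not hφ hT⟩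
end
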